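/- The six linear Nakayama algebras A_{8,(1)}^{(4)}, A_{8,(1)}^{(6)}, A_{8,(2)}^{(3)}, A_{8,(2)}^{(6)}, A_{8,(4)}^{(3)} and A_{8,(4)}^{(4)} are pairwise derived equivalent, and each of them is derived equivalent to the path algebra of any orientation of the Dynkin tree E_8. -/

import Mathlib

open CategoryTheory

/-- A finite quiver: a finite vertex type, an arrow type, and source/target maps. -/
structure PreQuiver where
  V : Type
  A : Type
  [fintV : Fintype V]
  s : A → V
  t : A → V

attribute [instance] PreQuiver.fintV

/-- The defining relations presenting the path algebra of the quiver `Q` over `k`, together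
with the zero relations given by the paths (lists of composable arrows) in `R`.  The
generators are the trivial paths `Sum.inl v` (one for each vertex) and the arrows
`Sum.inr a`; multiplication of generators corresponds to concatenation of paths, so that the
resulting algebra has as a basis the paths of `Q` (not passing through a relation of `R`). -/
inductive PathAlgRel (k : Type) [Field k] (Q : PreQuiver) (R : Set (List Q.A)) :
    FreeAlgebra k (Q.V ⊕ Q.A) → FreeAlgebra k (Q.V ⊕ Q.A) → Prop
  | idem (v : Q.V) :
      PathAlgRel k Q R (FreeAlgebra.ι k (Sum.inl v) * FreeAlgebra.ι k (Sum.inl v))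
        (FreeAlgebra.ι k (Sum.inl v))
  | orth (v w : Q.V) (h : v ≠ w) :
      PathAlgRel k Q R (FreeAlgebra.ι k (Sum.inl v) * FreeAlgebra.ι k (Sum.inl w)) 0
  | unit :
      PathAlgRel k Q R (∑ v : Q.V, FreeAlgebra.ι k (Sum.inl v)) 1
  | source (a : Q.A) :
      PathAlgRel k Q R (FreeAlgebra.ι k (Sum.inl (Q.s a)) * FreeAlgebra.ι k (Sum.inr a))
        (FreeAlgebra.ι k (Sum.inr a))
  | target (a : Q.A) :
      PathAlgRel k Q R (FreeAlgebra.ι k (Sum.inr a) * FreeAlgebra.ι k (Sum.inl (Q.t a)))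
        (FreeAlgebra.ι k (Sum.inr a))
  | zeroRel (p : List Q.A) (hp : p ∈ R) :
      PathAlgRel k Q R ((p.map fun a => FreeAlgebra.ι k (Sum.inr a)).prod) 0

/-- The path algebra of the quiver `Q` over the field `k`, modulo the two-sided ideal
generated by the zero relations in `R`. -/
abbrev PathAlgebraRel (k : Type) [Field k] (Q : PreQuiver) (R : Set (List Q.A)) : Type :=
  RingQuot (PathAlgRel k Q R)

/-- The path algebra of the quiver `Q` over the field `k`. -/
abbrev PathAlgebra (k : Type) [Field k] (Q : PreQuiver) : Type :=
  PathAlgebraRel k Q ∅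

noncomputable instance (C : Type*) [Category C] [Abelian C] : HasDerivedCategory C :=
  HasDerivedCategory.standard C

/-- Two `k`-algebras are *derived equivalent* if there is a triangulated equivalence between
the derived categories of their categories of right modules (i.e. of left modules over the
opposite rings). -/
def DerivedEquivalent (k : Type) [Field k] (A : Type) [Ring A] [Algebra k A]
    (B : Type) [Ring B] [Algebra k B] : Prop :=
  ∃ (F : DerivedCategory (ModuleCat.{0} Aᵐᵒᵖ) ⥤ DerivedCategory (ModuleCat.{0} Bᵐᵒᵖ))
    (c : F.CommShift ℤ), haveI := c; (F.IsTriangulated ∧ F.IsEquivalence)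

/-- The linearly ordered quiver `A_n` of Dynkin type `A`, with vertices `1, …, n`
(realized as `Fin n`) and an arrow from each vertex to the next one. -/
def linQuiver (n : ℕ) : PreQuiver where
  V := Fin n
  A := Fin (n - 1)
  s := fun a => ⟨a.1, by have := a.2; omega⟩
  t := fun a => ⟨a.1 + 1, by have := a.2; omega⟩

/-- The path of length `l` in the quiver `A_n` starting at the (1-indexed) vertex `v`. -/
def linPath (n : ℕ) (v l : ℕ) : List (linQuiver n).A :=
  (List.range l).filterMap fun j =>
    if h : v - 1 + j < n - 1 then some ⟨v - 1 + j, h⟩ else none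

/-- The linear Nakayama algebra `A_{n,(n_0,…,n_{t-1})}^{(l_0,…,l_{t-1})}`: the quotient of
the path algebra of `A_n` over `k` by the two-sided ideal generated, for each `i`, by the
path of length `ls i` starting at the vertex `ns i`. -/
abbrev NakayamaAlgebra (k : Type) [Field k] (n t : ℕ) (ns ls : Fin t → ℕ) : Type :=
  PathAlgebraRel k (linQuiver n) {p | ∃ i : Fin t, p = linPath n (ns i) (ls i)}

/-- The hypotheses on the data of a linear Nakayama algebra
`A_{n,(n_0,…,n_{t-1})}^{(l_0,…,l_{t-1})}` with almost separate relations: each relation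
starts at a vertex `ns i ≥ 1` and has length `ls i ≥ 2`, the start vertices are strictly
increasing, the end vertices `ns i + ls i` are strictly increasing and at most `n`, and the
overlap of two relations is at most one arrow (`ns j ≥ ns i + ls i - 1` for `i < j`). -/
structure IsASNakayama (n t : ℕ) (ns ls : Fin t → ℕ) : Prop where
  one_le : ∀ i, 1 ≤ ns i
  two_le : ∀ i, 2 ≤ ls i
  start_lt : ∀ i j, i < j → ns i < ns j
  end_lt : ∀ i j, i < j → ns i + ls i < ns j + ls j
  end_le : ∀ i, ns i + ls i ≤ n
  almost_separate : ∀ i j, i < j → ns i + ls i ≤ ns j + 1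

/-- An orientation of a graph, given by a relation selecting a direction for each edge,
regarded as a quiver. -/
def orientQuiver (V : Type) [Fintype V] (o : V → V → Prop) : PreQuiver where
  V := V
  A := { p : V × V // o p.1 p.2 }
  s := fun a => a.1.1
  t := fun a => a.1.2

/-- `o` is an orientation of the simple graph `G` if each edge of `G` is directed in exactly
one way by `o`, and `o` directs nothing else. -/
def IsOrientation {V : Type} (G : SimpleGraph V) (o : V → V → Prop) : Prop :=
  (∀ v w, G.Adj v w ↔ o v w ∨ o w v) ∧ ∀ v w, o v w → ¬o w v

/-- The Dynkin tree `E_8`: a path on the seven vertices `0, 1, …, 6` together with the extra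
vertex `7` attached to the vertex `2` (the third vertex from the end `0`). -/
def dynkinE8 : SimpleGraph (Fin 8) :=
  SimpleGraph.fromRel fun x y => (y.1 = x.1 + 1 ∧ y.1 ≤ 6) ∨ (x.1 = 2 ∧ y.1 = 7)

/-- The data `(n_0, l_0)` of the six Nakayama algebras `A_{8,(1)}^{(4)}`, `A_{8,(1)}^{(6)}`,
`A_{8,(2)}^{(3)}`, `A_{8,(2)}^{(6)}`, `A_{8,(4)}^{(3)}`, `A_{8,(4)}^{(4)}`. -/
def e8Data : List (ℕ × ℕ) := [(1, 4), (1, 6), (2, 3), (2, 6), (4, 3), (4, 4)]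

section
open CategoryTheory

open CategoryTheory.Limits CategoryTheory.Pretriangulated

namespace NakE8

universe v₁ v₂ v₃ u₁ u₂ u₃

section Dm

/-- Exact functors between abelian categories. -/
class Exa {C : Type u₁} [Category.{v₁} C] [Abelian C] {D : Type u₂} [Category.{v₂} D] [Abelian D]
    (F : C ⥤ D) : Prop where
  lim : PreservesFiniteLimits F
  colim : PreservesFiniteColimits F

variable {C : Type u₁} [Category.{v₁} C] [Abelian C] {D : Type u₂} [Category.{v₂} D] [Abelian D]
  {E : Type u₃} [Category.{v₃} E] [Abelian E]

instance (F : C ⥤ D) [Exa F] : PreservesFiniteLimits F := Exa.lim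
instance (F : C ⥤ D) [Exa F] : PreservesFiniteColimits F := Exa.colim
instance (F : C ⥤ D) [Exa F] : F.Additive := Functor.additive_of_preserves_binary_products F

instance (F : C ⥤ D) (G : D ⥤ E) [Exa F] [Exa G] : Exa (F ⋙ G) where
  lim := inferInstance
  colim := inferInstance

instance : Exa (𝟭 C) where
  lim := inferInstance
  colim := inferInstance

lemma exa_of_iso {F G : C ⥤ D} (e : F ≅ G) [Exa F] : Exa G where
  lim := preservesFiniteLimits_of_natIso e
  colim := preservesFiniteColimits_of_natIso e

lemma exa_of_shortExact (F : C ⥤ D) [F.Additive]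
    (h : ∀ S : ShortComplex C, S.ShortExact → (S.map F).ShortExact) : Exa F := by
  have h0 : PreservesFiniteLimits F ∧ PreservesFiniteColimits F :=
    ((Functor.exact_tfae F).out 0 3).1 h
  exact ⟨h0.1, h0.2⟩

lemma shortExact_of_isZero {S : ShortComplex D} (h₁ : IsZero S.X₁) (h₂ : IsZero S.X₂)
    (h₃ : IsZero S.X₃) : S.ShortExact where
  exact := ShortComplex.exact_of_isZero_X₂ _ h₂
  mono_f := ⟨fun _ _ _ => h₁.eq_of_tgt _ _⟩
  epi_g := ⟨fun _ _ _ => h₃.eq_of_src _ _⟩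

lemma exa_of_isZero (F : C ⥤ D) (h : ∀ X, IsZero (F.obj X)) : Exa F := by
  have : F.Additive := ⟨fun {_ _ _ _} => (h _).eq_of_src _ _⟩
  exact exa_of_shortExact F (fun S hS => shortExact_of_isZero (h _) (h _) (h _))

/-- The derived functor of an exact functor. -/
noncomputable abbrev dm (F : C ⥤ D) [Exa F] : DerivedCategory C ⥤ DerivedCategory D :=
  F.mapDerivedCategory

/-- Natural transformations between derived functors. -/
noncomputable def dmNat {F G : C ⥤ D} [Exa F] [Exa G] (α : F ⟶ G) : dm F ⟶ dm G :=
  Localization.liftNatTrans DerivedCategory.Q (HomologicalComplex.quasiIso C (ComplexShape.up ℤ))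
    (F.mapHomologicalComplex _ ⋙ DerivedCategory.Q) (G.mapHomologicalComplex _ ⋙ DerivedCategory.Q)
    (dm F) (dm G) (Functor.whiskerRight (NatTrans.mapHomologicalComplex α _) DerivedCategory.Q)

lemma dmNat_app {F G : C ⥤ D} [Exa F] [Exa G] (α : F ⟶ G) (K : CochainComplex C ℤ) :
    (dmNat α).app (DerivedCategory.Q.obj K) = F.mapDerivedCategoryFactors.hom.app K ≫
      DerivedCategory.Q.map ((NatTrans.mapHomologicalComplex α _).app K) ≫
      G.mapDerivedCategoryFactors.inv.app K := by
  simp [dmNat]; rfl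

lemma dm_ext {T : Type*} [Category T] {F G : DerivedCategory C ⥤ T} {α β : F ⟶ G}
    (h : ∀ K, α.app (DerivedCategory.Q.obj K) = β.app (DerivedCategory.Q.obj K)) : α = β :=
  Localization.natTrans_ext DerivedCategory.Q
    (HomologicalComplex.quasiIso C (ComplexShape.up ℤ)) h

lemma dmNat_id (F : C ⥤ D) [Exa F] : dmNat (𝟙 F) = 𝟙 _ := by
  apply dm_ext; intro K
  rw [dmNat_app]
  simp

lemma dmNat_comp {F G H : C ⥤ D} [Exa F] [Exa G] [Exa H] (α : F ⟶ G) (β : G ⟶ H) :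
    dmNat (α ≫ β) = dmNat α ≫ dmNat β := by
  apply dm_ext; intro K
  simp [dmNat_app]

lemma isIso_dmNat {F G : C ⥤ D} [Exa F] [Exa G] (α : F ⟶ G) [IsIso α] : IsIso (dmNat α) :=
  ⟨dmNat (inv α), by simp [← dmNat_comp, dmNat_id], by simp [← dmNat_comp, dmNat_id]⟩

noncomputable def dmIso {F G : C ⥤ D} [Exa F] [Exa G] (α : F ≅ G) : dm F ≅ dm G where
  hom := dmNat α.hom
  inv := dmNat α.inv
  hom_inv_id := by simp [← dmNat_comp, dmNat_id]
  inv_hom_id := by simp [← dmNat_comp, dmNat_id]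

/-- compatibility of `mapHomologicalComplex` with composition -/
noncomputable def mhComp (F : C ⥤ D) (G : D ⥤ E) [Exa F] [Exa G] :
    (F ⋙ G).mapHomologicalComplex (ComplexShape.up ℤ) ≅
      F.mapHomologicalComplex (ComplexShape.up ℤ) ⋙ G.mapHomologicalComplex (ComplexShape.up ℤ) :=
  (Functor.mapHomologicalComplexCompIso (Iso.refl (F ⋙ G)) _).symm

lemma mhComp_hom (F : C ⥤ D) (G : D ⥤ E) [Exa F] [Exa G] (K : CochainComplex C ℤ) (i : ℤ) :
    ((mhComp F G).hom.app K).f i = 𝟙 (G.obj (F.obj (K.X i))) := rfl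

lemma mhComp_right {F F' : C ⥤ D} (G : D ⥤ E) [Exa F] [Exa F'] [Exa G] (α : F ⟶ F')
    (K : CochainComplex C ℤ) :
    (NatTrans.mapHomologicalComplex (Functor.whiskerRight α G) _).app K ≫ (mhComp F' G).hom.app K =
      (mhComp F G).hom.app K ≫ (G.mapHomologicalComplex _).map
        ((NatTrans.mapHomologicalComplex α _).app K) := by
  ext i
  exact (Category.comp_id (G.map (α.app (K.X i)))).trans
    (Category.id_comp (G.map (α.app (K.X i)))).symm

lemma mhComp_left (F : C ⥤ D) {G G' : D ⥤ E} [Exa F] [Exa G] [Exa G'] (α : G ⟶ G')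
    (K : CochainComplex C ℤ) :
    (NatTrans.mapHomologicalComplex (Functor.whiskerLeft F α) _).app K ≫ (mhComp F G').hom.app K =
      (mhComp F G).hom.app K ≫ (NatTrans.mapHomologicalComplex α _).app
        ((F.mapHomologicalComplex (ComplexShape.up ℤ)).obj K) := by
  ext i
  exact (Category.comp_id (α.app (F.obj (K.X i)))).trans
    (Category.id_comp (α.app (F.obj (K.X i)))).symm

noncomputable instance liftComp (F : C ⥤ D) (G : D ⥤ E) [Exa F] [Exa G] :
    Localization.Lifting DerivedCategory.Q (HomologicalComplex.quasiIso C (ComplexShape.up ℤ))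
      ((F ⋙ G).mapHomologicalComplex _ ⋙ DerivedCategory.Q) (dm F ⋙ dm G) where
  iso := (Functor.associator _ _ _).symm ≪≫
    Functor.isoWhiskerRight F.mapDerivedCategoryFactors _ ≪≫ Functor.associator _ _ _ ≪≫
    Functor.isoWhiskerLeft _ G.mapDerivedCategoryFactors ≪≫ (Functor.associator _ _ _).symm ≪≫
    Functor.isoWhiskerRight (mhComp F G).symm _

noncomputable def dmComp (F : C ⥤ D) (G : D ⥤ E) [Exa F] [Exa G] :
    dm (F ⋙ G) ≅ dm F ⋙ dm G :=
  Localization.liftNatIso DerivedCategory.Q (HomologicalComplex.quasiIso C (ComplexShape.up ℤ))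
    ((F ⋙ G).mapHomologicalComplex _ ⋙ DerivedCategory.Q)
    ((F ⋙ G).mapHomologicalComplex _ ⋙ DerivedCategory.Q) _ _ (Iso.refl _)

lemma dmComp_app (F : C ⥤ D) (G : D ⥤ E) [Exa F] [Exa G] (K : CochainComplex C ℤ) :
    (dmComp F G).hom.app (DerivedCategory.Q.obj K) =
      (F ⋙ G).mapDerivedCategoryFactors.hom.app K ≫
      DerivedCategory.Q.map ((mhComp F G).hom.app K) ≫
      G.mapDerivedCategoryFactors.inv.app ((F.mapHomologicalComplex _).obj K) ≫
      (dm G).map (F.mapDerivedCategoryFactors.inv.app K) := by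
  simp [dmComp, Localization.liftNatIso, liftComp]
  rfl

lemma dmComp_whiskerRight {F F' : C ⥤ D} (G : D ⥤ E) [Exa F] [Exa F'] [Exa G] (α : F ⟶ F')
    (X : DerivedCategory C) :
    (dmNat (Functor.whiskerRight α G)).app X ≫ (dmComp F' G).hom.app X =
      (dmComp F G).hom.app X ≫ (dm G).map ((dmNat α).app X) := by
  suffices h : dmNat (Functor.whiskerRight α G) ≫ (dmComp F' G).hom =
      (dmComp F G).hom ≫ Functor.whiskerRight (dmNat α) (dm G) by
    exact NatTrans.congr_app h X
  apply dm_ext; intro K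
  simp [dmNat_app, dmComp_app, ← Functor.map_comp_assoc, ← Functor.map_comp]
  simp only [← Functor.map_comp_assoc, mhComp_right]
  simp
  have := G.mapDerivedCategoryFactors.inv.naturality ((NatTrans.mapHomologicalComplex α _).app K)
  simp at this
  rw [reassoc_of% this]

lemma dmComp_whiskerLeft (F : C ⥤ D) {G G' : D ⥤ E} [Exa F] [Exa G] [Exa G'] (α : G ⟶ G')
    (X : DerivedCategory C) :
    (dmNat (Functor.whiskerLeft F α)).app X ≫ (dmComp F G').hom.app X =
      (dmComp F G).hom.app X ≫ (dmNat α).app ((dm F).obj X) := by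
  suffices h : dmNat (Functor.whiskerLeft F α) ≫ (dmComp F G').hom =
      (dmComp F G).hom ≫ Functor.whiskerLeft (dm F) (dmNat α) by
    exact NatTrans.congr_app h X
  apply dm_ext; intro K
  simp [dmNat_app, dmComp_app]
  simp only [← Functor.map_comp_assoc, mhComp_left]

noncomputable def dmId : dm (𝟭 C) ≅ 𝟭 _ :=
  haveI : Localization.Lifting DerivedCategory.Q
    (HomologicalComplex.quasiIso C (ComplexShape.up ℤ))
      ((𝟭 C).mapHomologicalComplex _ ⋙ DerivedCategory.Q) (𝟭 (DerivedCategory C)) :=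
    ⟨NatIso.ofComponents (fun K => Iso.refl _) (by intros; simp; rfl)⟩
  Localization.liftNatIso DerivedCategory.Q (HomologicalComplex.quasiIso C (ComplexShape.up ℤ))
    ((𝟭 C).mapHomologicalComplex _ ⋙ DerivedCategory.Q)
    ((𝟭 C).mapHomologicalComplex _ ⋙ DerivedCategory.Q) _ _ (Iso.refl _)

lemma dmNat_zero {F G : C ⥤ D} [Exa F] [Exa G] : dmNat (0 : F ⟶ G) = 0 := by
  apply dm_ext; intro K
  have : (NatTrans.mapHomologicalComplex (0 : F ⟶ G) (ComplexShape.up ℤ)).app K = 0 := by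
    ext; simp; rfl
  rw [dmNat_app, this]; simp

lemma isZero_dm (F : C ⥤ D) [Exa F] (h : ∀ X, IsZero (F.obj X)) (X : DerivedCategory C) :
    IsZero ((dm F).obj X) := by
  have h1 : 𝟙 F = 0 := by ext X; exact (h X).eq_of_src _ _
  rw [IsZero.iff_id_eq_zero]
  have := dmNat_id F
  rw [h1, dmNat_zero] at this
  simpa using (NatTrans.congr_app this X).symm

lemma exists_dist_of_iso {T : Type*} [Category T] [HasZeroObject T] [HasShift T ℤ] [Preadditive T]
    [∀ n : ℤ, (shiftFunctor T n).Additive] [Pretriangulated T] {X Y Z X' Y' Z' : T}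
    {f' : X' ⟶ Y'} {g' : Y' ⟶ Z'} {h' : Z' ⟶ X'⟦(1 : ℤ)⟧} (hT : Triangle.mk f' g' h' ∈ distTriang T)
    (f : X ⟶ Y) (g : Y ⟶ Z) (e₁ : X ≅ X') (e₂ : Y ≅ Y') (e₃ : Z ≅ Z')
    (hf : f ≫ e₂.hom = e₁.hom ≫ f') (hg : g ≫ e₃.hom = e₂.hom ≫ g') :
    ∃ δ : Z ⟶ X⟦(1 : ℤ)⟧, Triangle.mk f g δ ∈ distTriang T := by
  refine ⟨e₃.hom ≫ h' ≫ e₁.inv⟦1⟧', ?_⟩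
  refine isomorphic_distinguished _ hT _ (Triangle.isoMk _ _ e₁ e₂ e₃ hf hg ?_)
  have h2 : e₁.inv⟦(1 : ℤ)⟧' ≫ e₁.hom⟦(1 : ℤ)⟧' = 𝟙 _ := by simp [← Functor.map_comp]
  change (e₃.hom ≫ h' ≫ e₁.inv⟦(1 : ℤ)⟧') ≫ e₁.hom⟦(1 : ℤ)⟧' = e₃.hom ≫ h'
  rw [Category.assoc, Category.assoc, h2, Category.comp_id]

/-- The triangle of a pointwise short exact sequence of exact functors. -/
lemma dm_triangle {F G H : C ⥤ D} [Exa F] [Exa G] [Exa H] (α : F ⟶ G) (β : G ⟶ H)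
    (w : ∀ A, α.app A ≫ β.app A = 0)
    (h : ∀ A, (ShortComplex.mk (α.app A) (β.app A) (w A)).ShortExact) (X : DerivedCategory C) :
    ∃ δ : (dm H).obj X ⟶ ((dm F).obj X)⟦(1 : ℤ)⟧,
      Triangle.mk ((dmNat α).app X) ((dmNat β).app X) δ ∈ distTriang _ := by
  obtain ⟨K, ⟨e⟩⟩ : ∃ K, Nonempty (DerivedCategory.Q.obj K ≅ X) :=
    ⟨_, ⟨DerivedCategory.Q.objObjPreimageIso X⟩⟩
  have w' : (NatTrans.mapHomologicalComplex α (ComplexShape.up ℤ)).app K ≫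
      (NatTrans.mapHomologicalComplex β (ComplexShape.up ℤ)).app K = 0 := by
    ext i; exact w _
  have hS : (ShortComplex.mk _ _ w').ShortExact :=
    HomologicalComplex.shortExact_of_degreewise_shortExact _ (fun i => h (K.X i))
  have hT := DerivedCategory.triangleOfSES_distinguished hS
  refine exists_dist_of_iso hT _ _ ((dm F).mapIso e.symm ≪≫ F.mapDerivedCategoryFactors.app K)
    ((dm G).mapIso e.symm ≪≫ G.mapDerivedCategoryFactors.app K)
    ((dm H).mapIso e.symm ≪≫ H.mapDerivedCategoryFactors.app K) ?_ ?_
  · have := (dmNat α).naturality e.inv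
    simp only [dmNat_app] at this
    simp [reassoc_of% this.symm]
  · have := (dmNat β).naturality e.inv
    simp only [dmNat_app] at this
    simp [reassoc_of% this.symm]

end Dm
end NakE8

end

section
open CategoryTheory
open CategoryTheory.Limits CategoryTheory.Pretriangulated

namespace NakE8
universe v₁ v₂ v₃ u₁ u₂ u₃
section Ar
variable {C : Type u₁} [Category.{v₁} C] [Abelian C] {D : Type u₂} [Category.{v₂} D] [Abelian D]
  {E : Type u₃} [Category.{v₃} E] [Abelian E]

abbrev Ar (C : Type u₁) [Category.{v₁} C] := ComposableArrows C 1

abbrev ev (C : Type u₁) [Category.{v₁} C] (i : Fin 2) : Ar C ⥤ C := (evaluation (Fin 2) C).obj i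

lemma exa_of_ev (F : D ⥤ Ar C) (h0 : Exa (F ⋙ ev C 0)) (h1 : Exa (F ⋙ ev C 1)) : Exa F where
  lim := ⟨fun J _ _ => preservesLimitsOfShape_of_evaluation F J (fun i => by
    fin_cases i
    · exact h0.lim.preservesFiniteLimits J
    · exact h1.lim.preservesFiniteLimits J)⟩
  colim := ⟨fun J _ _ => preservesColimitsOfShape_of_evaluation F J (fun i => by
    fin_cases i
    · exact h0.colim.preservesFiniteColimits J
    · exact h1.colim.preservesFiniteColimits J)⟩

instance (i : Fin 2) : Exa (ev C i) where
  lim := inferInstance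
  colim := inferInstance

/-- the functor to arrows attached to a natural transformation -/
def mkF {F G : D ⥤ C} (α : F ⟶ G) : D ⥤ Ar C where
  obj A := ComposableArrows.mk₁ (α.app A)
  map f := ComposableArrows.homMk₁ (F.map f) (G.map f) (α.naturality f).symm
  map_id A := ComposableArrows.hom_ext₁ (F.map_id A) (G.map_id A)
  map_comp f g := ComposableArrows.hom_ext₁ (F.map_comp f g) (G.map_comp f g)

def mkF0 {F G : D ⥤ C} (α : F ⟶ G) : mkF α ⋙ ev C 0 ≅ F := Iso.refl _
def mkF1 {F G : D ⥤ C} (α : F ⟶ G) : mkF α ⋙ ev C 1 ≅ G := Iso.refl _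

instance {F G : D ⥤ C} [Exa F] [Exa G] (α : F ⟶ G) : Exa (mkF α) :=
  exa_of_ev _ (exa_of_iso (mkF0 α).symm) (exa_of_iso (mkF1 α).symm)

def mkFhom {F G F' G' : D ⥤ C} {α : F ⟶ G} {α' : F' ⟶ G'} (p : F ⟶ F') (q : G ⟶ G')
    (h : α ≫ q = p ≫ α') : mkF α ⟶ mkF α' where
  app A := ComposableArrows.homMk₁ (p.app A) (q.app A) (NatTrans.congr_app h A)
  naturality _ _ f := ComposableArrows.hom_ext₁ (p.naturality f) (q.naturality f)

/-- short exact sequences of arrows -/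
lemma ar_shortExact (S : ShortComplex (Ar C)) (h0 : (S.map (ev C 0)).ShortExact)
    (h1 : (S.map (ev C 1)).ShortExact) : S.ShortExact := by
  have hm : ∀ i : Fin 2, (S.map (ev C i)).ShortExact := by
    intro i; fin_cases i
    · exact h0
    · exact h1
  have : Mono S.f := by
    have : ∀ i, Mono (S.f.app i) := fun i => (hm i).mono_f
    exact NatTrans.mono_of_mono_app _
  have : Epi S.g := by
    have : ∀ i, Epi (S.g.app i) := fun i => (hm i).epi_g
    exact NatTrans.epi_of_epi_app _
  refine ⟨?_⟩
  rw [ShortComplex.exact_iff_isZero_homology, Functor.isZero_iff]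
  intro i
  exact ((ShortComplex.exact_iff_isZero_homology _).1 (hm i).exact).of_iso
    (S.mapHomologyIso (ev C i)).symm

end Ar
end NakE8

end

section
open CategoryTheory
open CategoryTheory.Limits CategoryTheory.Pretriangulated

namespace NakE8
universe v₁ v₂ v₃ u₁ u₂ u₃
open scoped ZeroObject
section LL
variable {C : Type u₁} [Category.{v₁} C] [Abelian C] {D : Type u₂} [Category.{v₂} D] [Abelian D]
  {E : Type u₃} [Category.{v₃} E] [Abelian E]

lemma isIso_map_dmNat {F F' : C ⥤ D} (α : F ⟶ F') (G : D ⥤ E) [Exa F] [Exa F'] [Exa G]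
    (h : IsIso (Functor.whiskerRight α G)) (X : DerivedCategory C) :
    IsIso ((dm G).map ((dmNat α).app X)) := by
  have := isIso_dmNat (Functor.whiskerRight α G)
  have h2 := dmComp_whiskerRight G α X
  have h3 : (dm G).map ((dmNat α).app X) = (dmComp F G).inv.app X ≫
    (dmNat (Functor.whiskerRight α G)).app X ≫ (dmComp F' G).hom.app X := by simp [h2]
  rw [h3]; infer_instance

lemma isIso_dmNat_app (F : C ⥤ D) {G G' : D ⥤ E} [Exa F] [Exa G] [Exa G'] (α : G ⟶ G')
    (h : IsIso (Functor.whiskerLeft F α)) (X : DerivedCategory C) :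
    IsIso ((dmNat α).app ((dm F).obj X)) := by
  have := isIso_dmNat (Functor.whiskerLeft F α)
  have h2 := dmComp_whiskerLeft F α X
  have h3 : (dmNat α).app ((dm F).obj X) = (dmComp F G).inv.app X ≫
    (dmNat (Functor.whiskerLeft F α)).app X ≫ (dmComp F G').hom.app X := by simp [h2]
  rw [h3]; infer_instance

lemma isZero_dm_dm (F : C ⥤ D) (G : D ⥤ E) [Exa F] [Exa G] (h : ∀ X, IsZero (G.obj (F.obj X)))
    (X : DerivedCategory C) : IsZero ((dm G).obj ((dm F).obj X)) :=
  (isZero_dm (F ⋙ G) h X).of_iso ((dmComp F G).symm.app X)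

lemma isZero_map {T T' : Type*} [Category T] [Category T'] [Preadditive T] [Preadditive T']
    (F : T ⥤ T') [F.Additive] {X : T} (h : IsZero X) : IsZero (F.obj X) := by
  rw [IsZero.iff_id_eq_zero] at h ⊢
  rw [← F.map_id, h, F.map_zero]

/-- the zero functor -/
noncomputable abbrev zF (C : Type u₁) [Category.{v₁} C] (D : Type u₂) [Category.{v₂} D] [Abelian D] :
    C ⥤ D := (Functor.const _).obj (0 : D)

instance : Exa (zF C D) := exa_of_isZero _ (fun _ => isZero_zero D)

variable (C)

noncomputable def iotaF : C ⥤ Ar C := mkF (𝟙 (𝟭 C))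
noncomputable def jF : C ⥤ Ar C := mkF (0 : zF C C ⟶ 𝟭 C)
noncomputable def iF : C ⥤ Ar C := mkF (0 : 𝟭 C ⟶ zF C C)

instance : Exa (iotaF C) := by unfold iotaF; infer_instance
instance : Exa (jF C) := by unfold jF; infer_instance
instance : Exa (iF C) := by unfold iF; infer_instance

lemma ar_isIso {X Y : Ar C} (f : X ⟶ Y) (h0 : IsIso (f.app 0)) (h1 : IsIso (f.app 1)) :
    IsIso f := by
  have : ∀ i, IsIso (f.app i) := by
    intro i; fin_cases i
    · exact h0
    · exact h1
  exact NatIso.isIso_of_isIso_app f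

noncomputable def epsF : ev C 0 ⋙ iotaF C ⟶ 𝟭 (Ar C) where
  app X := ComposableArrows.homMk₁ (𝟙 (X.obj 0)) (X.map' 0 1)
    ((Category.id_comp (X.map' 0 1)).trans (Category.id_comp (X.map' 0 1)).symm)
  naturality X Y f := ComposableArrows.hom_ext₁
    ((Category.comp_id (f.app 0)).trans (Category.id_comp (f.app 0)).symm)
    (f.naturality (homOfLE (by simp : (0 : Fin 2) ≤ 1))).symm

noncomputable def jepsF : ev C 1 ⋙ jF C ⟶ 𝟭 (Ar C) where
  app X := ComposableArrows.homMk₁ 0 (𝟙 (X.obj 1)) ((isZero_zero C).eq_of_src _ _)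
  naturality X Y f := ComposableArrows.hom_ext₁
    ((isZero_zero C).eq_of_src _ _)
    ((Category.comp_id (f.app 1)).trans (Category.id_comp (f.app 1)).symm)

noncomputable def ietaF : 𝟭 (Ar C) ⟶ ev C 0 ⋙ iF C where
  app X := ComposableArrows.homMk₁ (𝟙 (X.obj 0)) 0 ((isZero_zero C).eq_of_tgt _ _)
  naturality X Y f := ComposableArrows.hom_ext₁
    ((Category.comp_id (f.app 0)).trans (Category.id_comp (f.app 0)).symm)
    ((isZero_zero C).eq_of_tgt _ _)

lemma ji_w (X : Ar C) : (jepsF C).app X ≫ (ietaF C).app X = 0 :=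
  ComposableArrows.hom_ext₁ ((isZero_zero C).eq_of_src _ _) ((isZero_zero C).eq_of_tgt _ _)

variable {C} in
lemma ses_left_id {S : ShortComplex C} (h1 : IsIso S.f) (h3 : IsZero S.X₃) : S.ShortExact where
  exact := (ShortComplex.exact_iff_epi S (h3.eq_of_tgt _ _)).2 inferInstance
  mono_f := inferInstance
  epi_g := ⟨fun _ _ _ => h3.eq_of_src _ _⟩

variable {C} in
lemma ses_right_id {S : ShortComplex C} (h1 : IsIso S.g) (h3 : IsZero S.X₁) : S.ShortExact where
  exact := (ShortComplex.exact_iff_mono S (h3.eq_of_src _ _)).2 inferInstance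
  mono_f := ⟨fun _ _ _ => h3.eq_of_tgt _ _⟩
  epi_g := inferInstance

lemma ji_ses (X : Ar C) :
    (ShortComplex.mk ((jepsF C).app X) ((ietaF C).app X) (ji_w C X)).ShortExact := by
  apply ar_shortExact
  · exact ses_right_id (inferInstanceAs (IsIso (𝟙 (X.obj 0)))) (isZero_zero C)
  · exact ses_left_id (inferInstanceAs (IsIso (𝟙 (X.obj 1)))) (isZero_zero C)

noncomputable def eD : dm (ev C 0 ⋙ iotaF C) ⟶ 𝟭 _ := dmNat (epsF C) ≫ dmId.hom
noncomputable def jD : dm (ev C 1 ⋙ jF C) ⟶ 𝟭 _ := dmNat (jepsF C) ≫ dmId.hom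

instance isIso_eD_iota (Z : DerivedCategory C) : IsIso ((eD C).app ((dm (iotaF C)).obj Z)) := by
  have : IsIso ((dmNat (epsF C)).app ((dm (iotaF C)).obj Z)) := by
    apply isIso_dmNat_app
    have : ∀ A, IsIso ((Functor.whiskerLeft (iotaF C) (epsF C)).app A) := fun A =>
      ar_isIso _ _ (inferInstanceAs (IsIso (𝟙 A))) (inferInstanceAs (IsIso (𝟙 A)))
    exact NatIso.isIso_of_isIso_app _
  dsimp [eD]; infer_instance

instance isIso_jD_j (Z : DerivedCategory C) : IsIso ((jD C).app ((dm (jF C)).obj Z)) := by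
  have : IsIso ((dmNat (jepsF C)).app ((dm (jF C)).obj Z)) := by
    apply isIso_dmNat_app
    have : ∀ A, IsIso ((Functor.whiskerLeft (jF C) (jepsF C)).app A) := fun A =>
      ar_isIso _ _ (isIso_of_source_target_iso_zero _ (isZero_zero C).isoZero (isZero_zero C).isoZero) (inferInstanceAs (IsIso (𝟙 A)))
    exact NatIso.isIso_of_isIso_app _
  dsimp [jD]; infer_instance

instance isIso_ev0_eD (X : DerivedCategory (Ar C)) : IsIso ((dm (ev C 0)).map ((eD C).app X)) := by
  have : IsIso ((dm (ev C 0)).map ((dmNat (epsF C)).app X)) := by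
    apply isIso_map_dmNat
    have : ∀ A, IsIso ((Functor.whiskerRight (epsF C) (ev C 0)).app A) := fun A =>
      inferInstanceAs (IsIso (𝟙 (A.obj 0)))
    exact NatIso.isIso_of_isIso_app _
  dsimp [eD]; rw [Functor.map_comp]; infer_instance

variable {C}

lemma iota_j_zero {Z Y : DerivedCategory C} (f : (dm (iotaF C)).obj Z ⟶ (dm (jF C)).obj Y) :
    f = 0 := by
  have h := (eD C).naturality f
  have h0 : IsZero ((dm (ev C 0 ⋙ iotaF C)).obj ((dm (jF C)).obj Y)) :=
    isZero_dm_dm (jF C) (ev C 0 ⋙ iotaF C) (fun _ => isZero_map (iotaF C) (isZero_zero C)) _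
  rw [h0.eq_of_tgt ((dm (ev C 0 ⋙ iotaF C)).map f) 0, zero_comp] at h
  rw [← cancel_epi ((eD C).app ((dm (iotaF C)).obj Z)), comp_zero]
  exact h.symm

lemma j_i_zero {Z Y : DerivedCategory C} (f : (dm (jF C)).obj Z ⟶ (dm (iF C)).obj Y) :
    f = 0 := by
  have h := (jD C).naturality f
  have h0 : IsZero ((dm (ev C 1 ⋙ jF C)).obj ((dm (iF C)).obj Y)) :=
    isZero_dm_dm (iF C) (ev C 1 ⋙ jF C) (fun _ => isZero_map (jF C) (isZero_zero C)) _
  rw [h0.eq_of_tgt ((dm (ev C 1 ⋙ jF C)).map f) 0, zero_comp] at h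
  rw [← cancel_epi ((jD C).app ((dm (jF C)).obj Z)), comp_zero]
  exact h.symm

lemma isIso_jD {X : DerivedCategory (Ar C)} (h : IsZero ((dm (ev C 0)).obj X)) :
    IsIso ((jD C).app X) := by
  obtain ⟨δ, hδ⟩ := dm_triangle (jepsF C) (ietaF C) (ji_w C) (ji_ses C) X
  have h3 : IsZero ((dm (ev C 0 ⋙ iF C)).obj X) :=
    (isZero_map (dm (iF C)) h).of_iso ((dmComp _ _).app X)
  have : IsIso ((dmNat (jepsF C)).app X) := (Triangle.isZero₃_iff_isIso₁ _ hδ).1 h3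
  dsimp [jD]; infer_instance

/-- `dm ev1` is a retraction of `dm j` -/
noncomputable def jRetr : dm (jF C) ⋙ dm (ev C 1) ≅ 𝟭 _ :=
  (dmComp (jF C) (ev C 1)).symm ≪≫ dmIso (mkF1 _) ≪≫ dmId

lemma ev1_inj {Y : DerivedCategory C} {X : DerivedCategory (Ar C)} {f g : (dm (jF C)).obj Y ⟶ X}
    (h : (dm (ev C 1)).map f = (dm (ev C 1)).map g) : f = g := by
  have h1 := (jD C).naturality f
  have h2 := (jD C).naturality g
  have h3 : (dm (ev C 1 ⋙ jF C)).map f = (dm (ev C 1 ⋙ jF C)).map g := by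
    have e1 := (dmComp (ev C 1) (jF C)).hom.naturality f
    have e2 := (dmComp (ev C 1) (jF C)).hom.naturality g
    rw [← cancel_mono ((dmComp (ev C 1) (jF C)).hom.app _), e1, e2]
    simp [h]
  rw [h3, h2] at h1
  rw [← cancel_epi ((jD C).app ((dm (jF C)).obj Y))]
  exact h1.symm

instance : (dm (jF C)).Faithful :=
  haveI : (dm (jF C) ⋙ dm (ev C 1)).Faithful := Functor.Faithful.of_iso (jRetr (C := C)).symm
  Functor.Faithful.of_comp (dm (jF C)) (dm (ev C 1))

instance : (dm (jF C)).Full where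
  map_surjective {Y Y'} f := by
    have : (dm (jF C) ⋙ dm (ev C 1)).Full := Functor.Full.of_iso (jRetr (C := C)).symm
    obtain ⟨g, hg⟩ := (dm (jF C) ⋙ dm (ev C 1)).map_surjective ((dm (ev C 1)).map f)
    exact ⟨g, ev1_inj hg⟩

/-- Reflection triangles. -/
lemma exists_refl (X : DerivedCategory (Ar C)) :
    ∃ (Y : DerivedCategory C) (u : X ⟶ (dm (jF C)).obj Y) (Z : DerivedCategory C)
      (a : (dm (iotaF C)).obj Z ⟶ X) (δ : (dm (jF C)).obj Y ⟶ ((dm (iotaF C)).obj Z)⟦(1 : ℤ)⟧),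
      Triangle.mk a u δ ∈ distTriang _ := by
  obtain ⟨K, u, δ, hT⟩ := distinguished_cocone_triangle ((eD C).app X)
  have h0 : IsZero ((dm (ev C 0)).obj K) :=
    (Triangle.isZero₃_iff_isIso₁ _ ((dm (ev C 0)).map_distinguished _ hT)).2
      (isIso_ev0_eD C X)
  have := isIso_jD h0
  let e : K ≅ (dm (jF C)).obj ((dm (ev C 1)).obj K) :=
    (asIso ((jD C).app K)).symm ≪≫ (dmComp (ev C 1) (jF C)).app K
  let e' : (dm (iotaF C)).obj ((dm (ev C 0)).obj X) ≅ (dm (ev C 0 ⋙ iotaF C)).obj X :=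
    (dmComp (ev C 0) (iotaF C)).symm.app X
  obtain ⟨δ', h'⟩ := exists_dist_of_iso hT (e'.hom ≫ (eD C).app X) (u ≫ e.hom) e' (Iso.refl _)
    e.symm (by simp) (by simp)
  exact ⟨_, _, _, _, δ', h'⟩

lemma refl_univ {X : DerivedCategory (Ar C)} {Y : DerivedCategory C} {u : X ⟶ (dm (jF C)).obj Y}
    {Z : DerivedCategory C}
    {a : (dm (iotaF C)).obj Z ⟶ X} {δ : (dm (jF C)).obj Y ⟶ ((dm (iotaF C)).obj Z)⟦(1 : ℤ)⟧}
    (hT : Triangle.mk a u δ ∈ distTriang _) (Y' : DerivedCategory C)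
    (f : X ⟶ (dm (jF C)).obj Y') : ∃! g : Y ⟶ Y', u ≫ (dm (jF C)).map g = f := by
  obtain ⟨h, hh⟩ := Triangle.yoneda_exact₂ _ hT f (iota_j_zero _)
  obtain ⟨g, rfl⟩ := (dm (jF C)).map_surjective h
  refine ⟨g, hh.symm, fun g' hg' => ?_⟩
  apply (dm (jF C)).map_injective
  rw [← sub_eq_zero]
  obtain ⟨k, hk⟩ := Triangle.yoneda_exact₃ _ hT ((dm (jF C)).map g' - (dm (jF C)).map g)
    (by
      have hh' : f = u ≫ (dm (jF C)).map g := hh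
      change u ≫ _ = 0
      rw [Preadditive.comp_sub, hg', hh', sub_self])
  have : k = 0 := by
    have e := ((dm (iotaF C)).commShiftIso (1 : ℤ)).app Z
    have h0 : e.hom ≫ k = 0 := iota_j_zero (e.hom ≫ k)
    exact (cancel_epi e.hom).1 (h0.trans comp_zero.symm)
  rw [hk, this]
  exact comp_zero

instance : (dm (jF C)).IsRightAdjoint := by
  rw [isRightAdjoint_iff_hasInitial_structuredArrow]
  intro X
  obtain ⟨Y, u, Z, a, δ, hT⟩ := exists_refl X
  have : IsInitial (StructuredArrow.mk u : StructuredArrow X (dm (jF C))) :=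
    IsInitial.ofUniqueHom (fun B => StructuredArrow.homMk (refl_univ hT _ B.hom).exists.choose
      (refl_univ hT _ B.hom).exists.choose_spec) (fun B m => by
        apply StructuredArrow.ext
        exact (refl_univ hT _ B.hom).unique (StructuredArrow.w m)
          (refl_univ hT _ B.hom).exists.choose_spec)
  exact this.hasInitial

variable (C)
/-- The derived cokernel (cone) functor. -/
noncomputable def LC : DerivedCategory (Ar C) ⥤ DerivedCategory C := (dm (jF C)).leftAdjoint

noncomputable def LCadj : LC C ⊣ dm (jF C) := Adjunction.ofIsRightAdjoint _

noncomputable instance : (LC C).CommShift ℤ := (LCadj C).leftAdjointCommShift ℤ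

instance : (LCadj C).CommShift ℤ := (LCadj C).commShift_of_rightAdjoint ℤ

instance : (LC C).IsTriangulated := (LCadj C).isTriangulated_leftAdjoint

lemma LC_iota (Z : DerivedCategory C) : IsZero ((LC C).obj ((dm (iotaF C)).obj Z)) := by
  rw [IsZero.iff_id_eq_zero]
  apply ((LCadj C).homEquiv _ _).injective
  rw [iota_j_zero (((LCadj C).homEquiv _ _) 0)]
  exact iota_j_zero _

/-- `L J ≅ id` -/
noncomputable def LCj : dm (jF C) ⋙ LC C ≅ 𝟭 _ := asIso (LCadj C).counit

lemma isIso_LC_map {X Y Z : DerivedCategory (Ar C)} {f : X ⟶ Y} {g : Y ⟶ Z} {δ}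
    (hT : Triangle.mk f g δ ∈ distTriang _) (Z' : DerivedCategory C)
    (e : X ≅ (dm (iotaF C)).obj Z') : IsIso ((LC C).map g) := by
  have := (LC C).map_distinguished _ hT
  exact (Triangle.isZero₁_iff_isIso₂ _ this).1 ((LC_iota C Z').of_iso ((LC C).mapIso e))

variable {C}

/-- a map inverted by a triangulated functor -/
lemma LC_five {T : Type*} [Category T] [HasZeroObject T] [HasShift T ℤ] [Preadditive T]
    [∀ n : ℤ, (shiftFunctor T n).Additive] [Pretriangulated T] (H : DerivedCategory C ⥤ T)
    [H.CommShift ℤ] [H.IsTriangulated] {X Y : DerivedCategory (Ar C)} (f : X ⟶ Y)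
    (h0 : IsIso ((dm (ev C 0)).map f)) (h1 : IsIso (H.map ((dm (ev C 1)).map f))) :
    IsIso (H.map ((LC C).map f)) := by
  obtain ⟨K, u, δ, hT⟩ := distinguished_cocone_triangle f
  have z0 : IsZero ((dm (ev C 0)).obj K) :=
    (Triangle.isZero₃_iff_isIso₁ _ ((dm (ev C 0)).map_distinguished _ hT)).2 h0
  have z1 : IsZero ((dm (ev C 1) ⋙ H).obj K) :=
    (Triangle.isZero₃_iff_isIso₁ _ ((dm (ev C 1) ⋙ H).map_distinguished _ hT)).2 h1
  refine (Triangle.isZero₃_iff_isIso₁ _ ((LC C ⋙ H).map_distinguished _ hT)).1 ?_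
  have := isIso_jD z0
  let e : K ≅ (dm (jF C)).obj ((dm (ev C 1)).obj K) :=
    (asIso ((jD C).app K)).symm ≪≫ (dmComp (ev C 1) (jF C)).app K
  exact z1.of_iso (H.mapIso ((LC C).mapIso e ≪≫ (LCj C).app _))

end LL
end NakE8

end

section
open CategoryTheory
open CategoryTheory.Limits CategoryTheory.Pretriangulated

namespace NakE8
universe v₁ v₂ v₃ u₁ u₂ u₃
open scoped ZeroObject
section BC
variable {C : Type u₁} [Category.{v₁} C] [Abelian C] {D : Type u₂} [Category.{v₂} D] [Abelian D]
  {E : Type u₃} [Category.{v₃} E] [Abelian E]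

lemma LC_unit_triangle (X : DerivedCategory (Ar C)) :
    ∃ (Z : DerivedCategory C) (a : (dm (iotaF C)).obj Z ⟶ X)
      (δ : (dm (jF C)).obj ((LC C).obj X) ⟶ ((dm (iotaF C)).obj Z)⟦(1 : ℤ)⟧),
      Triangle.mk a ((LCadj C).unit.app X) δ ∈ distTriang _ := by
  obtain ⟨Y, u, Z, a, δ, hT⟩ := exists_refl X
  obtain ⟨φ, hφ, -⟩ := refl_univ hT _ ((LCadj C).unit.app X)
  let ψ := ((LCadj C).homEquiv X Y).symm u
  have hψ : (LCadj C).unit.app X ≫ (dm (jF C)).map ψ = u := by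
    exact ((LCadj C).homEquiv_unit (X := X) (Y := Y) (f := ψ)).symm.trans
      (((LCadj C).homEquiv X Y).apply_symm_apply u)
  have h1 : φ ≫ ψ = 𝟙 _ := by
    apply (refl_univ hT _ u).unique
    · rw [Functor.map_comp, ← Category.assoc, hφ, hψ]
    · simp
  have h2 : ψ ≫ φ = 𝟙 _ := by
    apply ((LCadj C).homEquiv X _).injective
    rw [Adjunction.homEquiv_unit, Adjunction.homEquiv_unit, Functor.map_comp, ← Category.assoc,
      hψ, hφ]
    exact ((congrArg ((LCadj C).unit.app X ≫ ·)
      ((dm (jF C)).map_id ((LC C).obj X))).trans (Category.comp_id _)).symm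
  let e : (LC C).obj X ≅ Y := ⟨ψ, φ, h2, h1⟩
  obtain ⟨δ', h'⟩ := exists_dist_of_iso hT a ((LCadj C).unit.app X) (Iso.refl _) (Iso.refl _)
    ((dm (jF C)).mapIso e) (by simp) (by simpa [e] using hψ)
  exact ⟨Z, a, δ', h'⟩

def arF (G : C ⥤ D) : Ar C ⥤ Ar D := (Functor.whiskeringRight (Fin 2) C D).obj G

instance (G : C ⥤ D) [Exa G] : Exa (arF G) :=
  exa_of_ev _ (inferInstanceAs (Exa (ev C 0 ⋙ G))) (inferInstanceAs (Exa (ev C 1 ⋙ G)))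

lemma nat_isIso_ar (F G : C ⥤ Ar D) (ω : F ⟶ G) (h0 : ∀ A, IsIso ((ω.app A).app 0))
    (h1 : ∀ A, IsIso ((ω.app A).app 1)) : IsIso ω := by
  have : ∀ A, IsIso (ω.app A) := fun A => ar_isIso _ _ (h0 A) (h1 A)
  exact NatIso.isIso_of_isIso_app _

noncomputable def jArIso (G : C ⥤ D) [Exa G] : jF C ⋙ arF G ≅ G ⋙ jF D :=
  NatIso.ofComponents (fun A => ComposableArrows.isoMk₁ (isZero_map G (isZero_zero C)).isoZero
    (Iso.refl (G.obj A)) ((isZero_map G (isZero_zero C)).eq_of_src _ _))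
    (fun {A B} f => ComposableArrows.hom_ext₁ ((isZero_map G (isZero_zero C)).eq_of_src _ _)
      ((Category.comp_id (G.map f)).trans (Category.id_comp (G.map f)).symm))

noncomputable def iotaArIso (G : C ⥤ D) [Exa G] : iotaF C ⋙ arF G ≅ G ⋙ iotaF D :=
  NatIso.ofComponents (fun A => ComposableArrows.isoMk₁ (Iso.refl (G.obj A))
    (Iso.refl (G.obj A)) (by
      change G.map (𝟙 A) ≫ 𝟙 (G.obj A) = 𝟙 (G.obj A) ≫ 𝟙 (G.obj A)
      simp))
    (fun {A B} f => ComposableArrows.hom_ext₁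
      ((Category.comp_id (G.map f)).trans (Category.id_comp (G.map f)).symm)
      ((Category.comp_id (G.map f)).trans (Category.id_comp (G.map f)).symm))

noncomputable def jArD (G : C ⥤ D) [Exa G] : dm (jF C) ⋙ dm (arF G) ≅ dm G ⋙ dm (jF D) :=
  (dmComp _ _).symm ≪≫ dmIso (jArIso G) ≪≫ dmComp _ _

noncomputable def iotaArD (G : C ⥤ D) [Exa G] :
    dm (iotaF C) ⋙ dm (arF G) ≅ dm G ⋙ dm (iotaF D) :=
  (dmComp _ _).symm ≪≫ dmIso (iotaArIso G) ≪≫ dmComp _ _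

instance isIso_unit_ar (G : C ⥤ D) [Exa G] (X : DerivedCategory (Ar C)) :
    IsIso ((LC D).map ((dm (arF G)).map ((LCadj C).unit.app X))) := by
  obtain ⟨Z, a, δ, hT⟩ := LC_unit_triangle X
  exact isIso_LC_map D ((dm (arF G)).map_distinguished _ hT) ((dm G).obj Z) ((iotaArD G).app Z)

/-- Beck-Chevalley -/
noncomputable def bc (G : C ⥤ D) [Exa G] : dm (arF G) ⋙ LC D ≅ LC C ⋙ dm G := by
  have : IsIso (Functor.whiskerRight (LCadj C).unit (dm (arF G) ⋙ LC D)) := by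
    have : ∀ X, IsIso ((Functor.whiskerRight (LCadj C).unit (dm (arF G) ⋙ LC D)).app X) :=
      fun X => isIso_unit_ar G X
    exact NatIso.isIso_of_isIso_app _
  exact (Functor.leftUnitor _).symm ≪≫
    asIso (Functor.whiskerRight (LCadj C).unit (dm (arF G) ⋙ LC D)) ≪≫
    Functor.associator _ _ _ ≪≫ Functor.isoWhiskerLeft (LC C)
      ((Functor.associator _ _ _).symm ≪≫ Functor.isoWhiskerRight (jArD G) (LC D) ≪≫
        Functor.associator _ _ _ ≪≫ Functor.isoWhiskerLeft (dm G) (LCj D) ≪≫ Functor.rightUnitor _)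

variable (C)
noncomputable def jiota : jF C ⟶ iotaF C :=
  mkFhom 0 (𝟙 _) (by ext A; exact (isZero_zero C).eq_of_src _ _)
noncomputable def iotai : iotaF C ⟶ iF C :=
  mkFhom (𝟙 _) 0 (by ext A; exact (isZero_zero C).eq_of_tgt _ _)

lemma jii_w (A : C) : (jiota C).app A ≫ (iotai C).app A = 0 :=
  ComposableArrows.hom_ext₁ ((isZero_zero C).eq_of_src _ _) ((isZero_zero C).eq_of_tgt _ _)

lemma jii_ses (A : C) :
    (ShortComplex.mk ((jiota C).app A) ((iotai C).app A) (jii_w C A)).ShortExact := by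
  apply ar_shortExact
  · exact ses_right_id (inferInstanceAs (IsIso (𝟙 A))) (isZero_zero C)
  · exact ses_left_id (inferInstanceAs (IsIso (𝟙 A))) (isZero_zero C)

lemma exists_dl (Y : DerivedCategory C) :
    ∃ δ : (dm (iF C)).obj Y ⟶ ((dm (jF C)).obj Y)⟦(1 : ℤ)⟧,
      Triangle.mk ((dmNat (jiota C)).app Y) ((dmNat (iotai C)).app Y) δ ∈ distTriang _ :=
  dm_triangle (jiota C) (iotai C) (jii_w C) (jii_ses C) Y

noncomputable def dlApp (Y : DerivedCategory C) :
    (dm (iF C)).obj Y ⟶ ((dm (jF C)).obj Y)⟦(1 : ℤ)⟧ := (exists_dl C Y).choose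

lemma dlApp_dist (Y : DerivedCategory C) :
    Triangle.mk ((dmNat (jiota C)).app Y) ((dmNat (iotai C)).app Y) (dlApp C Y) ∈ distTriang _ :=
  (exists_dl C Y).choose_spec

noncomputable def dl : dm (iF C) ⟶ dm (jF C) ⋙ shiftFunctor _ (1 : ℤ) where
  app Y := dlApp C Y
  naturality Y Y' f := by
    obtain ⟨c, hc1, hc2⟩ := complete_distinguished_triangle_morphism _ _ (dlApp_dist C Y)
      (dlApp_dist C Y') ((dm (jF C)).map f) ((dm (iotaF C)).map f)
      ((dmNat (jiota C)).naturality f).symm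
    change (dm (iF C)).obj Y ⟶ (dm (iF C)).obj Y' at c
    change (dmNat (iotai C)).app Y ≫ c = _ ≫ (dmNat (iotai C)).app Y' at hc1
    have h1 : (dmNat (iotai C)).app Y ≫ (c - (dm (iF C)).map f) = 0 := by
      rw [Preadditive.comp_sub, hc1]
      exact sub_eq_zero.2 ((dmNat (iotai C)).naturality f)
    obtain ⟨k, hk⟩ := Triangle.yoneda_exact₃ _ (dlApp_dist C Y) _ h1
    have hk0 : k = 0 := by
      have e := ((dm (jF C)).commShiftIso (1 : ℤ)).app Y
      have h0 : e.hom ≫ k = 0 := j_i_zero (e.hom ≫ k)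
      exact (cancel_epi e.hom).1 (h0.trans comp_zero.symm)
    have h2 : c = (dm (iF C)).map f := by
      rw [← sub_eq_zero, hk, hk0]
      exact comp_zero
    rw [← h2]
    exact hc2.symm

instance isIso_L_dl (Y : DerivedCategory C) : IsIso ((LC C).map ((dl C).app Y)) := by
  have h := (LC C).map_distinguished _ (rot_of_distTriang _ (dlApp_dist C Y))
  exact (Triangle.isZero₁_iff_isIso₂ _ h).1 (LC_iota C Y)

/-- `L I ≅ [1]` -/
noncomputable def LCi : dm (iF C) ⋙ LC C ≅ shiftFunctor _ (1 : ℤ) := by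
  have : IsIso (Functor.whiskerRight (dl C) (LC C)) := by
    have : ∀ X, IsIso ((Functor.whiskerRight (dl C) (LC C)).app X) :=
      fun X => isIso_L_dl C X
    exact NatIso.isIso_of_isIso_app _
  exact asIso (Functor.whiskerRight (dl C) (LC C)) ≪≫ Functor.associator _ _ _ ≪≫
    Functor.isoWhiskerLeft _ ((LC C).commShiftIso (1 : ℤ)) ≪≫ (Functor.associator _ _ _).symm ≪≫
    Functor.isoWhiskerRight (LCj C) _ ≪≫ Functor.leftUnitor _

variable {C}
lemma isIso_ieta {X : DerivedCategory (Ar C)} (h : IsZero ((dm (ev C 1)).obj X)) :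
    Nonempty (X ≅ (dm (iF C)).obj ((dm (ev C 0)).obj X)) := by
  obtain ⟨δ, hδ⟩ := dm_triangle (jepsF C) (ietaF C) (ji_w C) (ji_ses C) X
  have h3 : IsZero ((dm (ev C 1 ⋙ jF C)).obj X) :=
    (isZero_map (dm (jF C)) h).of_iso ((dmComp _ _).app X)
  have : IsIso ((dmNat (ietaF C)).app X) := (Triangle.isZero₁_iff_isIso₂ _ hδ).1 h3
  exact ⟨dmId.symm.app X ≪≫ asIso ((dmNat (ietaF C)).app X) ≪≫ (dmComp _ _).app X⟩

lemma LC_five2 {T : Type*} [Category T] [HasZeroObject T] [HasShift T ℤ] [Preadditive T]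
    [∀ n : ℤ, (shiftFunctor T n).Additive] [Pretriangulated T] (H : DerivedCategory C ⥤ T)
    [H.CommShift ℤ] [H.IsTriangulated] {X Y : DerivedCategory (Ar C)} (f : X ⟶ Y)
    (h1 : IsIso ((dm (ev C 1)).map f)) (h0 : IsIso (H.map ((dm (ev C 0)).map f))) :
    IsIso (H.map ((LC C).map f)) := by
  obtain ⟨K, u, δ, hT⟩ := distinguished_cocone_triangle f
  have z1 : IsZero ((dm (ev C 1)).obj K) :=
    (Triangle.isZero₃_iff_isIso₁ _ ((dm (ev C 1)).map_distinguished _ hT)).2 h1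
  have z0 : IsZero ((dm (ev C 0) ⋙ H).obj K) :=
    (Triangle.isZero₃_iff_isIso₁ _ ((dm (ev C 0) ⋙ H).map_distinguished _ hT)).2 h0
  refine (Triangle.isZero₃_iff_isIso₁ _ ((LC C ⋙ H).map_distinguished _ hT)).1 ?_
  obtain ⟨e⟩ := isIso_ieta z1
  exact (isZero_map (shiftFunctor T (1 : ℤ)) z0).of_iso
    (H.mapIso ((LC C).mapIso e ≪≫ (LCi C).app _) ≪≫ (H.commShiftIso (1 : ℤ)).app _)

end BC
end NakE8

end

section
open CategoryTheory
open CategoryTheory.Limits CategoryTheory.Pretriangulated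

namespace NakE8
universe v₁ v₂ v₃ u₁ u₂ u₃
open scoped ZeroObject
section Glue
variable {C : Type u₁} [Category.{v₁} C] [Abelian C] {D : Type u₂} [Category.{v₂} D] [Abelian D]
  {E : Type u₃} [Category.{v₃} E] [Abelian E]

lemma LC_mk_id (Z : E ⥤ C) [Exa Z] (X : DerivedCategory E) :
    IsZero ((LC C).obj ((dm (mkF (𝟙 Z))).obj X)) := by
  let e : mkF (𝟙 Z) ≅ Z ⋙ iotaF C := Iso.refl _
  exact (LC_iota C ((dm Z).obj X)).of_iso ((LC C).mapIso
    ((dmIso e).app X ≪≫ (dmComp Z (iotaF C)).app X))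

lemma LC_iso_left {Q P : E ⥤ Ar C} {Z : E ⥤ C} [Exa Q] [Exa P] [Exa Z] (σ : Q ⟶ P)
    (τ : P ⟶ mkF (𝟙 Z)) (w : ∀ A, σ.app A ≫ τ.app A = 0)
    (h : ∀ A, (ShortComplex.mk (σ.app A) (τ.app A) (w A)).ShortExact) (X : DerivedCategory E) :
    IsIso ((LC C).map ((dmNat σ).app X)) := by
  obtain ⟨δ, hT⟩ := dm_triangle σ τ w h X
  exact (Triangle.isZero₃_iff_isIso₁ _ ((LC C).map_distinguished _ hT)).1 (LC_mk_id Z X)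

lemma LC_iso_right {Q P : E ⥤ Ar C} {Z : E ⥤ C} [Exa Q] [Exa P] [Exa Z] (σ : mkF (𝟙 Z) ⟶ P)
    (τ : P ⟶ Q) (w : ∀ A, σ.app A ≫ τ.app A = 0)
    (h : ∀ A, (ShortComplex.mk (σ.app A) (τ.app A) (w A)).ShortExact) (X : DerivedCategory E) :
    IsIso ((LC C).map ((dmNat τ).app X)) := by
  obtain ⟨δ, hT⟩ := dm_triangle σ τ w h X
  exact (Triangle.isZero₁_iff_isIso₂ _ ((LC C).map_distinguished _ hT)).1 (LC_mk_id Z X)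

lemma LC_ker {K M N : E ⥤ C} [Exa K] [Exa M] [Exa N] (κ : K ⟶ M) (p : M ⟶ N)
    (w : ∀ A, κ.app A ≫ p.app A = 0)
    (h : ∀ A, (ShortComplex.mk (κ.app A) (p.app A) (w A)).ShortExact)
    (hh : (0 : K ⟶ zF E C) ≫ (0 : zF E C ⟶ N) = κ ≫ p) (X : DerivedCategory E) :
    IsIso ((LC C).map ((dmNat (mkFhom κ 0 hh)).app X)) := by
  refine LC_iso_left (mkFhom κ 0 hh) (mkFhom p (𝟙 N) rfl) (fun A => ?_) (fun A => ?_) X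
  · exact ComposableArrows.hom_ext₁ (w A) ((isZero_zero C).eq_of_src _ _)
  · apply ar_shortExact
    · exact h A
    · exact ses_right_id (inferInstanceAs (IsIso (𝟙 (N.obj A)))) (isZero_zero C)

lemma LC_coker {K M N : E ⥤ C} [Exa K] [Exa M] [Exa N] (p : M ⟶ N) (κ : N ⟶ K)
    (w : ∀ A, p.app A ≫ κ.app A = 0)
    (h : ∀ A, (ShortComplex.mk (p.app A) (κ.app A) (w A)).ShortExact)
    (hh : p ≫ κ = (0 : M ⟶ zF E C) ≫ (0 : zF E C ⟶ K)) (X : DerivedCategory E) :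
    IsIso ((LC C).map ((dmNat (mkFhom 0 κ hh)).app X)) := by
  refine LC_iso_right (mkFhom (𝟙 M) p rfl) (mkFhom 0 κ hh) (fun A => ?_) (fun A => ?_) X
  · exact ComposableArrows.hom_ext₁ ((isZero_zero C).eq_of_tgt _ _) (w A)
  · apply ar_shortExact
    · exact ses_left_id (inferInstanceAs (IsIso (𝟙 (M.obj A)))) (isZero_zero C)
    · exact h A

lemma sq1 {M N B D' K : E ⥤ C} [Exa M] [Exa N] [Exa B] [Exa D'] [Exa K] (p : M ⟶ N) (q : B ⟶ D')
    (η : M ⟶ B) (a : N ⟶ D') (hs : p ≫ a = η ≫ q) (κ : K ⟶ M)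
    (w : ∀ A, κ.app A ≫ p.app A = 0)
    (h : ∀ A, (ShortComplex.mk (κ.app A) (p.app A) (w A)).ShortExact)
    (w' : ∀ A, (κ.app A ≫ η.app A) ≫ q.app A = 0)
    (h' : ∀ A, (ShortComplex.mk (κ.app A ≫ η.app A) (q.app A) (w' A)).ShortExact)
    (X : DerivedCategory E) :
    IsIso ((LC C).map ((dmNat (mkFhom η a hs)).app X)) := by
  have hh : (0 : K ⟶ zF E C) ≫ (0 : zF E C ⟶ N) = κ ≫ p := by
    ext A; rw [zero_comp]; exact (w A).symm
  have hh' : (0 : K ⟶ zF E C) ≫ (0 : zF E C ⟶ D') = (κ ≫ η) ≫ q := by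
    ext A; rw [zero_comp]; exact (w' A).symm
  have i1 := LC_ker κ p w h hh X
  have i2 := LC_ker (κ ≫ η) q w' h' hh' X
  have e : mkFhom (κ ≫ η) 0 hh' = mkFhom κ 0 hh ≫ mkFhom η a hs := by
    ext A : 2
    exact ComposableArrows.hom_ext₁ rfl ((isZero_zero C).eq_of_src _ _)
  rw [e, dmNat_comp, NatTrans.comp_app, Functor.map_comp] at i2
  exact IsIso.of_isIso_comp_left ((LC C).map ((dmNat (mkFhom κ 0 hh)).app X)) _

lemma sq2 {M N B D' K : E ⥤ C} [Exa M] [Exa N] [Exa B] [Exa D'] [Exa K] (p : M ⟶ N) (q : B ⟶ D')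
    (e : M ⟶ B) (ε : N ⟶ D') (hs : p ≫ ε = e ≫ q) (κ : D' ⟶ K)
    (w : ∀ A, q.app A ≫ κ.app A = 0)
    (h : ∀ A, (ShortComplex.mk (q.app A) (κ.app A) (w A)).ShortExact)
    (w' : ∀ A, p.app A ≫ ε.app A ≫ κ.app A = 0)
    (h' : ∀ A, (ShortComplex.mk (p.app A) (ε.app A ≫ κ.app A) (w' A)).ShortExact)
    (X : DerivedCategory E) :
    IsIso ((LC C).map ((dmNat (mkFhom e ε hs)).app X)) := by
  have hh : q ≫ κ = (0 : B ⟶ zF E C) ≫ (0 : zF E C ⟶ K) := by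
    ext A; rw [zero_comp]; exact (w A)
  have hh' : p ≫ ε ≫ κ = (0 : M ⟶ zF E C) ≫ (0 : zF E C ⟶ K) := by
    ext A; rw [zero_comp]; exact (w' A)
  have i1 := LC_coker q κ w h hh X
  have i2 := LC_coker p (ε ≫ κ) w' h' hh' X
  have e' : mkFhom 0 (ε ≫ κ) hh' = mkFhom e ε hs ≫ mkFhom 0 κ hh := by
    ext A : 2
    exact ComposableArrows.hom_ext₁ ((isZero_zero C).eq_of_tgt _ _) rfl
  rw [e', dmNat_comp, NatTrans.comp_app, Functor.map_comp] at i2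
  exact IsIso.of_isIso_comp_right _ ((LC C).map ((dmNat (mkFhom 0 κ hh)).app X))

lemma isIso_of_map_whisker {P P' : E ⥤ D} [Exa P] [Exa P'] (ω : P ⟶ P') (G : D ⥤ C) [Exa G]
    {T : Type*} [Category T] (H : DerivedCategory C ⥤ T) (X : DerivedCategory E)
    (h : IsIso (H.map ((dmNat (Functor.whiskerRight ω G)).app X))) :
    IsIso (H.map ((dm G).map ((dmNat ω).app X))) := by
  have h2 := dmComp_whiskerRight G ω X
  have h3 : (dm G).map ((dmNat ω).app X) = (dmComp P G).inv.app X ≫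
    (dmNat (Functor.whiskerRight ω G)).app X ≫ (dmComp P' G).hom.app X := by simp [h2]
  rw [h3, Functor.map_comp, Functor.map_comp]; infer_instance

variable {A B : Type*} [Category A] [Category B] [Abelian A] [Abelian B]

lemma glue1 (f0 f1 : A ⥤ B) (α : f0 ⟶ f1) (g1 g0 : B ⥤ A) (β : g1 ⟶ g0) [Exa f0] [Exa f1]
    [Exa g0] [Exa g1] (K : A ⥤ A) [Exa K]
    (z : ∀ M, IsZero (g1.obj (f0.obj M))) (η : 𝟭 A ⟶ f1 ⋙ g1) (π : 𝟭 A ⟶ f0 ⋙ g0)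
    (hηπ : ∀ M, η.app M ≫ β.app (f1.obj M) = π.app M ≫ g0.map (α.app M))
    (κ : K ⟶ 𝟭 A) (w : ∀ M, κ.app M ≫ π.app M = 0)
    (h : ∀ M, (ShortComplex.mk (κ.app M) (π.app M) (w M)).ShortExact)
    (w' : ∀ M, (κ.app M ≫ η.app M) ≫ β.app (f1.obj M) = 0)
    (h' : ∀ M, (ShortComplex.mk (κ.app M ≫ η.app M) (β.app (f1.obj M)) (w' M)).ShortExact) :
    Nonempty ((dm (mkF α) ⋙ LC B) ⋙ (dm (mkF β) ⋙ LC A) ≅ shiftFunctor _ (1 : ℤ)) := by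
  -- square
  let μ : mkF π ⟶ f1 ⋙ mkF β := mkFhom (α' := Functor.whiskerLeft f1 β) η (Functor.whiskerRight α g0)
    (by ext M; exact (hηπ M).symm)
  have hμ : ∀ X, IsIso ((LC A).map ((dmNat μ).app X)) := fun X =>
    sq1 π (Functor.whiskerLeft f1 β) η (Functor.whiskerRight α g0) _ κ w h w' h' X
  let l : f0 ⋙ mkF β ⟶ mkF π := mkFhom (α := Functor.whiskerLeft f0 β) 0 (𝟙 _)
    (by ext M; exact (z M).eq_of_src _ _)
  let ω : mkF l ⟶ mkF (Functor.whiskerRight α (mkF β)) := mkFhom (𝟙 _) μ (by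
    ext M : 2
    refine ComposableArrows.hom_ext₁ ((z M).eq_of_src _ _) ?_
    exact (Category.id_comp (g0.map (α.app M))).trans (Category.id_comp (g0.map (α.app M))).symm)
  have hω : ∀ X, IsIso ((LC A).map ((LC (Ar A)).map ((dmNat ω).app X))) := by
    intro X
    apply LC_five
    · apply isIso_map_dmNat
      exact (inferInstance : IsIso (𝟙 (f0 ⋙ mkF β)))
    · exact isIso_of_map_whisker ω (ev _ 1) (LC A) X (hμ X)
  let τ : mkF l ⟶ iF A ⋙ jF (Ar A) := mkFhom (α' := Functor.whiskerLeft (iF A) (0 : zF _ (Ar A) ⟶ 𝟭 (Ar A)))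
    0 (mkFhom (α' := (0 : 𝟭 A ⟶ zF A A)) (𝟙 _) 0
      (by ext M; exact (isZero_zero A).eq_of_tgt _ _)) (by
        ext M : 2
        exact ComposableArrows.hom_ext₁ ((z M).eq_of_src _ _) ((isZero_zero A).eq_of_tgt _ _))
  have hτ : ∀ X, IsIso ((LC (Ar A)).map ((dmNat τ).app X)) := by
    intro X
    refine LC_iso_right (mkFhom (𝟙 _) l rfl) τ (fun M => ?_) (fun M => ?_) X
    · refine ComposableArrows.hom_ext₁ ((isZero_zero _).eq_of_tgt _ _) ?_
      exact ComposableArrows.hom_ext₁ ((z M).eq_of_src _ _) ((isZero_zero A).eq_of_tgt _ _)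
    · apply ar_shortExact
      · exact ses_left_id (inferInstanceAs (IsIso (𝟙 ((mkF β).obj (f0.obj M))))) (isZero_zero _)
      · apply ar_shortExact
        · exact ses_right_id (inferInstanceAs (IsIso (𝟙 M))) (z M)
        · exact ses_left_id (inferInstanceAs (IsIso (𝟙 (g0.obj (f0.obj M))))) (isZero_zero _)
  have i1 : IsIso (Functor.whiskerRight (dmNat ω) (LC (Ar A) ⋙ LC A)) := by
    have : ∀ X, IsIso ((Functor.whiskerRight (dmNat ω) (LC (Ar A) ⋙ LC A)).app X) := hω
    exact NatIso.isIso_of_isIso_app _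
  have i2 : IsIso (Functor.whiskerRight (dmNat τ) (LC (Ar A))) := by
    have : ∀ X, IsIso ((Functor.whiskerRight (dmNat τ) (LC (Ar A))).app X) := hτ
    exact NatIso.isIso_of_isIso_app _
  let e0 : mkF α ⋙ arF (mkF β) ≅ mkF (Functor.whiskerRight α (mkF β)) :=
    NatIso.ofComponents (fun M => ComposableArrows.isoMk₁ (Iso.refl _) (Iso.refl _)
      ((Category.comp_id _).trans (Category.id_comp _).symm))
      (fun f => ComposableArrows.hom_ext₁ ((Category.comp_id _).trans (Category.id_comp _).symm)
        ((Category.comp_id _).trans (Category.id_comp _).symm))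
  refine ⟨?_⟩
  refine Functor.associator _ _ _ ≪≫ Functor.isoWhiskerLeft _ ((Functor.associator _ _ _).symm ≪≫
    Functor.isoWhiskerRight (bc (mkF β)).symm _ ≪≫ Functor.associator _ _ _) ≪≫
    (Functor.associator _ _ _).symm ≪≫
    Functor.isoWhiskerRight ((dmComp (mkF α) (arF (mkF β))).symm ≪≫ dmIso e0) _ ≪≫
    (asIso (Functor.whiskerRight (dmNat ω) (LC (Ar A) ⋙ LC A))).symm ≪≫
    (Functor.associator _ _ _).symm ≪≫
    Functor.isoWhiskerRight (asIso (Functor.whiskerRight (dmNat τ) (LC (Ar A))) ≪≫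
      Functor.isoWhiskerRight (dmComp _ _) _ ≪≫ Functor.associator _ _ _ ≪≫
      Functor.isoWhiskerLeft _ (LCj (Ar A)) ≪≫ Functor.rightUnitor _) (LC A) ≪≫ LCi A

lemma glue2 (f0 f1 : A ⥤ B) (α : f0 ⟶ f1) (g1 g0 : B ⥤ A) (β : g1 ⟶ g0) [Exa f0] [Exa f1]
    [Exa g0] [Exa g1] (K : B ⥤ B) [Exa K]
    (z : ∀ M, IsZero (f1.obj (g0.obj M))) (ε : g1 ⋙ f1 ⟶ 𝟭 B) (ρ : g0 ⋙ f0 ⟶ 𝟭 B)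
    (hερ : ∀ N, α.app (g1.obj N) ≫ ε.app N = f0.map (β.app N) ≫ ρ.app N)
    (κ : 𝟭 B ⟶ K) (w : ∀ N, ρ.app N ≫ κ.app N = 0)
    (h : ∀ N, (ShortComplex.mk (ρ.app N) (κ.app N) (w N)).ShortExact)
    (w' : ∀ N, α.app (g1.obj N) ≫ ε.app N ≫ κ.app N = 0)
    (h' : ∀ N, (ShortComplex.mk (α.app (g1.obj N)) (ε.app N ≫ κ.app N) (w' N)).ShortExact) :
    Nonempty ((dm (mkF β) ⋙ LC A) ⋙ (dm (mkF α) ⋙ LC B) ≅ shiftFunctor _ (1 : ℤ)) := by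
  let μ : g1 ⋙ mkF α ⟶ mkF ρ := mkFhom (α := Functor.whiskerLeft g1 α)
    (Functor.whiskerRight β f0) ε (by ext M; exact (hερ M))
  have hμ : ∀ X, IsIso ((LC B).map ((dmNat μ).app X)) := fun X =>
    sq2 (Functor.whiskerLeft g1 α) ρ (Functor.whiskerRight β f0) ε _ κ w h w' h' X
  let l : mkF ρ ⟶ g0 ⋙ mkF α := mkFhom (α' := Functor.whiskerLeft g0 α) (𝟙 _) 0
    (by ext M; exact (z M).eq_of_tgt _ _)
  let ω : mkF (Functor.whiskerRight β (mkF α)) ⟶ mkF l := mkFhom μ (𝟙 _) (by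
    ext M : 2
    refine ComposableArrows.hom_ext₁ ?_ ((z M).eq_of_tgt _ _)
    rfl)
  have hω : ∀ X, IsIso ((LC B).map ((LC (Ar B)).map ((dmNat ω).app X))) := by
    intro X
    apply LC_five2
    · apply isIso_map_dmNat
      exact (inferInstance : IsIso (𝟙 (g0 ⋙ mkF α)))
    · exact isIso_of_map_whisker ω (ev _ 0) (LC B) X (hμ X)
  let τ : jF B ⋙ iF (Ar B) ⟶ mkF l := mkFhom (α := Functor.whiskerLeft (jF B) (0 : 𝟭 (Ar B) ⟶ zF _ (Ar B)))
    (mkFhom (α := (0 : zF B B ⟶ 𝟭 B)) 0 (𝟙 _)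
      (by ext M; exact (isZero_zero B).eq_of_src _ _)) 0 (by
        ext M : 2
        exact ComposableArrows.hom_ext₁ ((isZero_zero B).eq_of_src _ _) ((z M).eq_of_tgt _ _))
  have hτ : ∀ X, IsIso ((LC (Ar B)).map ((dmNat τ).app X)) := by
    intro X
    refine LC_iso_left τ (mkFhom l (𝟙 _) rfl) (fun M => ?_) (fun M => ?_) X
    · refine ComposableArrows.hom_ext₁ ?_ ((isZero_zero _).eq_of_src _ _)
      exact ComposableArrows.hom_ext₁ ((isZero_zero B).eq_of_src _ _) ((z M).eq_of_tgt _ _)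
    · apply ar_shortExact
      · apply ar_shortExact
        · exact ses_right_id (inferInstanceAs (IsIso (𝟙 (f0.obj (g0.obj M))))) (isZero_zero _)
        · exact ses_left_id (inferInstanceAs (IsIso (𝟙 M))) (z M)
      · exact ses_right_id (inferInstanceAs (IsIso (𝟙 ((mkF α).obj (g0.obj M))))) (isZero_zero _)
  have i1 : IsIso (Functor.whiskerRight (dmNat ω) (LC (Ar B) ⋙ LC B)) := by
    have : ∀ X, IsIso ((Functor.whiskerRight (dmNat ω) (LC (Ar B) ⋙ LC B)).app X) := hω
    exact NatIso.isIso_of_isIso_app _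
  have i2 : IsIso (Functor.whiskerRight (dmNat τ) (LC (Ar B))) := by
    have : ∀ X, IsIso ((Functor.whiskerRight (dmNat τ) (LC (Ar B))).app X) := hτ
    exact NatIso.isIso_of_isIso_app _
  let e0 : mkF β ⋙ arF (mkF α) ≅ mkF (Functor.whiskerRight β (mkF α)) :=
    NatIso.ofComponents (fun M => ComposableArrows.isoMk₁ (Iso.refl _) (Iso.refl _)
      ((Category.comp_id _).trans (Category.id_comp _).symm))
      (fun f => ComposableArrows.hom_ext₁ ((Category.comp_id _).trans (Category.id_comp _).symm)
        ((Category.comp_id _).trans (Category.id_comp _).symm))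
  refine ⟨?_⟩
  refine Functor.associator _ _ _ ≪≫ Functor.isoWhiskerLeft _ ((Functor.associator _ _ _).symm ≪≫
    Functor.isoWhiskerRight (bc (mkF α)).symm _ ≪≫ Functor.associator _ _ _) ≪≫
    (Functor.associator _ _ _).symm ≪≫
    Functor.isoWhiskerRight ((dmComp (mkF β) (arF (mkF α))).symm ≪≫ dmIso e0) _ ≪≫
    asIso (Functor.whiskerRight (dmNat ω) (LC (Ar B) ⋙ LC B)) ≪≫
    (Functor.associator _ _ _).symm ≪≫
    Functor.isoWhiskerRight ((asIso (Functor.whiskerRight (dmNat τ) (LC (Ar B)))).symm ≪≫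
      Functor.isoWhiskerRight (dmComp _ _) _ ≪≫ Functor.associator _ _ _ ≪≫
      Functor.isoWhiskerLeft _ (LCi (Ar B))) (LC B) ≪≫ Functor.associator _ _ _ ≪≫
      Functor.isoWhiskerLeft _ ((LC B).commShiftIso (1 : ℤ)) ≪≫ (Functor.associator _ _ _).symm ≪≫
      Functor.isoWhiskerRight (LCj B) _ ≪≫ Functor.leftUnitor _

lemma isEquivalence_of_comps {T T' : Type*} [Category T] [Category T'] (F : T ⥤ T') (G : T' ⥤ T)
    (h1 : (F ⋙ G).IsEquivalence) (h2 : (G ⋙ F).IsEquivalence) : F.IsEquivalence := by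
  have hF : F.Faithful := Functor.Faithful.of_comp F G
  have hG : G.Faithful := Functor.Faithful.of_comp G F
  have : F.EssSurj := ⟨fun Y => ⟨G.obj ((G ⋙ F).objPreimage Y), ⟨(G ⋙ F).objObjPreimageIso Y⟩⟩⟩
  have : F.Full := Functor.Full.of_comp_faithful F G
  exact { }

/-- derived equivalence of abelian categories -/
def DEq (A B : Type*) [Category A] [Category B] [Abelian A] [Abelian B] : Prop :=
  ∃ (F : DerivedCategory A ⥤ DerivedCategory B) (c : F.CommShift ℤ),
    haveI := c; F.IsTriangulated ∧ F.IsEquivalence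

/-- the main abstract equivalence -/
theorem glue (f0 f1 : A ⥤ B) (α : f0 ⟶ f1) (g1 g0 : B ⥤ A) (β : g1 ⟶ g0) [Exa f0] [Exa f1]
    [Exa g0] [Exa g1] (K : A ⥤ A) [Exa K]
    (z : ∀ M, IsZero (g1.obj (f0.obj M))) (η : 𝟭 A ⟶ f1 ⋙ g1) (π : 𝟭 A ⟶ f0 ⋙ g0)
    (hηπ : ∀ M, η.app M ≫ β.app (f1.obj M) = π.app M ≫ g0.map (α.app M))
    (κ : K ⟶ 𝟭 A) (w : ∀ M, κ.app M ≫ π.app M = 0)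
    (h : ∀ M, (ShortComplex.mk (κ.app M) (π.app M) (w M)).ShortExact)
    (w' : ∀ M, (κ.app M ≫ η.app M) ≫ β.app (f1.obj M) = 0)
    (h' : ∀ M, (ShortComplex.mk (κ.app M ≫ η.app M) (β.app (f1.obj M)) (w' M)).ShortExact)
    (K₂ : B ⥤ B) [Exa K₂]
    (z₂ : ∀ M, IsZero (f1.obj (g0.obj M))) (ε : g1 ⋙ f1 ⟶ 𝟭 B) (ρ : g0 ⋙ f0 ⟶ 𝟭 B)
    (hερ : ∀ N, α.app (g1.obj N) ≫ ε.app N = f0.map (β.app N) ≫ ρ.app N)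
    (κ₂ : 𝟭 B ⟶ K₂) (w₂ : ∀ N, ρ.app N ≫ κ₂.app N = 0)
    (h₂ : ∀ N, (ShortComplex.mk (ρ.app N) (κ₂.app N) (w₂ N)).ShortExact)
    (w₂' : ∀ N, α.app (g1.obj N) ≫ ε.app N ≫ κ₂.app N = 0)
    (h₂' : ∀ N, (ShortComplex.mk (α.app (g1.obj N)) (ε.app N ≫ κ₂.app N) (w₂' N)).ShortExact) :
    DEq A B := by
  obtain ⟨e1⟩ := glue1 f0 f1 α g1 g0 β K z η π hηπ κ w h w' h'
  obtain ⟨e2⟩ := glue2 f0 f1 α g1 g0 β K₂ z₂ ε ρ hερ κ₂ w₂ h₂ w₂' h₂'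
  refine ⟨dm (mkF α) ⋙ LC B, inferInstance, inferInstance, ?_⟩
  exact isEquivalence_of_comps _ (dm (mkF β) ⋙ LC A)
    (Functor.isEquivalence_of_iso e1.symm) (Functor.isEquivalence_of_iso e2.symm)

lemma DEq.refl : DEq A A := ⟨𝟭 _, inferInstance, inferInstance, inferInstance⟩

lemma DEq.trans {A B C : Type*} [Category A] [Category B] [Abelian A] [Abelian B] [Category C]
    [Abelian C] (h : DEq A B) (h' : DEq B C) : DEq A C := by
  obtain ⟨F, c, t, e⟩ := h
  obtain ⟨F', c', t', e'⟩ := h'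
  exact ⟨F ⋙ F', inferInstance, inferInstance, inferInstance⟩

lemma DEq.symm (h : DEq A B) : DEq B A := by
  obtain ⟨F, c, t, e⟩ := h
  let E := F.asEquivalence
  letI : E.functor.CommShift ℤ := c
  letI : E.inverse.CommShift ℤ := E.commShiftInverse ℤ
  have := E.commShift_of_functor ℤ
  have : E.functor.IsTriangulated := t
  have : E.toAdjunction.CommShift ℤ := inferInstance
  exact ⟨E.inverse, inferInstance, E.toAdjunction.isTriangulated_rightAdjoint, inferInstance⟩

lemma DEq.of_equiv (e : A ≌ B) : DEq A B := by
  have : Exa e.functor := ⟨inferInstance, inferInstance⟩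
  have : Exa e.inverse := ⟨inferInstance, inferInstance⟩
  refine ⟨dm e.functor, inferInstance, inferInstance, ?_⟩
  apply isEquivalence_of_comps _ (dm e.inverse)
  · exact Functor.isEquivalence_of_iso (dmId.symm ≪≫ dmIso e.unitIso ≪≫ dmComp _ _)
  · exact Functor.isEquivalence_of_iso (dmId.symm ≪≫ dmIso e.counitIso.symm ≪≫ dmComp _ _)

end Glue
end NakE8

end

section
open CategoryTheory
open CategoryTheory.Limits CategoryTheory.Pretriangulated
open MulOpposite

namespace NakE8

/-- Relations of a path algebra with zero relations and commutativity relations. -/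
inductive GRel (k : Type) [Field k] (Q : PreQuiver) (R0 : Set (List Q.A))
    (R1 : Set (List Q.A × List Q.A)) :
    FreeAlgebra k (Q.V ⊕ Q.A) → FreeAlgebra k (Q.V ⊕ Q.A) → Prop
  | base {x y} (h : PathAlgRel k Q R0 x y) : GRel k Q R0 R1 x y
  | eqRel (p : List Q.A × List Q.A) (hp : p ∈ R1) :
      GRel k Q R0 R1 ((p.1.map fun a => FreeAlgebra.ι k (Sum.inr a)).prod)
        ((p.2.map fun a => FreeAlgebra.ι k (Sum.inr a)).prod)

abbrev GAlg (k : Type) [Field k] (Q : PreQuiver) (R0 : Set (List Q.A))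
    (R1 : Set (List Q.A × List Q.A)) : Type := RingQuot (GRel k Q R0 R1)

section
variable {k : Type} [Field k] {Q : PreQuiver} {R0 : Set (List Q.A)}
  {R1 : Set (List Q.A × List Q.A)}

lemma GRel_empty : GRel k Q R0 ∅ = PathAlgRel k Q R0 := by
  funext x y
  apply propext
  constructor
  · rintro (h | ⟨p, hp⟩)
    · exact h
    · exact absurd hp (Set.notMem_empty _)
  · exact GRel.base

namespace GAlg
variable (k R0 R1)
noncomputable def e (v : Q.V) : GAlg k Q R0 R1 :=
  RingQuot.mkAlgHom k _ (FreeAlgebra.ι k (Sum.inl v))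
noncomputable def x (a : Q.A) : GAlg k Q R0 R1 :=
  RingQuot.mkAlgHom k _ (FreeAlgebra.ι k (Sum.inr a))

lemma idem (v : Q.V) : e k R0 R1 v * e k R0 R1 v = e k R0 R1 v := by
  unfold e; rw [← map_mul]
  exact RingQuot.mkAlgHom_rel k (.base (.idem v))
lemma orth (v w : Q.V) (h : v ≠ w) : e k R0 R1 v * e k R0 R1 w = 0 := by
  unfold e; rw [← map_mul, ← map_zero (RingQuot.mkAlgHom k _)]
  exact RingQuot.mkAlgHom_rel k (.base (.orth v w h))
lemma unit : ∑ v : Q.V, e k R0 R1 v = 1 := by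
  unfold e; rw [← map_sum, ← map_one (RingQuot.mkAlgHom k _)]
  exact RingQuot.mkAlgHom_rel k (.base .unit)
lemma source (a : Q.A) : e k R0 R1 (Q.s a) * x k R0 R1 a = x k R0 R1 a := by
  unfold e x; rw [← map_mul]
  exact RingQuot.mkAlgHom_rel k (.base (.source a))
lemma target (a : Q.A) : x k R0 R1 a * e k R0 R1 (Q.t a) = x k R0 R1 a := by
  unfold e x; rw [← map_mul]
  exact RingQuot.mkAlgHom_rel k (.base (.target a))
lemma mk_prod (p : List Q.A) :
    RingQuot.mkAlgHom k (GRel k Q R0 R1) ((p.map fun a => FreeAlgebra.ι k (Sum.inr a)).prod) =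
     (p.map (x k R0 R1)).prod := by
  rw [map_list_prod, List.map_map]; rfl
lemma zeroRel (p : List Q.A) (hp : p ∈ R0) : (p.map (x k R0 R1)).prod = 0 := by
  rw [← mk_prod, ← map_zero (RingQuot.mkAlgHom k _)]
  exact RingQuot.mkAlgHom_rel k (.base (.zeroRel p hp))
lemma eqRel (p q : List Q.A) (hp : (p, q) ∈ R1) :
    (p.map (x k R0 R1)).prod = (q.map (x k R0 R1)).prod := by
  rw [← mk_prod, ← mk_prod]
  exact RingQuot.mkAlgHom_rel k (.eqRel (p, q) hp)

variable {k R0 R1}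

noncomputable def lift {B : Type} [Ring B] [Algebra k B] (E : Q.V → B) (X : Q.A → B)
    (h1 : ∀ v, E v * E v = E v) (h2 : ∀ v w, v ≠ w → E v * E w = 0) (h3 : ∑ v, E v = 1)
    (h4 : ∀ a, E (Q.s a) * X a = X a) (h5 : ∀ a, X a * E (Q.t a) = X a)
    (h6 : ∀ p ∈ R0, (p.map X).prod = 0)
    (h7 : ∀ p ∈ R1, (p.1.map X).prod = (p.2.map X).prod) : GAlg k Q R0 R1 →ₐ[k] B :=
  RingQuot.liftAlgHom k ⟨FreeAlgebra.lift k (Sum.elim E X), by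
    rintro x y (h | ⟨p, hp⟩)
    · cases h with
      | idem v => simp [h1]
      | orth v w h => simp [h2 v w h]
      | unit => simp [h3]
      | source a => simp [h4]
      | target a => simp [h5]
      | zeroRel p hp =>
        rw [map_list_prod, List.map_map, map_zero, ← h6 p hp]
        congr 1; apply List.map_congr_left; intro a _; simp
    · rw [map_list_prod, List.map_map, map_list_prod, List.map_map]
      have h8 : ∀ l : List Q.A, List.map ((FreeAlgebra.lift k (Sum.elim E X)) ∘
          fun a => FreeAlgebra.ι k (Sum.inr a)) l = l.map X := fun l => by
        apply List.map_congr_left; intro a _; simp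
      rw [h8, h8]
      exact h7 p hp⟩

lemma lift_e {B : Type} [Ring B] [Algebra k B] (E : Q.V → B) (X : Q.A → B) (h1 h2 h3 h4 h5 h6 h7)
   (v : Q.V) : lift (k := k) (R0 := R0) (R1 := R1) E X h1 h2 h3 h4 h5 h6 h7 (e k R0 R1 v) = E v := by
  unfold lift e; simp
lemma lift_x {B : Type} [Ring B] [Algebra k B] (E : Q.V → B) (X : Q.A → B) (h1 h2 h3 h4 h5 h6 h7)
   (v : Q.A) : lift (k := k) (R0 := R0) (R1 := R1) E X h1 h2 h3 h4 h5 h6 h7 (x k R0 R1 v) = X v := by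
  unfold lift x; simp

lemma ind {P : GAlg k Q R0 R1 → Prop} (h0 : ∀ c : k, P (algebraMap k _ c))
    (hv : ∀ v, P (e k R0 R1 v)) (ha : ∀ a, P (x k R0 R1 a)) (hm : ∀ x y, P x → P y → P (x * y))
    (hadd : ∀ x y, P x → P y → P (x + y)) (z : GAlg k Q R0 R1) : P z := by
  obtain ⟨z, rfl⟩ := RingQuot.mkAlgHom_surjective k _ z
  induction z using FreeAlgebra.induction with
  | grade0 r => rw [AlgHom.commutes]; exact h0 r
  | grade1 i => rcases i with v | a; exacts [hv v, ha a]
  | mul a b ha hb => rw [map_mul]; exact hm _ _ ha hb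
  | add a b ha hb => rw [map_add]; exact hadd _ _ ha hb

lemma hom_ext {B : Type} [Ring B] [Algebra k B] (f g : GAlg k Q R0 R1 →ₐ[k] B)
    (hv : ∀ v, f (e k R0 R1 v) = g (e k R0 R1 v)) (ha : ∀ a, f (x k R0 R1 a) = g (x k R0 R1 a)) :
    f = g := by
  refine AlgHom.ext fun z => ?_
  induction z using ind with
  | h0 => simp
  | hv v => exact hv v
  | ha a => exact ha a
  | hm a b ha hb => rw [map_mul, map_mul, ha, hb]
  | hadd a b ha hb => rw [map_add, map_add, ha, hb]

end GAlg

section Ops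
open Classical in
noncomputable def opT {M : Q.V → Type} [∀ v, AddCommGroup (M v)] [∀ v, Module k (M v)]
    (m : ∀ a, M (Q.s a) →ₗ[k] M (Q.t a)) (a : Q.A) : Module.End k (∀ v, M v) :=
  LinearMap.single k M (Q.t a) ∘ₗ m a ∘ₗ LinearMap.proj (Q.s a)

noncomputable def opP {M : Q.V → Type} [∀ v, AddCommGroup (M v)] [∀ v, Module k (M v)]
    (m : ∀ a, M (Q.s a) →ₗ[k] M (Q.t a)) : List Q.A → Module.End k (∀ v, M v)
  | [] => 1
  | a :: p => opP m p * opT m a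
end Ops
end

/-- Representations of a quiver with relations. -/
structure QR (k : Type) [Field k] (Q : PreQuiver) (R0 : Set (List Q.A))
    (R1 : Set (List Q.A × List Q.A)) where
  M : Q.V → Type
  [ab : ∀ v, AddCommGroup (M v)]
  [mo : ∀ v, Module k (M v)]
  m : ∀ a, M (Q.s a) →ₗ[k] M (Q.t a)
  h0 : ∀ p ∈ R0, opP m p = 0
  h1 : ∀ p ∈ R1, opP m p.1 = opP m p.2

attribute [instance] QR.ab QR.mo

namespace QR
variable {k : Type} [Field k] {Q : PreQuiver} {R0 : Set (List Q.A)}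
  {R1 : Set (List Q.A × List Q.A)}

@[ext] structure Hom (X Y : QR k Q R0 R1) where
  f : ∀ v, X.M v →ₗ[k] Y.M v
  comm : ∀ a x, Y.m a (f (Q.s a) x) = f (Q.t a) (X.m a x)

instance : Category (QR k Q R0 R1) where
  Hom := Hom
  id X := ⟨fun _ => LinearMap.id, fun _ _ => rfl⟩
  comp f g := ⟨fun v => g.f v ∘ₗ f.f v, fun a x => by simp [g.comm, f.comm]⟩

lemma hom_ext {X Y : QR k Q R0 R1} (f g : X ⟶ Y) (h : ∀ v x, f.f v x = g.f v x) : f = g := by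
  apply Hom.ext
  funext v; ext x; exact h v x
@[simp] lemma id_f (X : QR k Q R0 R1) (v x) : Hom.f (𝟙 X) v x = x := rfl
@[simp] lemma comp_f {X Y Z : QR k Q R0 R1} (f : X ⟶ Y) (g : Y ⟶ Z) (v x) :
   (f ≫ g).f v x = g.f v (f.f v x) := rfl

def Tot (X : QR k Q R0 R1) : Type := ∀ v, X.M v
instance (X : QR k Q R0 R1) : AddCommGroup X.Tot := inferInstanceAs (AddCommGroup (∀ v, X.M v))
instance (X : QR k Q R0 R1) : Module k X.Tot := inferInstanceAs (Module k (∀ v, X.M v))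

open Classical in
noncomputable def sing (X : QR k Q R0 R1) (v : Q.V) : X.M v →ₗ[k] X.Tot := LinearMap.single k X.M v
def prj (X : QR k Q R0 R1) (v : Q.V) : X.Tot →ₗ[k] X.M v := LinearMap.proj v

lemma tot_ext {X : QR k Q R0 R1} {x y : X.Tot} (h : ∀ v, X.prj v x = X.prj v y) : x = y :=
  funext h
@[simp] lemma prj_sing (X : QR k Q R0 R1) (v : Q.V) (x : X.M v) : X.prj v (X.sing v x) = x := by
  classical
  exact Pi.single_eq_same (M := X.M) v x
lemma prj_sing_ne (X : QR k Q R0 R1) {v w : Q.V} (h : v ≠ w) (x : X.M v) :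
    X.prj w (X.sing v x) = 0 := by
  classical
  exact Pi.single_eq_of_ne (M := X.M) h.symm x
lemma sum_sing (X : QR k Q R0 R1) (x : X.Tot) : ∑ v, X.sing v (X.prj v x) = x := by
  classical
  apply tot_ext
  intro w
  rw [map_sum, Finset.sum_eq_single w]
  · simp
  · intro b _ hb; exact prj_sing_ne X hb _
  · simp

noncomputable def oT (X : QR k Q R0 R1) (a : Q.A) : Module.End k X.Tot := X.sing _ ∘ₗ X.m a ∘ₗ X.prj _
lemma oT_prod (X : QR k Q R0 R1) (p : List Q.A) :
    (p.map fun a => op (X.oT a)).prod = op (show Module.End k X.Tot from opP X.m p) := by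
  induction p with
  | nil => rfl
  | cons a p ih => rw [List.map_cons, List.prod_cons, ih]; rfl

noncomputable def act (X : QR k Q R0 R1) : GAlg k Q R0 R1 →ₐ[k] (Module.End k X.Tot)ᵐᵒᵖ :=
  GAlg.lift (fun v => op (X.sing v ∘ₗ X.prj v)) (fun a => op (X.oT a))
    (fun v => by rw [← MulOpposite.op_mul]; congr 1; ext x; simp)
    (fun v w h => by
      rw [← MulOpposite.op_mul]; apply congrArg op; ext x; simp [prj_sing_ne X h])
    (by
      rw [← Finset.op_sum, ← MulOpposite.op_one]; congr 1; ext x : 1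
      rw [LinearMap.sum_apply]; exact sum_sing X x)
    (fun a => by
      rw [← MulOpposite.op_mul]; congr 1; ext x : 1
      exact congrArg (fun z => X.sing _ (X.m a z)) (prj_sing X _ _))
    (fun a => by
      rw [← MulOpposite.op_mul]; congr 1; ext x : 1
      exact congrArg (fun z => X.sing _ z) (prj_sing X _ _))
    (fun p hp => by
      rw [oT_prod, X.h0 p hp]; rfl)
    (fun p hp => by
      rw [oT_prod, oT_prod, X.h1 p hp])

noncomputable instance (X : QR k Q R0 R1) : Module (GAlg k Q R0 R1)ᵐᵒᵖ X.Tot :=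
  Module.compHom X.Tot (AlgHom.opComm (act X)).toRingHom

lemma smul_def (X : QR k Q R0 R1) (z : GAlg k Q R0 R1) (x : X.Tot) :
   op z • x = unop (act X z) x := rfl
lemma smul_e (X : QR k Q R0 R1) (v) (x : X.Tot) :
   op (GAlg.e k R0 R1 v) • x = X.sing v (X.prj v x) := by
  rw [smul_def, act, GAlg.lift_e]; rfl
lemma smul_x (X : QR k Q R0 R1) (a) (x : X.Tot) :
   op (GAlg.x k R0 R1 a) • x = X.sing _ (X.m a (X.prj _ x)) := by
  rw [smul_def, act, GAlg.lift_x]; rfl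
lemma smul_k (X : QR k Q R0 R1) (c : k) (x : X.Tot) :
   op (algebraMap k (GAlg k Q R0 R1) c) • x = c • x := by
  rw [smul_def, AlgHom.commutes]; rfl

def mkLin {N N' : Type} [AddCommGroup N] [AddCommGroup N'] [Module (GAlg k Q R0 R1)ᵐᵒᵖ N]
    [Module (GAlg k Q R0 R1)ᵐᵒᵖ N'] (g : N →+ N')
    (h0 : ∀ (c : k) (n : N), g (op (algebraMap k (GAlg k Q R0 R1) c) • n) =
      op (algebraMap k (GAlg k Q R0 R1) c) • g n)
    (hv : ∀ v n, g (op (GAlg.e k R0 R1 v) • n) = op (GAlg.e k R0 R1 v) • g n)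
    (ha : ∀ v n, g (op (GAlg.x k R0 R1 v) • n) = op (GAlg.x k R0 R1 v) • g n) :
    N →ₗ[(GAlg k Q R0 R1)ᵐᵒᵖ] N' where
  toFun := g
  map_add' := g.map_add
  map_smul' z n := by
    obtain ⟨z, rfl⟩ := op_surjective z
    induction z using GAlg.ind generalizing n with
    | h0 c => exact h0 c n
    | hv v => exact hv v n
    | ha a => exact ha a n
    | hm a b ha hb => simp only [MulOpposite.op_mul, mul_smul, ha, hb, RingHom.id_apply] at *
    | hadd a b ha hb => simp only [MulOpposite.op_add, add_smul, map_add, ha, hb, RingHom.id_apply] at *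

def totMap {X Y : QR k Q R0 R1} (f : X ⟶ Y) : X.Tot →+ Y.Tot where
  toFun x := fun v => f.f v (x v)
  map_zero' := by funext v; exact (f.f v).map_zero
  map_add' x y := by funext v; exact (f.f v).map_add _ _

lemma prj_totMap {X Y : QR k Q R0 R1} (f : X ⟶ Y) (v x) :
    Y.prj v (totMap f x) = f.f v (X.prj v x) := rfl
lemma totMap_sing {X Y : QR k Q R0 R1} (f : X ⟶ Y) (v x) :
    totMap f (X.sing v x) = Y.sing v (f.f v x) := by
  apply tot_ext
  intro w
  rw [prj_totMap]
  by_cases h : v = w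
  · subst h; simp
  · simp [prj_sing_ne _ h]

variable (k Q R0 R1) in
/-- The functor from representations to modules. -/
noncomputable def toMod : QR k Q R0 R1 ⥤ ModuleCat.{0} (GAlg k Q R0 R1)ᵐᵒᵖ where
  obj X := ModuleCat.of _ X.Tot
  map {X Y} f := ModuleCat.ofHom (mkLin (totMap f)
    (fun c n => by
      rw [smul_k, smul_k]; funext v; exact (f.f v).map_smul _ _)
    (fun v n => by rw [smul_e, smul_e, totMap_sing]; rfl)
    (fun a n => by rw [smul_x, smul_x, totMap_sing, ← f.comm]; rfl))
  map_id X := rfl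
  map_comp f g := rfl

lemma toMod_map_apply {X Y : QR k Q R0 R1} (f : X ⟶ Y) (x : X.Tot) :
    ((toMod k Q R0 R1).map f).hom x = totMap f x := rfl

instance : (toMod k Q R0 R1).Faithful where
  map_injective {X Y f g} h := by
    apply hom_ext
    intro v x
    have := congrArg (fun z => Y.prj v (z.hom (X.sing v x))) h
    simpa only [toMod_map_apply, totMap_sing, prj_sing] using this

instance : (toMod k Q R0 R1).Full where
  map_surjective {X Y} g := by
    let g' : X.Tot →ₗ[(GAlg k Q R0 R1)ᵐᵒᵖ] Y.Tot := g.hom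
    have hk : ∀ (c : k) x, g' (c • x) = c • g' x := fun c x => by
      rw [← smul_k, ← smul_k, map_smul]
    let g'' : X.Tot →ₗ[k] Y.Tot := { g' with map_smul' := hk }
    refine ⟨⟨fun v => Y.prj v ∘ₗ g'' ∘ₗ X.sing v, ?_⟩, ?_⟩
    · intro a x
      have h : g' (op (GAlg.x k R0 R1 a) • X.sing _ x) = op (GAlg.x k R0 R1 a) • g' (X.sing _ x) :=
        map_smul _ _ _
      rw [smul_x, smul_x, prj_sing] at h
      have h2 := congrArg (Y.prj (Q.t a)) h
      rw [prj_sing] at h2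
      exact h2.symm
    · ext x
      apply tot_ext
      intro v
      change X.Tot at x
      have h : g' (op (GAlg.e k R0 R1 v) • x) = op (GAlg.e k R0 R1 v) • g' x :=
        map_smul _ _ _
      rw [smul_e, smul_e] at h
      have h2 := congrArg (Y.prj v) h
      rw [prj_sing] at h2
      exact h2

section ess
variable (N : Type) [AddCommGroup N] [Module (GAlg k Q R0 R1)ᵐᵒᵖ N] [Module k N]

lemma smul_comm' (hk : ∀ (c : k) (n : N), op (algebraMap k (GAlg k Q R0 R1) c) • n = c • n)
    (z : GAlg k Q R0 R1) (c : k) (n : N) : op z • (c • n) = c • (op z • n) := by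
  rw [← hk, ← hk, smul_smul, smul_smul, ← MulOpposite.op_mul, ← MulOpposite.op_mul, Algebra.commutes]

variable (hk : ∀ (c : k) (n : N), op (algebraMap k (GAlg k Q R0 R1) c) • n = c • n)

noncomputable def eact (z : GAlg k Q R0 R1) : N →ₗ[k] N where
  toFun n := op z • n
  map_add' := smul_add _
  map_smul' c n := smul_comm' N hk z c n

noncomputable def essM (v : Q.V) : Submodule k N := LinearMap.range (eact N hk (GAlg.e k R0 R1 v))
lemma mem_essM (v : Q.V) (n : N) : n ∈ essM N hk v ↔ op (GAlg.e k R0 R1 v) • n = n := by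
  constructor
  · rintro ⟨n, rfl⟩
    show op (GAlg.e k R0 R1 v) • op (GAlg.e k R0 R1 v) • n = op (GAlg.e k R0 R1 v) • n
    rw [smul_smul, ← MulOpposite.op_mul, GAlg.idem]
  · intro h; exact ⟨n, h⟩

noncomputable def essm (a : Q.A) : essM N hk (Q.s a) →ₗ[k] essM N hk (Q.t a) :=
  (eact N hk (GAlg.x k R0 R1 a)).restrict (fun n _ => by
    rw [mem_essM]
    show op (GAlg.e k R0 R1 _) • op (GAlg.x k R0 R1 a) • n = op (GAlg.x k R0 R1 a) • n
    rw [smul_smul, ← MulOpposite.op_mul, GAlg.target])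

noncomputable def essPhi : N →ₗ[k] (∀ v, essM N hk v) :=
  LinearMap.pi (fun v => (eact N hk (GAlg.e k R0 R1 v)).rangeRestrict)

lemma essPhi_apply (n : N) (v) : (essPhi N hk n v : N) = op (GAlg.e k R0 R1 v) • n := rfl

lemma essPhi_bij : Function.Bijective (essPhi N hk) := by
  have hs : ∀ n : N, ∑ v, (essPhi N hk n v : N) = n := fun n => by
    simp only [essPhi_apply]
    rw [← Finset.sum_smul, ← Finset.op_sum, GAlg.unit, MulOpposite.op_one, one_smul]
  constructor
  · intro n n' h
    rw [← hs n, ← hs n', h]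
  · intro y
    refine ⟨∑ v, (y v : N), ?_⟩
    funext w
    apply Subtype.ext
    rw [essPhi_apply, Finset.smul_sum, Finset.sum_eq_single w]
    · exact (mem_essM N hk w _).1 (y w).2
    · intro v _ hv
      rw [← (mem_essM N hk v _).1 (y v).2, smul_smul, ← MulOpposite.op_mul, GAlg.orth _ _ _ _ _ hv]; simp
    · simp

lemma essPhi_x (a : Q.A) (n : N) :
    opT (essm N hk) a (essPhi N hk n) = essPhi N hk (op (GAlg.x k R0 R1 a) • n) := by
  classical
  funext w
  apply Subtype.ext
  rw [essPhi_apply, smul_smul, ← MulOpposite.op_mul]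
  show ((Pi.single (Q.t a) (essm N hk a (essPhi N hk n (Q.s a))) : ∀ v, essM N hk v) w : N) = _
  by_cases h : Q.t a = w
  · subst h
    rw [Pi.single_eq_same]
    show op (GAlg.x k R0 R1 a) • op (GAlg.e k R0 R1 _) • n = _
    rw [smul_smul, ← MulOpposite.op_mul, GAlg.source, GAlg.target]
  · rw [Pi.single_eq_of_ne (Ne.symm h), ← GAlg.target, mul_assoc, GAlg.orth _ _ _ _ _ h]; simp

lemma essPhi_p (p : List Q.A) (n : N) :
    opP (essm N hk) p (essPhi N hk n) = essPhi N hk (op ((p.map (GAlg.x k R0 R1)).prod) • n) := by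
  induction p generalizing n with
  | nil => simp [opP]
  | cons a p ih =>
    rw [opP, Module.End.mul_apply, essPhi_x, ih, List.map_cons, List.prod_cons, MulOpposite.op_mul, mul_smul]

noncomputable def essObj : QR k Q R0 R1 where
  M v := essM N hk v
  m := essm N hk
  h0 p hp := by
    refine LinearMap.ext fun y => ?_
    obtain ⟨n, rfl⟩ := (essPhi_bij N hk).2 y
    rw [essPhi_p, GAlg.zeroRel _ _ _ p hp]; simp
  h1 p hp := by
    refine LinearMap.ext fun y => ?_
    obtain ⟨n, rfl⟩ := (essPhi_bij N hk).2 y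
    rw [essPhi_p, essPhi_p, GAlg.eqRel _ _ _ p.1 p.2 hp]

noncomputable def essLin : N →ₗ[(GAlg k Q R0 R1)ᵐᵒᵖ] (essObj N hk).Tot :=
  mkLin (N' := (essObj N hk).Tot) (essPhi N hk).toAddMonoidHom
    (fun c n => by
      rw [hk, smul_k]; exact (essPhi N hk).map_smul c n)
    (fun v n => by
      rw [smul_e]
      classical
      funext w
      apply Subtype.ext
      show op (GAlg.e k R0 R1 w) • op (GAlg.e k R0 R1 v) • n = ((Pi.single v (essPhi N hk n v) : ∀ v, essM N hk v) w : N)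
      rw [smul_smul, ← MulOpposite.op_mul]
      by_cases h : v = w
      · subst h
        rw [Pi.single_eq_same, GAlg.idem]; rfl
      · rw [Pi.single_eq_of_ne (Ne.symm h), GAlg.orth _ _ _ _ _ h]; simp)
    (fun a n => by
      rw [smul_x]; exact (essPhi_x N hk a n).symm)
end ess

instance : (toMod k Q R0 R1).EssSurj where
  mem_essImage N := by
    let _ : Module k N := Module.compHom N (algebraMap k (GAlg k Q R0 R1)ᵐᵒᵖ)
    have hk : ∀ (c : k) (n : N), op (algebraMap k (GAlg k Q R0 R1) c) • n = c • n := fun _ _ => rfl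
    exact ⟨essObj N hk, ⟨(LinearEquiv.toModuleIso
      (LinearEquiv.ofBijective (essLin N hk) (essPhi_bij N hk))).symm⟩⟩

instance : (toMod k Q R0 R1).IsEquivalence where

end QR
end NakE8

end

section
open CategoryTheory
open CategoryTheory.Limits CategoryTheory.Pretriangulated
open MulOpposite

namespace NakE8
namespace QR
variable {k : Type} [Field k] {Q : PreQuiver} {R0 : Set (List Q.A)}
  {R1 : Set (List Q.A × List Q.A)}

noncomputable instance : Preadditive (QR k Q R0 R1) :=
  Preadditive.ofFullyFaithful (Functor.FullyFaithful.ofFullyFaithful (toMod k Q R0 R1))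

instance : (toMod k Q R0 R1).Additive :=
  Functor.FullyFaithful.additive_ofFullyFaithful _

instance : HasFiniteProducts (QR k Q R0 R1) :=
  ⟨fun _ => Adjunction.hasLimitsOfShape_of_equivalence (toMod k Q R0 R1)⟩

noncomputable instance : Abelian (QR k Q R0 R1) := abelianOfEquivalence (toMod k Q R0 R1)

noncomputable def toModEquiv : QR k Q R0 R1 ≌ ModuleCat.{0} (GAlg k Q R0 R1)ᵐᵒᵖ :=
  (toMod k Q R0 R1).asEquivalence

lemma f_eq {X Y : QR k Q R0 R1} (f : X ⟶ Y) (v x) :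
    f.f v x = Y.prj v (((toMod k Q R0 R1).map f).hom (X.sing v x)) := by
  rw [toMod_map_apply, totMap_sing, prj_sing]

@[simp] lemma add_f {X Y : QR k Q R0 R1} (f g : X ⟶ Y) (v x) :
    (f + g).f v x = f.f v x + g.f v x := by
  rw [f_eq, f_eq, f_eq, Functor.map_add]; rfl
@[simp] lemma zero_f {X Y : QR k Q R0 R1} (v x) :
    (0 : X ⟶ Y).f v x = 0 := by
  rw [f_eq, Functor.map_zero]; rfl

lemma isZero_of {X : QR k Q R0 R1} (h : ∀ v, Subsingleton (X.M v)) : IsZero X := by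
  rw [IsZero.iff_id_eq_zero]
  apply hom_ext
  intro v x
  exact (h v).elim _ _

lemma shortExact_iff (S : ShortComplex (QR k Q R0 R1)) : S.ShortExact ↔
    ∀ v, Function.Injective (S.f.f v) ∧ Function.Surjective (S.g.f v) ∧
      ∀ x, S.g.f v x = 0 → ∃ y, S.f.f v y = x := by
  have h1 : S.ShortExact ↔ (S.map (toMod k Q R0 R1)).ShortExact := by
    constructor
    · intro h; exact h.map_of_exact _
    · intro h
      have h1 : Mono ((toMod k Q R0 R1).map S.f) := h.mono_f
      have h2 : Epi ((toMod k Q R0 R1).map S.g) := h.epi_g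
      exact { exact := (ShortComplex.exact_map_iff_of_faithful S _).1 h.exact
              mono_f := (toMod k Q R0 R1).mono_of_mono_map h1
              epi_g := (toMod k Q R0 R1).epi_of_epi_map h2 }
  have h2 : (S.map (toMod k Q R0 R1)).ShortExact ↔
     (Function.Injective (totMap S.f) ∧ Function.Surjective (totMap S.g)) ∧
      ∀ x, totMap S.g x = 0 → ∃ y, totMap S.f y = x := by
    constructor
    · intro h
      have h1 : Mono ((toMod k Q R0 R1).map S.f) := h.mono_f
      have h2 : Epi ((toMod k Q R0 R1).map S.g) := h.epi_g
      exact ⟨⟨(ModuleCat.mono_iff_injective _).1 h1, (ModuleCat.epi_iff_surjective _).1 h2⟩,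
        (ShortComplex.moduleCat_exact_iff _).1 h.exact⟩
    · intro h
      have h1 : Mono ((toMod k Q R0 R1).map S.f) := (ModuleCat.mono_iff_injective _).2 h.1.1
      have h2 : Epi ((toMod k Q R0 R1).map S.g) := (ModuleCat.epi_iff_surjective _).2 h.1.2
      exact { exact := (ShortComplex.moduleCat_exact_iff _).2 h.2
              mono_f := h1
              epi_g := h2 }
  rw [h1, h2]
  constructor
  · rintro ⟨⟨h3, h4⟩, h5⟩ v
    refine ⟨?_, ?_, ?_⟩
    · intro x y h
      have := @h3 (S.X₁.sing v x) (S.X₁.sing v y) (by rw [totMap_sing, totMap_sing, h])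
      simpa using congrArg (S.X₁.prj v) this
    · intro y
      obtain ⟨x, hx⟩ := h4 (S.X₃.sing v y)
      exact ⟨S.X₂.prj v x, by rw [← prj_totMap, hx, prj_sing]⟩
    · intro x hx
      obtain ⟨y, hy⟩ := h5 (S.X₂.sing v x) (by rw [totMap_sing, hx, map_zero])
      exact ⟨S.X₁.prj v y, by rw [← prj_totMap, hy, prj_sing]⟩
  · intro h
    refine ⟨⟨?_, ?_⟩, ?_⟩
    · intro x y hxy
      funext v
      exact (h v).1 (congrFun hxy v)
    · intro y
      choose x hx using fun v => (h v).2.1 (y v)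
      exact ⟨x, funext hx⟩
    · intro x hx
      choose y hy using fun v => (h v).2.2 (x v) (congrFun hx v)
      exact ⟨y, funext hy⟩

end QR
end NakE8

end

section
open CategoryTheory
open CategoryTheory.Limits CategoryTheory.Pretriangulated

namespace NakE8

open Classical in
noncomputable def sgl {V : Type} {M : V → Type} [∀ v, AddCommGroup (M v)] (v : V) (x : M v) : ∀ v, M v :=
  Pi.single v x
lemma sgl_same {V : Type} {M : V → Type} [∀ v, AddCommGroup (M v)] (v : V) (x : M v) :
    sgl v x v = x := by
  classical exact Pi.single_eq_same v x
lemma sgl_zero {V : Type} {M : V → Type} [∀ v, AddCommGroup (M v)] (v : V) :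
    sgl v (0 : M v) = 0 := by
  classical exact Pi.single_zero v

/-- Combinatorial data of a zone. -/
structure Zone where
  (V X Y Sg AV AVX AX AY : Type)
  [fV : Fintype V]
  [fX : Fintype X]
  [fY : Fintype Y]
  [fS : Fintype Sg]
  [dS : DecidableEq Sg]
  sV : AV → V
  tV : AV → V
  sVX : AVX → V
  tVX : AVX → X
  sX : AX → X
  tX : AX → X
  sY : AY → Y
  tY : AY → Y
  σ : Sg → Y

attribute [instance] Zone.fV Zone.fX Zone.fY Zone.fS Zone.dS

namespace Zone

/-- Arrows. -/
inductive Arr (Z : Zone) : Type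
  | vv (a : Z.AV)
  | vx (a : Z.AVX)
  | xx (a : Z.AX)
  | yy (a : Z.AY)
  | c (u : Z.X) (s : Z.Sg)

variable (Z : Zone)

abbrev Vx := Z.V ⊕ (Z.X ⊕ Z.Y)

@[reducible] def QA : PreQuiver where
  V := Z.Vx
  A := Z.Arr
  s := fun
    | .vv a => .inl (Z.sV a)
    | .vx a => .inl (Z.sVX a)
    | .xx a => .inr (.inl (Z.sX a))
    | .yy a => .inr (.inr (Z.sY a))
    | .c u _ => .inr (.inl u)
  t := fun
    | .vv a => .inl (Z.tV a)
    | .vx a => .inr (.inl (Z.tVX a))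
    | .xx a => .inr (.inl (Z.tX a))
    | .yy a => .inr (.inr (Z.tY a))
    | .c _ s => .inr (.inr (Z.σ s))

@[reducible] def QB : PreQuiver where
  V := Z.Vx
  A := Z.Arr
  s := fun
    | .vv a => .inl (Z.sV a)
    | .vx a => .inl (Z.sVX a)
    | .xx a => .inr (.inl (Z.sX a))
    | .yy a => .inr (.inr (Z.sY a))
    | .c _ s => .inr (.inr (Z.σ s))
  t := fun
    | .vv a => .inl (Z.tV a)
    | .vx a => .inr (.inl (Z.tVX a))
    | .xx a => .inr (.inl (Z.tX a))
    | .yy a => .inr (.inr (Z.tY a))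
    | .c u _ => .inr (.inl u)

def RA0 : Set (List Z.QA.A) := {p | ∃ a s, p = [.vx a, .c (Z.tVX a) s]}
def RA1 : Set (List Z.QA.A × List Z.QA.A) :=
  {p | ∃ a s, p = ([.xx a, .c (Z.tX a) s], [.c (Z.sX a) s])}
def RB1 : Set (List Z.QB.A × List Z.QB.A) :=
  {p | ∃ a s, p = ([.c (Z.sX a) s, .xx a], [.c (Z.tX a) s])}

variable (k : Type) [Field k]
abbrev CA := QR k Z.QA Z.RA0 Z.RA1
abbrev CB := QR k Z.QB ∅ Z.RB1

variable {Z k}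


section build
variable (MV : Z.V → Type) [∀ v, AddCommGroup (MV v)] [∀ v, Module k (MV v)]
  (MX : Z.X → Type) [∀ v, AddCommGroup (MX v)] [∀ v, Module k (MX v)]
  (MY : Z.Y → Type) [∀ v, AddCommGroup (MY v)] [∀ v, Module k (MY v)]
  (vv : ∀ a, MV (Z.sV a) →ₗ[k] MV (Z.tV a))
  (vx : ∀ a, MV (Z.sVX a) →ₗ[k] MX (Z.tVX a))
  (xx : ∀ a, MX (Z.sX a) →ₗ[k] MX (Z.tX a))
  (yy : ∀ a, MY (Z.sY a) →ₗ[k] MY (Z.tY a))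

abbrev MM : Z.Vx → Type
  | .inl v => MV v
  | .inr (.inl v) => MX v
  | .inr (.inr v) => MY v
instance instMMab : ∀ v, AddCommGroup (MM (Z := Z) MV MX MY v)
  | .inl v => inferInstanceAs (AddCommGroup (MV v))
  | .inr (.inl v) => inferInstanceAs (AddCommGroup (MX v))
  | .inr (.inr v) => inferInstanceAs (AddCommGroup (MY v))
instance instMMmo : ∀ v, Module k (MM (Z := Z) MV MX MY v)
  | .inl v => inferInstanceAs (Module k (MV v))
  | .inr (.inl v) => inferInstanceAs (Module k (MX v))
  | .inr (.inr v) => inferInstanceAs (Module k (MY v))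

def mkA (c : ∀ u s, MX u →ₗ[k] MY (Z.σ s)) (r0 : ∀ a s x, c (Z.tVX a) s (vx a x) = 0)
    (r1 : ∀ a s x, c (Z.tX a) s (xx a x) = c (Z.sX a) s x) : Z.CA k where
  M := MM MV MX MY
  ab := instMMab MV MX MY
  mo := instMMmo MV MX MY
  m := fun
    | .vv a => vv a
    | .vx a => vx a
    | .xx a => xx a
    | .yy a => yy a
    | .c u s => c u s
  h0 := by
    rintro p ⟨a, s, rfl⟩
    refine LinearMap.ext fun x => ?_
    change sgl (M := MM (Z := Z) MV MX MY) (Sum.inr (Sum.inr (Z.σ s)))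
      (c (Z.tVX a) s (sgl (M := MM (Z := Z) MV MX MY) (Sum.inr (Sum.inl (Z.tVX a)))
        (vx a (x (Sum.inl (Z.sVX a)))) (Sum.inr (Sum.inl (Z.tVX a))))) = 0
    rw [sgl_same, r0, sgl_zero]
  h1 := by
    rintro p ⟨a, s, rfl⟩
    refine LinearMap.ext fun x => ?_
    change sgl (M := MM (Z := Z) MV MX MY) (Sum.inr (Sum.inr (Z.σ s)))
      (c (Z.tX a) s (sgl (M := MM (Z := Z) MV MX MY) (Sum.inr (Sum.inl (Z.tX a)))
        (xx a (x (Sum.inr (Sum.inl (Z.sX a))))) (Sum.inr (Sum.inl (Z.tX a))))) =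
        sgl (M := MM (Z := Z) MV MX MY) (Sum.inr (Sum.inr (Z.σ s)))
          (c (Z.sX a) s (x (Sum.inr (Sum.inl (Z.sX a)))))
    rw [sgl_same, r1]

def mkB (c : ∀ u s, MY (Z.σ s) →ₗ[k] MX u)
    (r1 : ∀ a s x, xx a (c (Z.sX a) s x) = c (Z.tX a) s x) : Z.CB k where
  M := MM MV MX MY
  ab := instMMab MV MX MY
  mo := instMMmo MV MX MY
  m := fun
    | .vv a => vv a
    | .vx a => vx a
    | .xx a => xx a
    | .yy a => yy a
    | .c u s => c u s
  h0 := by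
    rintro p hp
    exact absurd hp (Set.notMem_empty _)
  h1 := by
    rintro p ⟨a, s, rfl⟩
    refine LinearMap.ext fun x => ?_
    change sgl (M := MM (Z := Z) MV MX MY) (Sum.inr (Sum.inl (Z.tX a)))
      (xx a (sgl (M := MM (Z := Z) MV MX MY) (Sum.inr (Sum.inl (Z.sX a)))
        (c (Z.sX a) s (x (Sum.inr (Sum.inr (Z.σ s))))) (Sum.inr (Sum.inl (Z.sX a))))) =
        sgl (M := MM (Z := Z) MV MX MY) (Sum.inr (Sum.inl (Z.tX a)))
          (c (Z.tX a) s (x (Sum.inr (Sum.inr (Z.σ s)))))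
    rw [sgl_same, r1]
end build

lemma A_r0 (M : Z.CA k) (a s) (x : M.M (Sum.inl (Z.sVX a))) :
    (M.m (.c (Z.tVX a) s) : M.M (Sum.inr (Sum.inl (Z.tVX a))) →ₗ[k] M.M (Sum.inr (Sum.inr (Z.σ s))))
      ((M.m (.vx a) : M.M (Sum.inl (Z.sVX a)) →ₗ[k] M.M (Sum.inr (Sum.inl (Z.tVX a)))) x) = 0 := by
  have h := congrFun (LinearMap.congr_fun (M.h0 _ ⟨a, s, rfl⟩) (sgl (Sum.inl (Z.sVX a)) x))
    (Sum.inr (Sum.inr (Z.σ s)))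
  change sgl (M := M.M) (Sum.inr (Sum.inr (Z.σ s)))
      (M.m (.c (Z.tVX a) s) (sgl (M := M.M) (Sum.inr (Sum.inl (Z.tVX a)))
        (M.m (.vx a) (sgl (M := M.M) (Sum.inl (Z.sVX a)) x (Sum.inl (Z.sVX a))))
          (Sum.inr (Sum.inl (Z.tVX a))))) (Sum.inr (Sum.inr (Z.σ s))) = 0 at h
  rw [sgl_same, sgl_same, sgl_same] at h
  exact h

lemma A_r1 (M : Z.CA k) (a s) (x : M.M (Sum.inr (Sum.inl (Z.sX a)))) :
    (M.m (.c (Z.tX a) s) : M.M (Sum.inr (Sum.inl (Z.tX a))) →ₗ[k] M.M (Sum.inr (Sum.inr (Z.σ s))))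
      ((M.m (.xx a) : M.M (Sum.inr (Sum.inl (Z.sX a))) →ₗ[k] M.M (Sum.inr (Sum.inl (Z.tX a)))) x) =
    (M.m (.c (Z.sX a) s) : M.M (Sum.inr (Sum.inl (Z.sX a))) →ₗ[k] M.M (Sum.inr (Sum.inr (Z.σ s)))) x
    := by
  have h := congrFun (LinearMap.congr_fun (M.h1 _ ⟨a, s, rfl⟩)
    (sgl (Sum.inr (Sum.inl (Z.sX a))) x)) (Sum.inr (Sum.inr (Z.σ s)))
  change sgl (M := M.M) (Sum.inr (Sum.inr (Z.σ s)))
      (M.m (.c (Z.tX a) s) (sgl (M := M.M) (Sum.inr (Sum.inl (Z.tX a)))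
        (M.m (.xx a) (sgl (M := M.M) (Sum.inr (Sum.inl (Z.sX a))) x (Sum.inr (Sum.inl (Z.sX a)))))
          (Sum.inr (Sum.inl (Z.tX a))))) (Sum.inr (Sum.inr (Z.σ s))) =
      sgl (M := M.M) (Sum.inr (Sum.inr (Z.σ s)))
        (M.m (.c (Z.sX a) s) (sgl (M := M.M) (Sum.inr (Sum.inl (Z.sX a))) x
          (Sum.inr (Sum.inl (Z.sX a))))) (Sum.inr (Sum.inr (Z.σ s))) at h
  rw [sgl_same, sgl_same, sgl_same, sgl_same] at h
  exact h

lemma B_r1 (M : Z.CB k) (a s) (x : M.M (Sum.inr (Sum.inr (Z.σ s)))) :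
    (M.m (.xx a) : M.M (Sum.inr (Sum.inl (Z.sX a))) →ₗ[k] M.M (Sum.inr (Sum.inl (Z.tX a))))
    ((M.m (.c (Z.sX a) s) : M.M (Sum.inr (Sum.inr (Z.σ s))) →ₗ[k] M.M (Sum.inr (Sum.inl (Z.sX a)))) x)
    = (M.m (.c (Z.tX a) s) : M.M (Sum.inr (Sum.inr (Z.σ s))) →ₗ[k] M.M (Sum.inr (Sum.inl (Z.tX a)))) x
    := by
  have h := congrFun (LinearMap.congr_fun (M.h1 _ ⟨a, s, rfl⟩)
    (sgl (Sum.inr (Sum.inr (Z.σ s))) x)) (Sum.inr (Sum.inl (Z.tX a)))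
  change sgl (M := M.M) (Sum.inr (Sum.inl (Z.tX a)))
      (M.m (.xx a) (sgl (M := M.M) (Sum.inr (Sum.inl (Z.sX a)))
        (M.m (.c (Z.sX a) s) (sgl (M := M.M) (Sum.inr (Sum.inr (Z.σ s))) x
          (Sum.inr (Sum.inr (Z.σ s)))))
          (Sum.inr (Sum.inl (Z.sX a))))) (Sum.inr (Sum.inl (Z.tX a))) =
      sgl (M := M.M) (Sum.inr (Sum.inl (Z.tX a)))
        (M.m (.c (Z.tX a) s) (sgl (M := M.M) (Sum.inr (Sum.inr (Z.σ s))) x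
          (Sum.inr (Sum.inr (Z.σ s))))) (Sum.inr (Sum.inl (Z.tX a))) at h
  rw [sgl_same, sgl_same, sgl_same, sgl_same] at h
  exact h

end Zone
end NakE8

end

section
open CategoryTheory
open CategoryTheory.Limits CategoryTheory.Pretriangulated

namespace NakE8
namespace Zone
variable {Z : Zone} {k : Type} [Field k]

abbrev iV (v : Z.V) : Z.Vx := .inl v
abbrev iX (v : Z.X) : Z.Vx := .inr (.inl v)
abbrev iY (v : Z.Y) : Z.Vx := .inr (.inr v)

abbrev IA (M : Z.CA k) : Type := ∀ s : Z.Sg, M.M (iY (Z.σ s))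
abbrev IB (M : Z.CB k) : Type := ∀ s : Z.Sg, M.M (iY (Z.σ s))

variable (Z k)

noncomputable def f0 : Z.CA k ⥤ Z.CB k where
  obj M := mkB (fun v => M.M (iV v)) (fun v => M.M (iX v)) (fun _ => PUnit)
    (fun a => M.m (.vv a)) (fun a => M.m (.vx a)) (fun a => M.m (.xx a)) (fun _ => 0)
    (fun _ _ => 0) (fun _ _ _ => map_zero _)
  map {M N} f :=
    { f := fun
        | .inl v => f.f (iV v)
        | .inr (.inl v) => f.f (iX v)
        | .inr (.inr _) => LinearMap.id
      comm := by
        rintro (a | a | a | a | ⟨u, s⟩) x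
        exacts [f.comm (.vv a) x, f.comm (.vx a) x, f.comm (.xx a) x, rfl, (map_zero _).symm] }
  map_id M := by apply QR.hom_ext; rintro (v | v | v) x <;> rfl
  map_comp f g := by apply QR.hom_ext; rintro (v | v | v) x <;> rfl

noncomputable def g0 : Z.CB k ⥤ Z.CA k where
  obj M := mkA (fun v => M.M (iV v)) (fun v => M.M (iX v)) (fun _ => PUnit)
    (fun a => M.m (.vv a)) (fun a => M.m (.vx a)) (fun a => M.m (.xx a)) (fun _ => 0)
    (fun _ _ => 0) (fun _ _ _ => rfl) (fun _ _ _ => rfl)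
  map {M N} f :=
    { f := fun
        | .inl v => f.f (iV v)
        | .inr (.inl v) => f.f (iX v)
        | .inr (.inr _) => LinearMap.id
      comm := by
        rintro (a | a | a | a | ⟨u, s⟩) x
        exacts [f.comm (.vv a) x, f.comm (.vx a) x, f.comm (.xx a) x, rfl, rfl] }
  map_id M := by apply QR.hom_ext; rintro (v | v | v) x <;> rfl
  map_comp f g := by apply QR.hom_ext; rintro (v | v | v) x <;> rfl

noncomputable def f1 : Z.CA k ⥤ Z.CB k where
  obj M := mkB (fun _ => PUnit) (fun _ => IA M) (fun v => M.M (iY v))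
    (fun _ => 0) (fun _ => 0) (fun _ => LinearMap.id) (fun a => M.m (.yy a))
    (fun _ s => LinearMap.single k (fun s => M.M (iY (Z.σ s))) s) (fun _ _ _ => rfl)
  map {M N} f :=
    { f := fun
        | .inl v => LinearMap.id
        | .inr (.inl v) => LinearMap.pi (fun s => f.f (iY (Z.σ s)) ∘ₗ LinearMap.proj s)
        | .inr (.inr v) => f.f (iY v)
      comm := by
        rintro (a | a | a | a | ⟨u, s⟩) x
        · rfl
        · exact (map_zero _).symm
        · rfl
        · exact f.comm (.yy a) x
        · funext s'
          exact (Pi.apply_single (fun s => f.f (iY (Z.σ s))) (fun _ => map_zero _) s x s').symm }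
  map_id M := by apply QR.hom_ext; rintro (v | v | v) x <;> rfl
  map_comp f g := by apply QR.hom_ext; rintro (v | v | v) x <;> rfl

noncomputable def g1 : Z.CB k ⥤ Z.CA k where
  obj M := mkA (fun _ => PUnit) (fun _ => IB M) (fun v => M.M (iY v))
    (fun _ => 0) (fun _ => 0) (fun _ => LinearMap.id) (fun a => M.m (.yy a))
    (fun _ s => LinearMap.proj s) (fun _ _ _ => rfl) (fun _ _ _ => rfl)
  map {M N} f :=
    { f := fun
        | .inl v => LinearMap.id
        | .inr (.inl v) => LinearMap.pi (fun s => f.f (iY (Z.σ s)) ∘ₗ LinearMap.proj s)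
        | .inr (.inr v) => f.f (iY v)
      comm := by
        rintro (a | a | a | a | ⟨u, s⟩) x
        · rfl
        · exact (map_zero _).symm
        · rfl
        · exact f.comm (.yy a) x
        · rfl }
  map_id M := by apply QR.hom_ext; rintro (v | v | v) x <;> rfl
  map_comp f g := by apply QR.hom_ext; rintro (v | v | v) x <;> rfl

noncomputable def K1 : Z.CA k ⥤ Z.CA k where
  obj M := mkA (fun _ => PUnit) (fun _ => PUnit) (fun v => M.M (iY v))
    (fun _ => 0) (fun _ => 0) (fun _ => LinearMap.id) (fun a => M.m (.yy a))
    (fun _ s => 0) (fun _ _ _ => rfl) (fun _ _ _ => rfl)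
  map {M N} f :=
    { f := fun
        | .inl v => LinearMap.id
        | .inr (.inl v) => LinearMap.id
        | .inr (.inr v) => f.f (iY v)
      comm := by
        rintro (a | a | a | a | ⟨u, s⟩) x
        exacts [rfl, rfl, rfl, f.comm (.yy a) x, (map_zero _).symm] }
  map_id M := by apply QR.hom_ext; rintro (v | v | v) x <;> rfl
  map_comp f g := by apply QR.hom_ext; rintro (v | v | v) x <;> rfl

noncomputable def K2 : Z.CB k ⥤ Z.CB k where
  obj M := mkB (fun _ => PUnit) (fun _ => PUnit) (fun v => M.M (iY v))
    (fun _ => 0) (fun _ => 0) (fun _ => LinearMap.id) (fun a => M.m (.yy a))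
    (fun _ s => 0) (fun _ _ _ => rfl)
  map {M N} f :=
    { f := fun
        | .inl v => LinearMap.id
        | .inr (.inl v) => LinearMap.id
        | .inr (.inr v) => f.f (iY v)
      comm := by
        rintro (a | a | a | a | ⟨u, s⟩) x
        exacts [rfl, rfl, rfl, f.comm (.yy a) x, rfl] }
  map_id M := by apply QR.hom_ext; rintro (v | v | v) x <;> rfl
  map_comp f g := by apply QR.hom_ext; rintro (v | v | v) x <;> rfl

/-- vertexwise short exactness -/
def SE {A B C : Type} [Zero C] (f : A → B) (g : B → C) : Prop :=
  Function.Injective f ∧ Function.Surjective g ∧ ∀ x, g x = 0 → ∃ y, f y = x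

lemma SE_pi {ι : Type} {A B C : ι → Type} [∀ i, Zero (C i)] (f : ∀ i, A i → B i)
    (g : ∀ i, B i → C i) (h : ∀ i, SE (f i) (g i)) :
    SE (fun (x : ∀ i, A i) i => f i (x i)) (fun (x : ∀ i, B i) i => g i (x i)) := by
  refine ⟨?_, ?_, ?_⟩
  · intro x y hxy
    funext i
    exact (h i).1 (congrFun hxy i)
  · intro y
    choose x hx using fun v => (h v).2.1 (y v)
    exact ⟨x, funext hx⟩
  · intro x hx
    choose y hy using fun v => (h v).2.2 (x v) (congrFun hx v)
    exact ⟨y, funext hy⟩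

lemma SE_left {A B C : Type} [Zero B] [Zero C] [Subsingleton C] {f : A → B} {g : B → C}
    (h : Function.Bijective f) : SE f g :=
  ⟨h.1, fun _ => ⟨0, Subsingleton.elim _ _⟩, fun x _ => h.2 x⟩

lemma SE_right {A B C : Type} [Zero A] [Zero C] [Subsingleton A] {f : A → B} {g : B → C}
    (hf : g (f 0) = 0) (h : Function.Bijective g) : SE f g :=
  ⟨fun _ _ _ => Subsingleton.elim _ _, h.2, fun _ hx => ⟨0, h.1 (hf.trans hx.symm)⟩⟩

lemma se_of {Q : PreQuiver} {R0 : Set (List Q.A)} {R1 : Set (List Q.A × List Q.A)}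
    {X Y W : QR k Q R0 R1} {f : X ⟶ Y} {g : Y ⟶ W} (w : f ≫ g = 0)
    (h : ∀ v, SE (f.f v) (g.f v)) : (ShortComplex.mk f g w).ShortExact :=
  (QR.shortExact_iff _).2 h

lemma exa_aux {Q : PreQuiver} {R0 : Set (List Q.A)} {R1 : Set (List Q.A × List Q.A)}
    {Q' : PreQuiver} {R0' : Set (List Q'.A)} {R1' : Set (List Q'.A × List Q'.A)}
    (F : QR k Q R0 R1 ⥤ QR k Q' R0' R1')
    (h : ∀ (X Y : QR k Q R0 R1) (f g : X ⟶ Y) (v x),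
      (F.map (f + g)).f v x = (F.map f).f v x + (F.map g).f v x)
    (h' : ∀ {X Y W : QR k Q R0 R1} (f : X ⟶ Y) (g : Y ⟶ W), (∀ v, SE (f.f v) (g.f v)) →
      ∀ v, SE ((F.map f).f v) ((F.map g).f v)) : Exa F := by
  have : F.Additive := ⟨fun {X Y f g} => QR.hom_ext _ _ fun v x => by rw [h, QR.add_f]⟩
  apply exa_of_shortExact
  intro S hS
  rw [QR.shortExact_iff] at hS ⊢
  exact h' S.f S.g hS

instance : Exa (f0 Z k) := exa_aux k _
  (by
    rintro X Y f g (v | v | v) x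
    exacts [QR.add_f f g _ x, QR.add_f f g _ x, rfl])
  (by
    rintro X Y W f g h (v | v | v)
    exacts [h (iV v), h (iX v), SE_left (B := PUnit) (C := PUnit) Function.bijective_id])
instance : Exa (g0 Z k) := exa_aux k _
  (by
    rintro X Y f g (v | v | v) x
    exacts [QR.add_f f g _ x, QR.add_f f g _ x, rfl])
  (by
    rintro X Y W f g h (v | v | v)
    exacts [h (iV v), h (iX v), SE_left (B := PUnit) (C := PUnit) Function.bijective_id])
instance : Exa (f1 Z k) := exa_aux k _
  (by
    rintro X Y f g (v | v | v) x
    exacts [rfl, funext fun s => QR.add_f f g _ (x s), QR.add_f f g _ x])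
  (by
    rintro X Y W f g h (v | v | v)
    exacts [SE_left (B := PUnit) (C := PUnit) Function.bijective_id,
      SE_pi (fun s => f.f (iY (Z.σ s))) (fun s => g.f (iY (Z.σ s))) (fun s => h (iY (Z.σ s))),
      h (iY v)])
instance : Exa (g1 Z k) := exa_aux k _
  (by
    rintro X Y f g (v | v | v) x
    exacts [rfl, funext fun s => QR.add_f f g _ (x s), QR.add_f f g _ x])
  (by
    rintro X Y W f g h (v | v | v)
    exacts [SE_left (B := PUnit) (C := PUnit) Function.bijective_id,
      SE_pi (fun s => f.f (iY (Z.σ s))) (fun s => g.f (iY (Z.σ s))) (fun s => h (iY (Z.σ s))),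
      h (iY v)])
instance : Exa (K1 Z k) := exa_aux k _
  (by
    rintro X Y f g (v | v | v) x
    exacts [rfl, rfl, QR.add_f f g _ x])
  (by
    rintro X Y W f g h (v | v | v)
    exacts [SE_left (B := PUnit) (C := PUnit) Function.bijective_id,
      SE_left (B := PUnit) (C := PUnit) Function.bijective_id, h (iY v)])
instance : Exa (K2 Z k) := exa_aux k _
  (by
    rintro X Y f g (v | v | v) x
    exacts [rfl, rfl, QR.add_f f g _ x])
  (by
    rintro X Y W f g h (v | v | v)
    exacts [SE_left (B := PUnit) (C := PUnit) Function.bijective_id,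
      SE_left (B := PUnit) (C := PUnit) Function.bijective_id, h (iY v)])

variable {Z k} in
noncomputable def cA (M : Z.CA k) (u : Z.X) : M.M (iX u) →ₗ[k] IA M :=
  LinearMap.pi (fun s => (M.m (.c u s) : M.M (iX u) →ₗ[k] M.M (iY (Z.σ s))))
variable {Z k} in
noncomputable def cB (M : Z.CB k) (u : Z.X) : IB M →ₗ[k] M.M (iX u) :=
  ∑ s, (M.m (.c u s) : M.M (iY (Z.σ s)) →ₗ[k] M.M (iX u)) ∘ₗ LinearMap.proj s
variable {Z k} in
lemma cA_apply (M : Z.CA k) (u : Z.X) (x s) : cA M u x s = M.m (.c u s) x := rfl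
variable {Z k} in
lemma cB_apply (M : Z.CB k) (u : Z.X) (x) : cB M u x =
    ∑ s, (M.m (.c u s) : M.M (iY (Z.σ s)) →ₗ[k] M.M (iX u)) (x s) := by
  simp [cB]

variable {Z k} in
lemma cB_xx (M : Z.CB k) (a : Z.AX) (x : IB M) :
    (M.m (.xx a) : M.M (iX (Z.sX a)) →ₗ[k] M.M (iX (Z.tX a))) (cB M (Z.sX a) x) =
      cB M (Z.tX a) x := by
  rw [cB_apply, cB_apply, map_sum]
  exact Finset.sum_congr rfl fun s _ => B_r1 M a s (x s)
variable {Z k} in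
lemma cB_nat {M N : Z.CB k} (f : M ⟶ N) (v : Z.X) (x : IB M) :
    cB N v (fun s => f.f (iY (Z.σ s)) (x s)) = f.f (iX v) (cB M v x) := by
  rw [cB_apply, cB_apply, map_sum]
  exact Finset.sum_congr rfl fun s _ => f.comm (.c v s) (x s)
variable {Z k} in
lemma cB_single (M : Z.CB k) (u : Z.X) (s : Z.Sg) (x : M.M (iY (Z.σ s))) :
    (M.m (.c u s) : M.M (iY (Z.σ s)) →ₗ[k] M.M (iX u)) x =
      cB M u (Pi.single (M := fun s => M.M (iY (Z.σ s))) s x) := by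
  rw [cB_apply, Finset.sum_eq_single s]
  · rw [Pi.single_eq_same]
  · intro b _ hb
    rw [Pi.single_eq_of_ne hb, map_zero]
  · simp

noncomputable def al : f0 Z k ⟶ f1 Z k where
  app M :=
    { f := fun
        | .inl v => (0 : M.M (iV v) →ₗ[k] PUnit)
        | .inr (.inl v) => cA M v
        | .inr (.inr v) => (0 : PUnit →ₗ[k] M.M (iY v))
      comm := by
        rintro (a | a | a | a | ⟨u, s⟩) x
        · rfl
        · funext s
          exact (A_r0 M a s x).symm
        · funext s
          exact (A_r1 M a s x).symm
        · exact map_zero (M.m (.yy a))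
        · exact (map_zero (LinearMap.single k (fun s => M.M (iY (Z.σ s))) s)).trans
            (map_zero (cA M u)).symm }
  naturality M N f := by
    apply QR.hom_ext
    rintro (v | v | v) x
    · rfl
    · funext s
      exact f.comm (.c v s) x
    · exact (map_zero (f.f (iY v))).symm

noncomputable def be : g1 Z k ⟶ g0 Z k where
  app M :=
    { f := fun
        | .inl v => (0 : PUnit →ₗ[k] M.M (iV v))
        | .inr (.inl v) => cB M v
        | .inr (.inr v) => (0 : M.M (iY v) →ₗ[k] PUnit)
      comm := by
        rintro (a | a | a | a | ⟨u, s⟩) x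
        · exact map_zero (M.m (.vv a))
        · exact (map_zero (M.m (.vx a))).trans (map_zero (cB M _)).symm
        · exact cB_xx M a x
        · rfl
        · rfl }
  naturality M N f := by
    apply QR.hom_ext
    rintro (v | v | v) x
    · exact (map_zero (f.f (iV v))).symm
    · exact cB_nat f v x
    · rfl

lemma cB_f1 (M : Z.CA k) (u) (x : IA M) : cB ((f1 Z k).obj M) u x = x := by
  refine (cB_apply ((f1 Z k).obj M) u x).trans ?_
  exact Finset.univ_sum_single (M := fun s => M.M (iY (Z.σ s))) x

lemma cA_g1 (M : Z.CB k) (u) (x : IB M) : cA ((g1 Z k).obj M) u x = x := rfl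

noncomputable def et : 𝟭 (Z.CA k) ⟶ f1 Z k ⋙ g1 Z k where
  app M :=
    { f := fun
        | .inl v => (0 : M.M (iV v) →ₗ[k] PUnit)
        | .inr (.inl v) => cA M v
        | .inr (.inr v) => (LinearMap.id : M.M (iY v) →ₗ[k] M.M (iY v))
      comm := by
        rintro (a | a | a | a | ⟨u, s⟩) x
        · rfl
        · funext s
          exact (A_r0 M a s x).symm
        · funext s
          exact (A_r1 M a s x).symm
        · rfl
        · rfl }
  naturality M N f := by
    apply QR.hom_ext
    rintro (v | v | v) x
    · rfl
    · funext s
      exact f.comm (.c v s) x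
    · rfl

noncomputable def pi0 : 𝟭 (Z.CA k) ⟶ f0 Z k ⋙ g0 Z k where
  app M :=
    { f := fun
        | .inl v => (LinearMap.id : M.M (iV v) →ₗ[k] M.M (iV v))
        | .inr (.inl v) => (LinearMap.id : M.M (iX v) →ₗ[k] M.M (iX v))
        | .inr (.inr v) => (0 : M.M (iY v) →ₗ[k] PUnit)
      comm := by
        rintro (a | a | a | a | ⟨u, s⟩) x <;> rfl }
  naturality M N f := by
    apply QR.hom_ext
    rintro (v | v | v) x <;> rfl

noncomputable def ka : K1 Z k ⟶ 𝟭 (Z.CA k) where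
  app M :=
    { f := fun
        | .inl v => (0 : PUnit →ₗ[k] M.M (iV v))
        | .inr (.inl v) => (0 : PUnit →ₗ[k] M.M (iX v))
        | .inr (.inr v) => (LinearMap.id : M.M (iY v) →ₗ[k] M.M (iY v))
      comm := by
        rintro (a | a | a | a | ⟨u, s⟩) x
        exacts [map_zero (M.m (.vv a)), map_zero (M.m (.vx a)), map_zero (M.m (.xx a)), rfl,
          map_zero (M.m (.c u s))] }
  naturality M N f := by
    apply QR.hom_ext
    rintro (v | v | v) x
    exacts [(map_zero (f.f (iV v))).symm, (map_zero (f.f (iX v))).symm, rfl]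

noncomputable def ep : g1 Z k ⋙ f1 Z k ⟶ 𝟭 (Z.CB k) where
  app M :=
    { f := fun
        | .inl v => (0 : PUnit →ₗ[k] M.M (iV v))
        | .inr (.inl v) => cB M v
        | .inr (.inr v) => (LinearMap.id : M.M (iY v) →ₗ[k] M.M (iY v))
      comm := by
        rintro (a | a | a | a | ⟨u, s⟩) x
        · exact map_zero (M.m (.vv a))
        · exact (map_zero (M.m (.vx a))).trans (map_zero (cB M _)).symm
        · exact cB_xx M a x
        · rfl
        · exact cB_single M u s x }
  naturality M N f := by
    apply QR.hom_ext
    rintro (v | v | v) x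
    · exact (map_zero (f.f (iV v))).symm
    · exact cB_nat f v x
    · rfl

noncomputable def rh : g0 Z k ⋙ f0 Z k ⟶ 𝟭 (Z.CB k) where
  app M :=
    { f := fun
        | .inl v => (LinearMap.id : M.M (iV v) →ₗ[k] M.M (iV v))
        | .inr (.inl v) => (LinearMap.id : M.M (iX v) →ₗ[k] M.M (iX v))
        | .inr (.inr v) => (0 : PUnit →ₗ[k] M.M (iY v))
      comm := by
        rintro (a | a | a | a | ⟨u, s⟩) x
        exacts [rfl, rfl, rfl, map_zero (M.m (.yy a)), map_zero (M.m (.c u s))] }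
  naturality M N f := by
    apply QR.hom_ext
    rintro (v | v | v) x
    exacts [rfl, rfl, (map_zero (f.f (iY v))).symm]

noncomputable def kb : 𝟭 (Z.CB k) ⟶ K2 Z k where
  app M :=
    { f := fun
        | .inl v => (0 : M.M (iV v) →ₗ[k] PUnit)
        | .inr (.inl v) => (0 : M.M (iX v) →ₗ[k] PUnit)
        | .inr (.inr v) => (LinearMap.id : M.M (iY v) →ₗ[k] M.M (iY v))
      comm := by
        rintro (a | a | a | a | ⟨u, s⟩) x <;> rfl }
  naturality M N f := by
    apply QR.hom_ext
    rintro (v | v | v) x <;> rfl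

theorem zone : DEq (Z.CA k) (Z.CB k) := by
  refine glue (f0 Z k) (f1 Z k) (al Z k) (g1 Z k) (g0 Z k) (be Z k) (K1 Z k) ?_ (et Z k) (pi0 Z k)
    ?_ (ka Z k) ?_ ?_ ?_ ?_ (K2 Z k) ?_ (ep Z k) (rh Z k) ?_ (kb Z k) ?_ ?_ ?_ ?_
  · intro M
    apply QR.isZero_of
    rintro (v | v | v)
    · exact inferInstanceAs (Subsingleton PUnit)
    · exact inferInstanceAs (Subsingleton (Z.Sg → PUnit))
    · exact inferInstanceAs (Subsingleton PUnit)
  · intro M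
    apply QR.hom_ext
    rintro (v | v | v) x
    · rfl
    · exact cB_f1 Z k M v (cA M v x)
    · rfl
  · intro M
    apply QR.hom_ext
    intro v x
    rw [QR.zero_f]
    rcases v with v | v | v <;> rfl
  · intro M
    apply se_of
    rintro (v | v | v)
    · exact SE_right (A := PUnit) (f := fun _ => (0 : M.M (iV v))) rfl Function.bijective_id
    · exact SE_right (A := PUnit) (f := fun _ => (0 : M.M (iX v))) rfl Function.bijective_id
    · exact SE_left (C := PUnit) (Function.bijective_id (α := M.M (iY v)))
  · intro M
    apply QR.hom_ext
    intro v x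
    rw [QR.zero_f]
    rcases v with v | v | v
    · rfl
    · exact (cB_f1 Z k M v _).trans (map_zero (cA M v))
    · rfl
  · intro M
    apply se_of
    rintro (v | v | v)
    · exact SE_right (A := PUnit) (C := PUnit) rfl Function.bijective_id
    · have h : Function.Bijective (cB ((f1 Z k).obj M) v) := by
        have : ⇑(cB ((f1 Z k).obj M) v) = id := funext (cB_f1 Z k M v)
        rw [this]; exact Function.bijective_id
      exact SE_right (A := PUnit) (f := fun _ => cA M v 0)
        ((cB_f1 Z k M v _).trans (map_zero (cA M v))) h
    · exact SE_left (C := PUnit) (Function.bijective_id (α := M.M (iY v)))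
  · intro M
    apply QR.isZero_of
    rintro (v | v | v)
    · exact inferInstanceAs (Subsingleton PUnit)
    · exact inferInstanceAs (Subsingleton (Z.Sg → PUnit))
    · exact inferInstanceAs (Subsingleton PUnit)
  · intro M
    apply QR.hom_ext
    rintro (v | v | v) x <;> rfl
  · intro M
    apply QR.hom_ext
    intro v x
    rw [QR.zero_f]
    rcases v with v | v | v <;> rfl
  · intro M
    apply se_of
    rintro (v | v | v)
    · exact SE_left (C := PUnit) (Function.bijective_id (α := M.M (iV v)))
    · exact SE_left (C := PUnit) (Function.bijective_id (α := M.M (iX v)))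
    · exact SE_right (A := PUnit) (f := fun _ => (0 : M.M (iY v))) rfl Function.bijective_id
  · intro M
    apply QR.hom_ext
    intro v x
    rw [QR.zero_f]
    rcases v with v | v | v <;> rfl
  · intro M
    apply se_of
    rintro (v | v | v)
    · exact SE_right (A := PUnit) (C := PUnit) rfl Function.bijective_id
    · exact SE_left (C := PUnit) (Function.bijective_id (α := IB M))
    · exact SE_right (A := PUnit) (f := fun _ => (0 : M.M (iY v))) rfl Function.bijective_id

end Zone
end NakE8

end

section
open CategoryTheory
open CategoryTheory.Limits CategoryTheory.Pretriangulated

namespace NakE8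

lemma DE_iff (k : Type) [Field k] (A : Type) [Ring A] [Algebra k A] (B : Type) [Ring B]
    [Algebra k B] : DerivedEquivalent k A B ↔
      DEq (ModuleCat.{0} Aᵐᵒᵖ) (ModuleCat.{0} Bᵐᵒᵖ) := Iff.rfl

lemma DE_of_algEquiv {k : Type} [Field k] {A : Type} [Ring A] [Algebra k A] {B : Type} [Ring B]
    [Algebra k B] (e : A ≃ₐ[k] B) : DerivedEquivalent k A B :=
  (DE_iff k A B).2 (DEq.of_equiv
    (ModuleCat.restrictScalarsEquivalenceOfRingEquiv (RingEquiv.op e.symm.toRingEquiv)))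

lemma DE_symm {k : Type} [Field k] {A : Type} [Ring A] [Algebra k A] {B : Type} [Ring B]
    [Algebra k B] (h : DerivedEquivalent k A B) : DerivedEquivalent k B A := DEq.symm h
lemma DE_trans {k : Type} [Field k] {A : Type} [Ring A] [Algebra k A] {B : Type} [Ring B]
    [Algebra k B] {C : Type} [Ring C] [Algebra k C]
    (h : DerivedEquivalent k A B) (h' : DerivedEquivalent k B C) : DerivedEquivalent k A C :=
  DEq.trans h h'

lemma DE_zone (Z : Zone) (k : Type) [Field k] :
    DerivedEquivalent k (GAlg k Z.QA Z.RA0 Z.RA1) (GAlg k Z.QB ∅ Z.RB1) :=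
  (DE_iff _ _ _).2 (((DEq.of_equiv QR.toModEquiv).symm.trans (Zone.zone Z k)).trans
    (DEq.of_equiv QR.toModEquiv))

section maps
variable {k : Type} [Field k] {Q : PreQuiver} {R0 : Set (List Q.A)}
  {R1 : Set (List Q.A × List Q.A)}

def IsPath (Q : PreQuiver) : Q.V → List Q.A → Q.V → Prop
  | v, [], w => v = w
  | v, a :: p, w => v = Q.s a ∧ IsPath Q (Q.t a) p w

lemma path_left {v w : Q.V} {p : List Q.A} (h : IsPath Q v p w) (hp : p ≠ []) :
    GAlg.e k R0 R1 v * (p.map (GAlg.x k R0 R1)).prod = (p.map (GAlg.x k R0 R1)).prod := by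
  cases p with
  | nil => exact absurd rfl hp
  | cons a p =>
    rw [h.1, List.map_cons, List.prod_cons, ← mul_assoc, GAlg.source]

lemma path_right {v w : Q.V} {p : List Q.A} (h : IsPath Q v p w) (hp : p ≠ []) :
    (p.map (GAlg.x k R0 R1)).prod * GAlg.e k R0 R1 w = (p.map (GAlg.x k R0 R1)).prod := by
  induction p generalizing v with
  | nil => exact absurd rfl hp
  | cons a p ih =>
    rw [List.map_cons, List.prod_cons, mul_assoc]
    by_cases hp' : p = []
    · subst hp'
      have : Q.t a = w := h.2
      subst this
      simp [GAlg.target]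
    · rw [ih h.2 hp']

variable {Q' : PreQuiver} {R0' : Set (List Q'.A)} {R1' : Set (List Q'.A × List Q'.A)}

lemma prod_flatMap (φ : Q.A → List Q'.A) (p : List Q.A) :
    (p.map (fun a => ((φ a).map (GAlg.x k R0' R1')).prod)).prod =
      ((p.flatMap φ).map (GAlg.x k R0' R1')).prod := by
  induction p with
  | nil => rfl
  | cons a p ih => simp [ih]

noncomputable def pmap (eV : Q.V ≃ Q'.V) (φ : Q.A → List Q'.A) (hne : ∀ a, φ a ≠ [])
    (hφ : ∀ a, IsPath Q' (eV (Q.s a)) (φ a) (eV (Q.t a)))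
    (h0 : ∀ p ∈ R0, ((p.flatMap φ).map (GAlg.x k R0' R1')).prod = 0)
    (h1 : ∀ p ∈ R1, ((p.1.flatMap φ).map (GAlg.x k R0' R1')).prod =
      ((p.2.flatMap φ).map (GAlg.x k R0' R1')).prod) :
    GAlg k Q R0 R1 →ₐ[k] GAlg k Q' R0' R1' :=
  GAlg.lift (fun v => GAlg.e k R0' R1' (eV v)) (fun a => ((φ a).map (GAlg.x k R0' R1')).prod)
    (fun v => GAlg.idem _ _ _ _)
    (fun v w h => GAlg.orth _ _ _ _ _ (fun h' => h (eV.injective h')))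
    (by rw [Equiv.sum_comp eV (GAlg.e k R0' R1')]; exact GAlg.unit _ _ _)
    (fun a => path_left (hφ a) (hne a))
    (fun a => path_right (hφ a) (hne a))
    (fun p hp => by rw [prod_flatMap]; exact h0 p hp)
    (fun p hp => by rw [prod_flatMap, prod_flatMap]; exact h1 p hp)

theorem DE_maps (eV : Q.V ≃ Q'.V) (φ : Q.A → List Q'.A) (hne : ∀ a, φ a ≠ [])
    (hφ : ∀ a, IsPath Q' (eV (Q.s a)) (φ a) (eV (Q.t a)))
    (h0 : ∀ p ∈ R0, ((p.flatMap φ).map (GAlg.x k R0' R1')).prod = 0)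
    (h1 : ∀ p ∈ R1, ((p.1.flatMap φ).map (GAlg.x k R0' R1')).prod =
      ((p.2.flatMap φ).map (GAlg.x k R0' R1')).prod)
    (ψ : Q'.A → List Q.A) (hne' : ∀ a, ψ a ≠ [])
    (hψ : ∀ a, IsPath Q (eV.symm (Q'.s a)) (ψ a) (eV.symm (Q'.t a)))
    (h0' : ∀ p ∈ R0', ((p.flatMap ψ).map (GAlg.x k R0 R1)).prod = 0)
    (h1' : ∀ p ∈ R1', ((p.1.flatMap ψ).map (GAlg.x k R0 R1)).prod =
      ((p.2.flatMap ψ).map (GAlg.x k R0 R1)).prod)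
    (hφψ : ∀ a, (((φ a).flatMap ψ).map (GAlg.x k R0 R1)).prod = GAlg.x k R0 R1 a)
    (hψφ : ∀ a, (((ψ a).flatMap φ).map (GAlg.x k R0' R1')).prod = GAlg.x k R0' R1' a) :
    DerivedEquivalent k (GAlg k Q R0 R1) (GAlg k Q' R0' R1') := by
  have key : ∀ (f : GAlg k Q R0 R1 →ₐ[k] GAlg k Q' R0' R1') (p : List Q.A),
      (∀ a, f (GAlg.x k R0 R1 a) = ((φ a).map (GAlg.x k R0' R1')).prod) →
      f (p.map (GAlg.x k R0 R1)).prod = ((p.flatMap φ).map (GAlg.x k R0' R1')).prod := by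
    intro f p h
    rw [map_list_prod, List.map_map, ← prod_flatMap]
    congr 1
    exact List.map_congr_left (fun a _ => h a)
  have key' : ∀ (f : GAlg k Q' R0' R1' →ₐ[k] GAlg k Q R0 R1) (p : List Q'.A),
      (∀ a, f (GAlg.x k R0' R1' a) = ((ψ a).map (GAlg.x k R0 R1)).prod) →
      f (p.map (GAlg.x k R0' R1')).prod = ((p.flatMap ψ).map (GAlg.x k R0 R1)).prod := by
    intro f p h
    rw [map_list_prod, List.map_map, ← prod_flatMap]
    congr 1
    exact List.map_congr_left (fun a _ => h a)
  have e1 : ∀ a, pmap eV φ hne hφ h0 h1 (GAlg.x k R0 R1 a) = ((φ a).map (GAlg.x k R0' R1')).prod :=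
    fun a => GAlg.lift_x _ _ _ _ _ _ _ _ _ _
  have e2 : ∀ a, pmap eV.symm ψ hne' hψ h0' h1' (GAlg.x k R0' R1' a) =
    ((ψ a).map (GAlg.x k R0 R1)).prod := fun a => GAlg.lift_x _ _ _ _ _ _ _ _ _ _
  have e3 : ∀ v, pmap eV φ hne hφ h0 h1 (GAlg.e k R0 R1 v) = GAlg.e k R0' R1' (eV v) :=
    fun a => GAlg.lift_e _ _ _ _ _ _ _ _ _ _
  have e4 : ∀ v, pmap eV.symm ψ hne' hψ h0' h1' (GAlg.e k R0' R1' v) =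
    GAlg.e k R0 R1 (eV.symm v) := fun a => GAlg.lift_e _ _ _ _ _ _ _ _ _ _
  refine DE_of_algEquiv (AlgEquiv.ofAlgHom (pmap eV φ hne hφ h0 h1)
    (pmap eV.symm ψ hne' hψ h0' h1') ?_ ?_)
  · apply GAlg.hom_ext
    · intro v
      rw [AlgHom.comp_apply, e4, e3]; simp
    · intro a
      rw [AlgHom.comp_apply, e2, key _ _ e1, hψφ]; rfl
  · apply GAlg.hom_ext
    · intro v
      rw [AlgHom.comp_apply, e3, e4]; simp
    · intro a
      rw [AlgHom.comp_apply, e1, key' _ _ e2, hφψ]; rfl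

lemma DE_empty (R : Set (List Q.A)) :
    DerivedEquivalent k (GAlg k Q R ∅) (PathAlgebraRel k Q R) := by
  have h : GRel k Q R ∅ = PathAlgRel k Q R := GRel_empty
  have : ∀ r : FreeAlgebra k (Q.V ⊕ Q.A) → FreeAlgebra k (Q.V ⊕ Q.A) → Prop,
     GRel k Q R ∅ = r → DerivedEquivalent k (RingQuot (GRel k Q R ∅)) (RingQuot r) := by
    rintro r rfl
    exact DE_of_algEquiv AlgEquiv.refl
  exact this _ h

/-- Quiver isomorphisms onto an oriented graph. -/
lemma DE_orient {V : Type} [Fintype V] (o : V → V → Prop) (hR0 : ∀ p, p ∉ R0) (hR1 : ∀ p, p ∉ R1)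
    (eV : Q.V ≃ V) (inj : ∀ a b, Q.s a = Q.s b → Q.t a = Q.t b → a = b)
    (ho : ∀ v w, o v w ↔ ∃ a, eV (Q.s a) = v ∧ eV (Q.t a) = w) :
    DerivedEquivalent k (GAlg k Q R0 R1) (PathAlgebra k (orientQuiver V o)) := by
  refine DE_trans ?_ (DE_empty _)
  choose ψ hψ using fun a : (orientQuiver V o).A => (ho a.1.1 a.1.2).1 a.2
  have hs : ∀ a, eV (Q.s (ψ a)) = (orientQuiver V o).s a := fun a => (hψ a).1
  have ht : ∀ a, eV (Q.t (ψ a)) = (orientQuiver V o).t a := fun a => (hψ a).2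
  let φ : Q.A → (orientQuiver V o).A :=
    fun a => ⟨(eV (Q.s a), eV (Q.t a)), (ho _ _).2 ⟨a, rfl, rfl⟩⟩
  refine DE_maps (Q' := orientQuiver V o) eV (fun a => [φ a]) (by simp)
    (fun a => ⟨rfl, rfl⟩) (fun p hp => absurd hp (hR0 p)) (fun p hp => absurd hp (hR1 p))
    (fun a => [ψ a]) (by simp) (fun a => ⟨?_, ?_⟩) (fun p hp => absurd hp (Set.notMem_empty p))
    (fun p hp => absurd hp (Set.notMem_empty p)) (fun a => ?_) (fun a => ?_)
  · exact (Equiv.symm_apply_eq eV).2 (hs a).symm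
  · exact ((Equiv.symm_apply_eq eV).2 (ht a).symm).symm
  · have : ψ (φ a) = a := inj _ _ (eV.injective (hs (φ a))) (eV.injective (ht (φ a)))
    simp [this]
  · have : φ (ψ a) = a := Subtype.ext (Prod.ext (hs a) (ht a))
    simp [this]

end maps
end NakE8

end

section
open CategoryTheory
open CategoryTheory.Limits CategoryTheory.Pretriangulated

namespace NakE8

/-- The zone of a linear Nakayama algebra with one relation. -/
@[reducible] def Zn (n m r : ℕ) : Zone where
  V := Fin (n+1)
  X := Fin (m+1)
  Y := Fin (r+1)
  Sg := Unit
  AV := Fin n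
  AVX := Unit
  AX := Fin m
  AY := Fin r
  sV := Fin.castSucc
  tV := Fin.succ
  sVX _ := Fin.last n
  tVX _ := 0
  sX := Fin.castSucc
  tX := Fin.succ
  sY := Fin.castSucc
  tY := Fin.succ
  σ _ := 0

section
variable {k : Type} [Field k] {n m r : ℕ}

/-- The arrows `u → ⋯ → m` of the middle part. -/
def xs (m : ℕ) (u : Fin (m+1)) : List (Fin m) :=
  (List.finRange m).filter fun a => u.1 ≤ a.1

/-- The arrows `0 → ⋯ → u` of the middle part. -/
def ys (m : ℕ) (u : Fin (m+1)) : List (Fin m) :=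
  (List.finRange m).filter fun a => a.1 < u.1

def PathX (m : ℕ) : Fin (m+1) → List (Fin m) → Fin (m+1) → Prop
  | v, [], w => v = w
  | v, a :: p, w => v = a.castSucc ∧ PathX m a.succ p w

instance : ∀ v p w, Decidable (PathX m v p w)
  | _, [], _ => inferInstanceAs (Decidable (_ = _))
  | _, a :: p, w =>
    have := instDecidablePathX a.succ p w
    inferInstanceAs (Decidable (_ ∧ _))

lemma chainA {u w : Fin (m+1)} {L : List (Fin m)} (h : PathX m u L w) :
    ((L.map Zone.Arr.xx ++ [Zone.Arr.c w ()]).map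
      (GAlg.x (Q := (Zn n m r).QA) k (Zn n m r).RA0 (Zn n m r).RA1)).prod =
    GAlg.x (Q := (Zn n m r).QA) k (Zn n m r).RA0 (Zn n m r).RA1 (Zone.Arr.c u ()) := by
  induction L generalizing u with
  | nil => obtain rfl : u = w := h; simp
  | cons a L ih =>
    obtain ⟨rfl, h⟩ := h
    have := ih h
    rw [List.map_cons, List.cons_append, List.map_cons, List.prod_cons, this]
    have := GAlg.eqRel (Q := (Zn n m r).QA) k (Zn n m r).RA0 (Zn n m r).RA1 [.xx a, .c a.succ ()] [.c a.castSucc ()] ⟨a, (), rfl⟩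
    simpa using this

lemma chainB {u w : Fin (m+1)} {L : List (Fin m)} (h : PathX m u L w) :
    ((Zone.Arr.c u () :: L.map Zone.Arr.xx).map
      (GAlg.x (Q := (Zn n m r).QB) k ∅ (Zn n m r).RB1)).prod =
    GAlg.x (Q := (Zn n m r).QB) k ∅ (Zn n m r).RB1 (Zone.Arr.c w ()) := by
  induction L generalizing u with
  | nil => obtain rfl : u = w := h; simp
  | cons a L ih =>
    obtain ⟨rfl, h⟩ := h
    rw [← ih h]
    have := GAlg.eqRel (Q := (Zn n m r).QB) k ∅ (Zn n m r).RB1 [.c a.castSucc (), .xx a] [.c a.succ ()] ⟨a, (), rfl⟩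
    simp only [List.map_cons, List.prod_cons, List.map_nil, List.prod_nil, mul_one] at this ⊢
    rw [← this, mul_assoc]

/-- The images of the arrows in the linear quiver. -/
def fA (h : n + m + r = 5) : (Zn n m r).Arr → List (linQuiver 8).A
  | .vv a => [(⟨a.1, by have := a.2; omega⟩ : Fin 7)]
  | .vx _ => [(⟨n, by omega⟩ : Fin 7)]
  | .xx a => [(⟨n+1+a.1, by have := a.2; omega⟩ : Fin 7)]
  | .yy a => [(⟨n+m+2+a.1, by have := a.2; omega⟩ : Fin 7)]
  | .c u _ => (xs m u).map (fun a => (⟨n+1+a.1, by have := a.2; omega⟩ : Fin 7)) ++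
      [(⟨n+m+1, by omega⟩ : Fin 7)]

def gA (h : n + m + r = 5) (j' : (linQuiver 8).A) : (Zn n m r).Arr :=
  let j : Fin 7 := j'
  if h1 : j.1 < n then .vv ⟨j.1, h1⟩ else
  if h2 : j.1 = n then .vx () else
  if h3 : j.1 < n+1+m then .xx ⟨j.1-(n+1), by omega⟩ else
  if h4 : j.1 = n+m+1 then .c (Fin.last m) () else .yy ⟨j.1-(n+m+2), by omega⟩

def eA (h : n + m + r = 5) : Fin (n+1) ⊕ (Fin (m+1) ⊕ Fin (r+1)) ≃ Fin 8 :=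
  ((Equiv.sumCongr (Equiv.refl _) finSumFinEquiv).trans finSumFinEquiv).trans
    (finCongr (by omega))

structure GoodA (h : n + m + r = 5) : Prop where
  pv : ∀ a : Fin n, IsPath (linQuiver 8) (eA h ((Zn n m r).QA.s (.vv a))) (fA h (.vv a)) (eA h ((Zn n m r).QA.t (.vv a)))
  pw : ∀ a : Unit, IsPath (linQuiver 8) (eA h ((Zn n m r).QA.s (.vx a))) (fA h (.vx a)) (eA h ((Zn n m r).QA.t (.vx a)))
  pxx : ∀ a : Fin m, IsPath (linQuiver 8) (eA h ((Zn n m r).QA.s (.xx a))) (fA h (.xx a)) (eA h ((Zn n m r).QA.t (.xx a)))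
  py : ∀ a : Fin r, IsPath (linQuiver 8) (eA h ((Zn n m r).QA.s (.yy a))) (fA h (.yy a)) (eA h ((Zn n m r).QA.t (.yy a)))
  pc : ∀ a : Fin (m+1), IsPath (linQuiver 8) (eA h ((Zn n m r).QA.s (.c a ()))) (fA h (.c a ())) (eA h ((Zn n m r).QA.t (.c a ())))
  src : ∀ j : (linQuiver 8).A, eA h ((Zn n m r).QA.s (gA h j)) = (linQuiver 8).s j
  tgt : ∀ j : (linQuiver 8).A, eA h ((Zn n m r).QA.t (gA h j)) = (linQuiver 8).t j
  px : ∀ u, PathX m u (xs m u) (Fin.last m)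
  rel : fA h (.vx ()) ++ fA h (.c 0 ()) = linPath 8 (n+1) (m+2)
  com : ∀ a : Fin m, fA h (.xx a) ++ fA h (.c a.succ ()) = fA h (.c a.castSucc ())
  gv : ∀ a : Fin n, (fA h (.vv a)).map (gA h) = [.vv a]
  gx : ∀ a : Fin m, (fA h (.xx a)).map (gA h) = [.xx a]
  gvx : (fA h (.vx ())).map (gA h) = [.vx ()]
  gy : ∀ a : Fin r, (fA h (.yy a)).map (gA h) = [.yy a]
  gc : ∀ u, (fA h (.c u ())).map (gA h) = (xs m u).map (Zone.Arr.xx (Z := Zn n m r)) ++ [.c (Fin.last m) ()]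
  fg : ∀ j : (linQuiver 8).A, fA h (gA h j) = [j]

lemma GoodA.path {h : n + m + r = 5} (g : GoodA h) (a) :
    IsPath (linQuiver 8) (eA h ((Zn n m r).QA.s a)) (fA h a) (eA h ((Zn n m r).QA.t a)) := by
  rcases a with (a | a | a | a | ⟨u, s⟩)
  · exact g.pv a
  · exact g.pw a
  · exact g.pxx a
  · exact g.py a
  · exact g.pc u

theorem GoodA.de {h : n + m + r = 5} (g : GoodA h) :
    DerivedEquivalent k (GAlg k (Zn n m r).QA (Zn n m r).RA0 (Zn n m r).RA1)
      (NakayamaAlgebra k 8 1 (fun _ => n+1) (fun _ => m+2)) := by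
  refine DE_trans ?_ (DE_empty _)
  have fm : ∀ L : List (linQuiver 8).A, L.flatMap (fun j => [gA h j]) = L.map (gA h) := by
    intro L; induction L <;> simp_all
  have fm1 : ∀ j : (linQuiver 8).A, [gA h j].flatMap (fA h) = fA h (gA h j) := by simp
  refine DE_maps (Q := (Zn n m r).QA) (Q' := linQuiver 8) (eA h) (fA h) ?_ g.path ?_ ?_
    (fun j => [gA h j]) (by simp)
    (fun a => ⟨(Equiv.symm_apply_eq (eA h)).2 (g.src a).symm,
      ((Equiv.symm_apply_eq (eA h)).2 (g.tgt a).symm).symm⟩) ?_ 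
    (fun p hp => absurd hp (Set.notMem_empty p)) ?_ ?_
  · rintro (a | a | a | a | ⟨u, s⟩)
    · exact List.cons_ne_nil _ _
    · exact List.cons_ne_nil _ _
    · exact List.cons_ne_nil _ _
    · exact List.cons_ne_nil _ _
    · exact List.append_ne_nil_of_right_ne_nil _ (List.cons_ne_nil _ _)
  · rintro p ⟨a, s, rfl⟩
    apply GAlg.zeroRel
    refine ⟨0, ?_⟩
    rw [← g.rel]
    simp
  · rintro p ⟨a, s, rfl⟩
    have := g.com a
    simp only [List.flatMap_cons, List.flatMap_nil, List.append_nil]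
    rw [this]
  · rintro p ⟨i, rfl⟩
    have e : ((linPath 8 (n+1) (m+2)).flatMap (fun j => [gA h j])) =
      .vx () :: ((xs m 0).map (Zone.Arr.xx (Z := Zn n m r)) ++ [.c (Fin.last m) ()]) := by
      rw [← g.rel, fm, List.map_append, g.gvx, g.gc]; rfl
    rw [e, List.map_cons, List.prod_cons, chainA (g.px 0)]
    have := GAlg.zeroRel (Q := (Zn n m r).QA) k (Zn n m r).RA0 (Zn n m r).RA1 [.vx (), .c 0 ()] ⟨(), (), rfl⟩
    simpa using this
  · intro a
    rw [fm]
    rcases a with (a | a | a | a | ⟨u, s⟩)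
    · rw [g.gv]; simp
    · rw [g.gvx]; simp
    · rw [g.gx]; simp
    · rw [g.gy]; simp
    · rw [g.gc, chainA (g.px u)]
  · intro j
    rw [fm1, g.fg]; simp

end
end NakE8

end

section
open CategoryTheory
open CategoryTheory.Limits CategoryTheory.Pretriangulated

namespace NakE8

section
variable {k : Type} [Field k] {n m r : ℕ}

instance decPath (Q : PreQuiver) [DecidableEq Q.V] : ∀ v p w, Decidable (IsPath Q v p w)
  | _, [], _ => inferInstanceAs (Decidable (_ = _))
  | _, a :: p, w =>
    have := decPath Q (Q.t a) p w
    inferInstanceAs (Decidable (_ ∧ _))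

/-- The star-shaped tree quiver obtained from the zone. -/
@[reducible] def Tn (n m r : ℕ) : PreQuiver where
  V := Fin (n+1) ⊕ (Fin (m+1) ⊕ Fin (r+1))
  A := Fin n ⊕ (Fin m ⊕ (Fin r ⊕ Bool))
  s := fun
    | .inl a => .inl a.castSucc
    | .inr (.inl a) => .inr (.inl a.castSucc)
    | .inr (.inr (.inl a)) => .inr (.inr a.castSucc)
    | .inr (.inr (.inr true)) => .inl (Fin.last n)
    | .inr (.inr (.inr false)) => .inr (.inr 0)
  t := fun
    | .inl a => .inl a.succ
    | .inr (.inl a) => .inr (.inl a.succ)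
    | .inr (.inr (.inl a)) => .inr (.inr a.succ)
    | .inr (.inr (.inr true)) => .inr (.inl 0)
    | .inr (.inr (.inr false)) => .inr (.inl 0)

def tx (a : Fin m) : (Tn n m r).A := .inr (.inl a)

def fB : (Zn n m r).Arr → List (Tn n m r).A
  | .vv a => [.inl a]
  | .vx _ => [.inr (.inr (.inr true))]
  | .xx a => [.inr (.inl a)]
  | .yy a => [.inr (.inr (.inl a))]
  | .c u _ => .inr (.inr (.inr false)) :: (ys m u).map tx

def gB : (Tn n m r).A → (Zn n m r).Arr
  | .inl a => .vv a
  | .inr (.inl a) => .xx a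
  | .inr (.inr (.inl a)) => .yy a
  | .inr (.inr (.inr true)) => .vx ()
  | .inr (.inr (.inr false)) => .c 0 ()

lemma path_tx {u w : Fin (m+1)} {L : List (Fin m)} (h : PathX m u L w) :
    IsPath (Tn n m r) (.inr (.inl u)) (L.map tx) (.inr (.inl w)) := by
  induction L generalizing u with
  | nil => obtain rfl : u = w := h; rfl
  | cons a L ih =>
    obtain ⟨rfl, h⟩ := h
    exact ⟨rfl, ih h⟩

theorem deB (py : ∀ u, PathX m 0 (ys m u) u) (ysucc : ∀ a : Fin m, ys m a.castSucc ++ [a] = ys m a.succ)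
    (y0 : ys m 0 = []) :
    DerivedEquivalent k (GAlg k (Zn n m r).QB ∅ (Zn n m r).RB1) (GAlg k (Tn n m r) ∅ ∅) := by
  have fm : ∀ L : List (Fin m), (L.map (tx (n := n) (r := r))).flatMap (fun j => [gB j]) =
      L.map (Zone.Arr.xx (Z := Zn n m r)) := by
    intro L
    induction L with
    | nil => rfl
    | cons a L ih => rw [List.map_cons, List.flatMap_cons, ih]; rfl
  refine DE_maps (Q := (Zn n m r).QB) (Q' := Tn n m r) (Equiv.refl _) fB ?_ ?_
    (fun p hp => absurd hp (Set.notMem_empty p)) ?_ (fun j => [gB j]) (by simp) ?_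
    (fun p hp => absurd hp (Set.notMem_empty p)) (fun p hp => absurd hp (Set.notMem_empty p)) ?_ ?_
  · rintro (a | a | a | a | ⟨u, s⟩) <;> exact List.cons_ne_nil _ _
  · rintro (a | a | a | a | ⟨u, s⟩)
    · exact ⟨rfl, rfl⟩
    · exact ⟨rfl, rfl⟩
    · exact ⟨rfl, rfl⟩
    · exact ⟨rfl, rfl⟩
    · exact ⟨rfl, path_tx (py u)⟩
  · rintro p ⟨a, s, rfl⟩
    have e : ([Zone.Arr.c a.castSucc s, .xx a] : List (Zn n m r).Arr).flatMap fB =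
      [Zone.Arr.c a.succ s].flatMap fB := by
      simp [fB, ← ysucc a, tx]
    exact congrArg (fun L => (List.map _ L).prod) e
  · rintro (a | a | a | a | a)
    · exact ⟨rfl, rfl⟩
    · exact ⟨rfl, rfl⟩
    · exact ⟨rfl, rfl⟩
    · exact ⟨rfl, rfl⟩
    · exact ⟨rfl, rfl⟩
  · rintro (a | a | a | a | ⟨u, s⟩)
    · simp [fB, gB]
    · simp [fB, gB]
    · simp [fB, gB]
    · simp [fB, gB]
    · have e : (fB (Zone.Arr.c u s)).flatMap (fun j => [gB j]) =
        (Zone.Arr.c 0 () : (Zn n m r).Arr) :: (ys m u).map (Zone.Arr.xx (Z := Zn n m r)) := by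
        rw [← fm]; rfl
      rw [e, chainB (py u)]
  · rintro (a | a | a | a | a)
    · simp [fB, gB]
    · simp [fB, gB]
    · simp [fB, gB]
    · simp [fB, gB, y0]
    · simp [fB, gB]

lemma tn_inj : ∀ a b, (Tn n m r).s a = (Tn n m r).s b → (Tn n m r).t a = (Tn n m r).t b → a = b := by
  rintro (a | a | a | a | a) (b | b | b | b | b) <;> simp

/-- The orientation of the labelled tree. -/
@[reducible] def oT (h : n + m + r = 5) (f : Fin 8 → Fin 8) (v w : Fin 8) : Prop :=
  ∃ a, f (eA h ((Tn n m r).s a)) = v ∧ f (eA h ((Tn n m r).t a)) = w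

theorem deT (h : n + m + r = 5) (f : Fin 8 → Fin 8) (hf : Function.Injective f) :
    DerivedEquivalent k (GAlg k (Tn n m r) ∅ ∅) (PathAlgebra k (orientQuiver (Fin 8) (oT h f))) :=
  DE_orient _ (fun p => Set.notMem_empty p) (fun p => Set.notMem_empty p)
    ((eA h).trans (Equiv.ofBijective f (Finite.injective_iff_bijective.1 hf))) tn_inj
    (fun _ _ => Iff.rfl)

structure GoodB (h : n + m + r = 5) (f : Fin 8 → Fin 8) : Prop where
  py : ∀ u, PathX m 0 (ys m u) u
  ysucc : ∀ a : Fin m, ys m a.castSucc ++ [a] = ys m a.succ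
  y0 : ys m 0 = []
  inj : Function.Injective f
  adj : ∀ v w : Fin 8, (v ≠ w ∧ (((w.1 = v.1 + 1 ∧ w.1 ≤ 6) ∨ (v.1 = 2 ∧ w.1 = 7)) ∨
    ((v.1 = w.1 + 1 ∧ v.1 ≤ 6) ∨ (w.1 = 2 ∧ v.1 = 7)))) ↔ oT h f v w ∨ oT h f w v
  asym : ∀ v w : Fin 8, oT h f v w → ¬ oT h f w v

theorem deNak (h : n + m + r = 5) (f : Fin 8 → Fin 8) (gA : GoodA h) (gB : GoodB h f) :
    ∃ o, IsOrientation dynkinE8 o ∧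
      DerivedEquivalent k (NakayamaAlgebra k 8 1 (fun _ => n+1) (fun _ => m+2))
        (PathAlgebra k (orientQuiver (Fin 8) o)) :=
  ⟨oT h f, ⟨gB.adj, gB.asym⟩,
    DE_trans (DE_symm gA.de) (DE_trans (DE_zone (Zn n m r) k)
      (DE_trans (deB gB.py gB.ysucc gB.y0) (deT h f gB.inj)))⟩

instance : DecidableEq (linQuiver 8).V := inferInstanceAs (DecidableEq (Fin 8))
instance : DecidableEq (linQuiver 8).A := inferInstanceAs (DecidableEq (Fin 7))

set_option maxRecDepth 10000 in
lemma a1 : GoodA (n := 0) (m := 2) (r := 3) rfl where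
  pv := by intro a; fin_cases a <;> (repeat first | rfl | refine ⟨rfl, ?_⟩)
  pw := by intro a; exact ⟨rfl, rfl⟩
  pxx := by intro a; fin_cases a <;> (repeat first | rfl | refine ⟨rfl, ?_⟩)
  py := by intro a; fin_cases a <;> (repeat first | rfl | refine ⟨rfl, ?_⟩)
  pc := by intro a; fin_cases a <;> (repeat first | rfl | refine ⟨rfl, ?_⟩)
  src := by intro (j : Fin 7); fin_cases j <;> rfl
  tgt := by intro (j : Fin 7); fin_cases j <;> rfl
  px := by decide
  rel := by decide
  com := by decide
  gv := by intro a; fin_cases a <;> rfl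
  gx := by intro a; fin_cases a <;> rfl
  gvx := rfl
  gy := by intro a; fin_cases a <;> rfl
  gc := by intro a; fin_cases a <;> rfl
  fg := by show ∀ j : Fin 7, _; decide

set_option maxRecDepth 10000 in
lemma b1 : GoodB (n := 0) (m := 2) (r := 3) rfl ![7,2,1,0,3,4,5,6] where
  py := by decide
  ysucc := by decide
  y0 := by decide
  inj := by decide
  adj := by decide +kernel
  asym := by decide +kernel

set_option maxRecDepth 10000 in
lemma a2 : GoodA (n := 0) (m := 4) (r := 1) rfl where
  pv := by intro a; fin_cases a <;> (repeat first | rfl | refine ⟨rfl, ?_⟩)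
  pw := by intro a; exact ⟨rfl, rfl⟩
  pxx := by intro a; fin_cases a <;> (repeat first | rfl | refine ⟨rfl, ?_⟩)
  py := by intro a; fin_cases a <;> (repeat first | rfl | refine ⟨rfl, ?_⟩)
  pc := by intro a; fin_cases a <;> (repeat first | rfl | refine ⟨rfl, ?_⟩)
  src := by intro (j : Fin 7); fin_cases j <;> rfl
  tgt := by intro (j : Fin 7); fin_cases j <;> rfl
  px := by decide
  rel := by decide
  com := by decide
  gv := by intro a; fin_cases a <;> rfl
  gx := by intro a; fin_cases a <;> rfl
  gvx := rfl
  gy := by intro a; fin_cases a <;> rfl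
  gc := by intro a; fin_cases a <;> rfl
  fg := by show ∀ j : Fin 7, _; decide

set_option maxRecDepth 10000 in
lemma b2 : GoodB (n := 0) (m := 4) (r := 1) rfl ![7,2,3,4,5,6,1,0] where
  py := by decide
  ysucc := by decide
  y0 := by decide
  inj := by decide
  adj := by decide +kernel
  asym := by decide +kernel

set_option maxRecDepth 10000 in
lemma a3 : GoodA (n := 1) (m := 1) (r := 3) rfl where
  pv := by intro a; fin_cases a <;> (repeat first | rfl | refine ⟨rfl, ?_⟩)
  pw := by intro a; exact ⟨rfl, rfl⟩
  pxx := by intro a; fin_cases a <;> (repeat first | rfl | refine ⟨rfl, ?_⟩)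
  py := by intro a; fin_cases a <;> (repeat first | rfl | refine ⟨rfl, ?_⟩)
  pc := by intro a; fin_cases a <;> (repeat first | rfl | refine ⟨rfl, ?_⟩)
  src := by intro (j : Fin 7); fin_cases j <;> rfl
  tgt := by intro (j : Fin 7); fin_cases j <;> rfl
  px := by decide
  rel := by decide
  com := by decide
  gv := by intro a; fin_cases a <;> rfl
  gx := by intro a; fin_cases a <;> rfl
  gvx := rfl
  gy := by intro a; fin_cases a <;> rfl
  gc := by intro a; fin_cases a <;> rfl
  fg := by show ∀ j : Fin 7, _; decide

set_option maxRecDepth 10000 in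
lemma b3 : GoodB (n := 1) (m := 1) (r := 3) rfl ![0,1,2,7,3,4,5,6] where
  py := by decide
  ysucc := by decide
  y0 := by decide
  inj := by decide
  adj := by decide +kernel
  asym := by decide +kernel

set_option maxRecDepth 10000 in
lemma a4 : GoodA (n := 1) (m := 4) (r := 0) rfl where
  pv := by intro a; fin_cases a <;> (repeat first | rfl | refine ⟨rfl, ?_⟩)
  pw := by intro a; exact ⟨rfl, rfl⟩
  pxx := by intro a; fin_cases a <;> (repeat first | rfl | refine ⟨rfl, ?_⟩)
  py := by intro a; fin_cases a <;> (repeat first | rfl | refine ⟨rfl, ?_⟩)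
  pc := by intro a; fin_cases a <;> (repeat first | rfl | refine ⟨rfl, ?_⟩)
  src := by intro (j : Fin 7); fin_cases j <;> rfl
  tgt := by intro (j : Fin 7); fin_cases j <;> rfl
  px := by decide
  rel := by decide
  com := by decide
  gv := by intro a; fin_cases a <;> rfl
  gx := by intro a; fin_cases a <;> rfl
  gvx := rfl
  gy := by intro a; fin_cases a <;> rfl
  gc := by intro a; fin_cases a <;> rfl
  fg := by show ∀ j : Fin 7, _; decide

set_option maxRecDepth 10000 in
lemma b4 : GoodB (n := 1) (m := 4) (r := 0) rfl ![0,1,2,3,4,5,6,7] where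
  py := by decide
  ysucc := by decide
  y0 := by decide
  inj := by decide
  adj := by decide +kernel
  asym := by decide +kernel

set_option maxRecDepth 10000 in
lemma a5 : GoodA (n := 3) (m := 1) (r := 1) rfl where
  pv := by intro a; fin_cases a <;> (repeat first | rfl | refine ⟨rfl, ?_⟩)
  pw := by intro a; exact ⟨rfl, rfl⟩
  pxx := by intro a; fin_cases a <;> (repeat first | rfl | refine ⟨rfl, ?_⟩)
  py := by intro a; fin_cases a <;> (repeat first | rfl | refine ⟨rfl, ?_⟩)
  pc := by intro a; fin_cases a <;> (repeat first | rfl | refine ⟨rfl, ?_⟩)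
  src := by intro (j : Fin 7); fin_cases j <;> rfl
  tgt := by intro (j : Fin 7); fin_cases j <;> rfl
  px := by decide
  rel := by decide
  com := by decide
  gv := by intro a; fin_cases a <;> rfl
  gx := by intro a; fin_cases a <;> rfl
  gvx := rfl
  gy := by intro a; fin_cases a <;> rfl
  gc := by intro a; fin_cases a <;> rfl
  fg := by show ∀ j : Fin 7, _; decide

set_option maxRecDepth 10000 in
lemma b5 : GoodB (n := 3) (m := 1) (r := 1) rfl ![6,5,4,3,2,7,1,0] where
  py := by decide
  ysucc := by decide
  y0 := by decide
  inj := by decide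
  adj := by decide +kernel
  asym := by decide +kernel

set_option maxRecDepth 10000 in
lemma a6 : GoodA (n := 3) (m := 2) (r := 0) rfl where
  pv := by intro a; fin_cases a <;> (repeat first | rfl | refine ⟨rfl, ?_⟩)
  pw := by intro a; exact ⟨rfl, rfl⟩
  pxx := by intro a; fin_cases a <;> (repeat first | rfl | refine ⟨rfl, ?_⟩)
  py := by intro a; fin_cases a <;> (repeat first | rfl | refine ⟨rfl, ?_⟩)
  pc := by intro a; fin_cases a <;> (repeat first | rfl | refine ⟨rfl, ?_⟩)
  src := by intro (j : Fin 7); fin_cases j <;> rfl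
  tgt := by intro (j : Fin 7); fin_cases j <;> rfl
  px := by decide
  rel := by decide
  com := by decide
  gv := by intro a; fin_cases a <;> rfl
  gx := by intro a; fin_cases a <;> rfl
  gvx := rfl
  gy := by intro a; fin_cases a <;> rfl
  gc := by intro a; fin_cases a <;> rfl
  fg := by show ∀ j : Fin 7, _; decide

set_option maxRecDepth 10000 in
lemma b6 : GoodB (n := 3) (m := 2) (r := 0) rfl ![6,5,4,3,2,1,0,7] where
  py := by decide
  ysucc := by decide
  y0 := by decide
  inj := by decide
  adj := by decide +kernel
  asym := by decide +kernel

theorem nak_all (p : ℕ × ℕ) (hp : p ∈ e8Data) :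
    ∃ o, IsOrientation dynkinE8 o ∧
      DerivedEquivalent k (NakayamaAlgebra k 8 1 (fun _ => p.1) (fun _ => p.2))
        (PathAlgebra k (orientQuiver (Fin 8) o)) := by
  simp only [e8Data, List.mem_cons, List.not_mem_nil, or_false] at hp
  rcases hp with rfl | rfl | rfl | rfl | rfl | rfl
  · exact deNak rfl _ a1 b1
  · exact deNak rfl _ a2 b2
  · exact deNak rfl _ a3 b3
  · exact deNak rfl _ a4 b4
  · exact deNak rfl _ a5 b5
  · exact deNak rfl _ a6 b6
end
end NakE8

end

section
open CategoryTheory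
open CategoryTheory.Limits CategoryTheory.Pretriangulated

namespace NakE8

section
variable {k : Type} [Field k]

section refl
variable {V : Type} [Fintype V] [DecidableEq V]

def flipO (i : V) (o : V → V → Prop) (v w : V) : Prop :=
  if v = i ∨ w = i then o w v else o v w

open Classical in
/-- The zone of a source reflection. -/
@[reducible] noncomputable def Zr (i : V) (o : V → V → Prop) : Zone where
  V := Empty
  X := Unit
  Y := {v : V // v ≠ i}
  Sg := {w : V // w ≠ i ∧ o i w}
  AV := Empty
  AVX := Empty
  AX := Empty
  AY := {p : V × V // (p.1 ≠ i ∧ p.2 ≠ i) ∧ o p.1 p.2}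
  sV := Empty.elim
  tV := Empty.elim
  sVX := Empty.elim
  tVX := Empty.elim
  sX := Empty.elim
  tX := Empty.elim
  sY p := ⟨p.1.1, p.2.1.1⟩
  tY p := ⟨p.1.2, p.2.1.2⟩
  σ w := ⟨w.1, w.2.1⟩

noncomputable def eR (i : V) (o : V → V → Prop) : (Zr i o).Vx ≃ V :=
  Equiv.ofBijective (fun
    | .inl a => a.elim
    | .inr (.inl _) => i
    | .inr (.inr y) => y.1) (by
    constructor
    · rintro (⟨⟨⟩⟩ | ⟨⟨⟩⟩ | ⟨y, hy⟩) (⟨⟨⟩⟩ | ⟨⟨⟩⟩ | ⟨z, hz⟩) h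
      · rfl
      · exact absurd h.symm hz
      · exact absurd h hy
      · obtain rfl : y = z := h
        rfl
    · intro v
      by_cases h : v = i
      · exact ⟨.inr (.inl ()), h.symm⟩
      · exact ⟨.inr (.inr ⟨v, h⟩), rfl⟩)

theorem de_refl (i : V) (o : V → V → Prop) (hi : ∀ w, ¬ o w i) :
    DerivedEquivalent k (PathAlgebra k (orientQuiver V o))
      (PathAlgebra k (orientQuiver V (flipO i o))) := by
  have h1 : DerivedEquivalent k (GAlg k (Zr i o).QA (Zr i o).RA0 (Zr i o).RA1)
      (PathAlgebra k (orientQuiver V o)) := by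
    refine DE_orient o ?_ ?_ (eR i o) ?_ ?_
    · rintro p ⟨⟨⟩, _⟩
    · rintro p ⟨⟨⟩, _⟩
    · rintro (⟨⟨⟩⟩ | ⟨⟨⟩⟩ | ⟨⟨⟩⟩ | ⟨p, hp⟩ | ⟨⟨⟩, s⟩) (⟨⟨⟩⟩ | ⟨⟨⟩⟩ | ⟨⟨⟩⟩ | ⟨q, hq⟩ | ⟨⟨⟩, s'⟩) h h'
      · have e1 := congrArg (eR i o) h
        have e2 := congrArg (eR i o) h'
        obtain rfl : p = q := Prod.ext e1 e2
        rfl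
      · exact absurd (congrArg (eR i o) h) hp.1.1
      · exact absurd (congrArg (eR i o) h).symm hq.1.1
      · have e2 := congrArg (eR i o) h'
        obtain rfl : s = s' := Subtype.ext e2
        rfl
    · intro v w
      constructor
      · intro h
        have hw : w ≠ i := fun e => hi v (e ▸ h)
        by_cases hv : v = i
        · subst hv
          exact ⟨.c () ⟨w, hw, h⟩, rfl, rfl⟩
        · exact ⟨.yy ⟨(v, w), ⟨hv, hw⟩, h⟩, rfl, rfl⟩
      · rintro ⟨(⟨⟨⟩⟩ | ⟨⟨⟩⟩ | ⟨⟨⟩⟩ | ⟨p, hp⟩ | ⟨⟨⟩, s⟩), rfl, rfl⟩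
        · exact hp.2
        · exact s.2.2
  have h2 : DerivedEquivalent k (GAlg k (Zr i o).QB ∅ (Zr i o).RB1)
      (PathAlgebra k (orientQuiver V (flipO i o))) := by
    refine DE_orient (flipO i o) (fun p => Set.notMem_empty p) ?_ (eR i o) ?_ ?_
    · rintro p ⟨⟨⟩, _⟩
    · rintro (⟨⟨⟩⟩ | ⟨⟨⟩⟩ | ⟨⟨⟩⟩ | ⟨p, hp⟩ | ⟨⟨⟩, s⟩) (⟨⟨⟩⟩ | ⟨⟨⟩⟩ | ⟨⟨⟩⟩ | ⟨q, hq⟩ | ⟨⟨⟩, s'⟩) h h'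
      · have e1 := congrArg (eR i o) h
        have e2 := congrArg (eR i o) h'
        obtain rfl : p = q := Prod.ext e1 e2
        rfl
      · exact absurd (congrArg (eR i o) h') hp.1.2
      · exact absurd (congrArg (eR i o) h').symm hq.1.2
      · have e2 := congrArg (eR i o) h
        obtain rfl : s = s' := Subtype.ext e2
        rfl
    · intro v w
      unfold flipO
      constructor
      · intro h
        split_ifs at h with hc
        · have hv : v ≠ i := fun e => hi w (e ▸ h)
          obtain rfl : w = i := hc.resolve_left hv
          exact ⟨.c () ⟨v, hv, h⟩, rfl, rfl⟩
        · rw [not_or] at hc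
          exact ⟨.yy ⟨(v, w), hc, h⟩, rfl, rfl⟩
      · rintro ⟨(⟨⟨⟩⟩ | ⟨⟨⟩⟩ | ⟨⟨⟩⟩ | ⟨p, hp⟩ | ⟨⟨⟩, s⟩), rfl, rfl⟩
        · rw [if_neg (by rintro (h | h); exacts [hp.1.1 h, hp.1.2 h])]
          exact hp.2
        · rw [if_pos (Or.inr (by rfl))]
          exact s.2.2
  exact DE_trans (DE_symm h1) (DE_trans (DE_zone _ k) h2)
end refl

def par : Fin 8 → Fin 8 := ![1,2,2,2,3,4,5,2]

/-- The orientation of the tree encoded by a boolean function. -/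
def ob (b : Fin 8 → Bool) (v w : Fin 8) : Prop :=
  (v ≠ 2 ∧ par v = w ∧ b v = false) ∨ (w ≠ 2 ∧ par w = v ∧ b w = true)

def E (k : Type) [Field k] (b b' : Fin 8 → Bool) : Prop :=
  DerivedEquivalent k (PathAlgebra k (orientQuiver (Fin 8) (ob b)))
    (PathAlgebra k (orientQuiver (Fin 8) (ob b')))

lemma E.symm {b b'} (h : E k b b') : E k b' b := DE_symm h
lemma E.trans {b b' b''} (h : E k b b') (h' : E k b' b'') : E k b b'' := DE_trans h h'
lemma E.refl (b) : E k b b := DE_of_algEquiv AlgEquiv.refl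

def rf (v : Fin 8) (b : Fin 8 → Bool) (u : Fin 8) : Bool :=
  if u = v ∨ (u ≠ 2 ∧ par u = v) then !b u else b u

def tog (v : Fin 8) (b : Fin 8 → Bool) (u : Fin 8) : Bool :=
  if u = v then !b u else b u

lemma flip_ob (v : Fin 8) (hv : v ≠ 2) (b) : flipO v (ob b) = ob (rf v b) := by
  funext x y
  apply propext
  unfold flipO ob rf
  grind

lemma E_src (v : Fin 8) (hv : v ≠ 2) (b) (h : b v = false)
    (hc : ∀ u, u ≠ 2 → par u = v → b u = true) : E k b (rf v b) := by
  unfold E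
  rw [← flip_ob v hv]
  apply de_refl
  unfold ob
  grind

lemma rf_rf (v : Fin 8) (b) : rf v (rf v b) = b := by
  funext u; unfold rf; cases b u <;> grind
lemma tog_tog (v : Fin 8) (b) : tog v (tog v b) = b := by
  funext u; unfold tog; cases b u <;> grind

lemma E_rf (v : Fin 8) (hv : v ≠ 2) (b)
    (hc : ∀ u, u ≠ 2 → par u = v → b u ≠ b v) : E k b (rf v b) := by
  cases h : b v
  · exact E_src v hv b h (by grind)
  · have : E k (rf v b) (rf v (rf v b)) := by
      apply E_src v hv
      · unfold rf; grind
      · unfold rf; grind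
    rw [rf_rf] at this
    exact this.symm

def Free (k : Type) [Field k] (v : Fin 8) : Prop := ∀ b, E k b (tog v b)

lemma free_leaf (v : Fin 8) (hv : v ≠ 2) (hc : ∀ u, u ≠ 2 → par u ≠ v) : Free k v := by
  intro b
  have := E_rf (k := k) v hv b (fun u h h' => absurd h' (hc u h))
  have e : rf v b = tog v b := by
    funext u; unfold rf tog; cases b u <;> grind
  rwa [e] at this

lemma free_child (v c : Fin 8) (hv : v ≠ 2) (hvc : v ≠ c) (hc : ∀ u, (u ≠ 2 ∧ par u = v) ↔ u = c)
    (hf : Free k c) : Free k v := by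
  intro b
  have e : ∀ b, rf v b = tog c (tog v b) := by
    intro b; funext u; unfold rf tog; cases b u <;> grind
  by_cases h : b c = b v
  · have h1 := E_rf (k := k) v hv (tog c b) (by unfold tog; grind)
    have e' : rf v (tog c b) = tog v b := by
      rw [e]; funext u; unfold tog; cases b u <;> grind
    rw [e'] at h1
    exact (hf b).trans h1
  · have h1 := E_rf (k := k) v hv b (by grind)
    have h2 := h1.trans (hf _)
    rwa [e, tog_tog] at h2

lemma free_all (v : Fin 8) : Free k v := by
  have f6 : Free k 6 := free_leaf 6 (by decide) (by decide)
  have f5 : Free k 5 := free_child 5 6 (by decide) (by decide) (by decide) f6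
  have f4 : Free k 4 := free_child 4 5 (by decide) (by decide) (by decide) f5
  have f3 : Free k 3 := free_child 3 4 (by decide) (by decide) (by decide) f4
  have f7 : Free k 7 := free_leaf 7 (by decide) (by decide)
  have f0 : Free k 0 := free_leaf 0 (by decide) (by decide)
  have f1 : Free k 1 := free_child 1 0 (by decide) (by decide) (by decide) f0
  have f2 : Free k 2 := by
    intro b
    have e : ob b = ob (tog 2 b) := by
      funext x y; unfold ob tog; grind
    unfold E
    rw [← e]
    exact E.refl b
  fin_cases v <;> assumption

lemma E_all (b b' : Fin 8 → Bool) : E k b b' := by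
  have key : ∀ s : Finset (Fin 8), E k b (fun u => if u ∈ s then b' u else b u) := by
    intro s
    induction s using Finset.induction_on with
    | empty => simpa using E.refl b
    | insert a s ha ih =>
      by_cases h : b a = b' a
      · convert ih using 1
        funext u; grind
      · have h2 := ih.trans (free_all a _)
        have h3 : b' a = !b a := by
          cases h4 : b a <;> cases h5 : b' a <;> simp_all
        convert h2 using 1
        funext u; unfold tog; grind
  simpa using key Finset.univ

lemma orient_ob (o : Fin 8 → Fin 8 → Prop) (h : IsOrientation dynkinE8 o) : ∃ b, o = ob b := by
  classical
  refine ⟨fun v => decide (o (par v) v), ?_⟩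
  have adj : ∀ v w, dynkinE8.Adj v w ↔ (v ≠ 2 ∧ par v = w) ∨ (w ≠ 2 ∧ par w = v) := by
    have : ∀ v w : Fin 8, (v ≠ w ∧ (((w.1 = v.1 + 1 ∧ w.1 ≤ 6) ∨ (v.1 = 2 ∧ w.1 = 7)) ∨
      ((v.1 = w.1 + 1 ∧ v.1 ≤ 6) ∨ (w.1 = 2 ∧ v.1 = 7)))) ↔
      (v ≠ 2 ∧ par v = w) ∨ (w ≠ 2 ∧ par w = v) := by decide +kernel
    exact this
  funext v w
  apply propext
  have h1 := h.1 v w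
  have h2 := h.2 v w
  have h3 := h.2 w v
  rw [adj] at h1
  unfold ob
  grind

theorem orient_all (o o' : Fin 8 → Fin 8 → Prop) (h : IsOrientation dynkinE8 o)
    (h' : IsOrientation dynkinE8 o') :
    DerivedEquivalent k (PathAlgebra k (orientQuiver (Fin 8) o))
      (PathAlgebra k (orientQuiver (Fin 8) o')) := by
  obtain ⟨b, rfl⟩ := orient_ob o h
  obtain ⟨b', rfl⟩ := orient_ob o' h'
  exact E_all b b'

end
end NakE8

end

/-- The six linear Nakayama algebras `A_{8,(1)}^{(4)}`, `A_{8,(1)}^{(6)}`,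
`A_{8,(2)}^{(3)}`, `A_{8,(2)}^{(6)}`, `A_{8,(4)}^{(3)}` and `A_{8,(4)}^{(4)}` are pairwise
derived equivalent, and each of them is derived equivalent to the path algebra of any
orientation of the Dynkin tree `E_8`. -/
theorem nakayama_E8 (k : Type) [Field k] :
    (∀ p ∈ e8Data, ∀ q ∈ e8Data,
      DerivedEquivalent k (NakayamaAlgebra k 8 1 (fun _ => p.1) (fun _ => p.2))
        (NakayamaAlgebra k 8 1 (fun _ => q.1) (fun _ => q.2))) ∧
    (∀ p ∈ e8Data, ∀ o : Fin 8 → Fin 8 → Prop, IsOrientation dynkinE8 o →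
      DerivedEquivalent k (NakayamaAlgebra k 8 1 (fun _ => p.1) (fun _ => p.2))
        (PathAlgebra k (orientQuiver (Fin 8) o))) := by
  refine ⟨fun p hp q hq => ?_, fun p hp o ho => ?_⟩
  · obtain ⟨o, ho, h⟩ := NakE8.nak_all (k := k) p hp
    obtain ⟨o', ho', h'⟩ := NakE8.nak_all (k := k) q hq
    exact NakE8.DE_trans h (NakE8.DE_trans (NakE8.orient_all o o' ho ho') (NakE8.DE_symm h'))
  · obtain ⟨o', ho', h⟩ := NakE8.nak_all (k := k) p hp
    exact NakE8.DE_trans h (NakE8.orient_all o' o ho' ho)
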